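/- arXiv:1912.04215 — 2 statements merged into one kernel-verified Lean document; each statement's English description precedes it below -/
import Mathlib

section
/- Occupation time estimate for the Euler–Maruyama process: there exists a constant C ∈ (0,∞) such that for all k ∈ {1,…,m}, all x ∈ ℝ, every n ∈ ℕ with δ = T/n ∈ (0,1), and all ε ∈ (0,∞), it holds that ∫_0^T P( |X^{(δ),x}_t − ζ_k| ≤ ε ) dt ≤ C(1 + x^2)(ε + δ^{1/2}). -/
open MeasureTheory ProbabilityTheory

/-- Grid values of the Euler–Maruyama scheme with step size `δ` and initial value `x`. -/
noncomputable def emGrid {Ω : Type*} (μ σ ρ : ℝ → ℝ) (W N : ℝ → Ω → ℝ)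
    (δ : ℝ) (x : ℝ) : ℕ → Ω → ℝ
  | 0, _ => x
  | (j + 1), ω =>
      emGrid μ σ ρ W N δ x j ω
        + μ (emGrid μ σ ρ W N δ x j ω) * δ
        + σ (emGrid μ σ ρ W N δ x j ω) * (W (((j : ℝ) + 1) * δ) ω - W ((j : ℝ) * δ) ω)
        + ρ (emGrid μ σ ρ W N δ x j ω) * (N (((j : ℝ) + 1) * δ) ω - N ((j : ℝ) * δ) ω)

/-- The last grid point `t̲ = δ ⌊t/δ⌋` before time `t`. -/
noncomputable def lastGrid (δ t : ℝ) : ℝ := (⌊t / δ⌋.toNat : ℝ) * δ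

/-- The continuous-time Euler–Maruyama scheme
`X_t = X_t̲ + μ(X_t̲)(t - t̲) + σ(X_t̲)(W_t - W_t̲) + ρ(X_t̲)(N_t - N_t̲)`. -/
noncomputable def emProc {Ω : Type*} (μ σ ρ : ℝ → ℝ) (W N : ℝ → Ω → ℝ)
    (δ : ℝ) (x : ℝ) (t : ℝ) (ω : Ω) : ℝ :=
  emGrid μ σ ρ W N δ x (⌊t / δ⌋.toNat) ω
    + μ (emGrid μ σ ρ W N δ x (⌊t / δ⌋.toNat) ω) * (t - lastGrid δ t)
    + σ (emGrid μ σ ρ W N δ x (⌊t / δ⌋.toNat) ω) * (W t ω - W (lastGrid δ t) ω)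
    + ρ (emGrid μ σ ρ W N δ x (⌊t / δ⌋.toNat) ω) * (N t ω - N (lastGrid δ t) ω)


lemma aux_poisson_hasSum (r : NNReal) :
    HasSum (fun n : ℕ => Real.exp (-r) * r ^ n / (n.factorial : ℝ) * (n : ℝ) ^ 2) ((r : ℝ) ^ 2 + r) := by
  have h0 := hasSum_one_poissonMeasure r
  have h1 : HasSum (fun n : ℕ => Real.exp (-r) * r ^ n / (n.factorial : ℝ) * (n : ℝ)) (r : ℝ) := by
    rw [← hasSum_nat_add_iff' 1]
    have := h0.mul_left (r : ℝ)
    simp only [mul_one] at this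
    convert this using 1
    · rfl
    · ext n
      rw [Nat.factorial_succ]
      push_cast
      field_simp
      try ring
    · simp
  rw [← hasSum_nat_add_iff' 1]
  have := (h1.mul_left (r : ℝ)).add (h0.mul_left (r : ℝ))
  convert this using 1
  · rfl
  · ext n
    rw [Nat.factorial_succ]
    push_cast
    field_simp
    try ring
  · simp; ring

lemma aux_poisson_integral {Ω : Type*} {m0 : MeasurableSpace Ω} (P : Measure Ω)
    (V : Ω → ℝ) (hV : Measurable V) (r : NNReal)
    (h : Measure.map V P = Measure.map (fun k : ℕ => (k : ℝ)) (poissonMeasure r)) :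
    Integrable (fun ω => (V ω) ^ 2) P ∧ ∫ ω, (V ω) ^ 2 ∂P = (r : ℝ) ^ 2 + r ∧
      ∀ᵐ ω ∂P, ∃ k : ℕ, V ω = k := by
  have hs := aux_poisson_hasSum r
  have hm : Measurable (fun k : ℕ => (k : ℝ)) := measurable_from_top
  have hq : Measurable (fun x : ℝ => x ^ 2) := by fun_prop
  refine ⟨?_, ?_, ?_⟩
  · have : Integrable (fun x : ℝ => x ^ 2) (Measure.map V P) := by
      rw [h, integrable_map_measure hq.aestronglyMeasurable hm.aemeasurable,
        integrable_poissonMeasure_iff]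
      convert hs.summable using 1
      ext n
      simp
    exact (integrable_map_measure hq.aestronglyMeasurable hV.aemeasurable).1 this
  · rw [← integral_map (f := fun x : ℝ => x ^ 2) hV.aemeasurable hq.aestronglyMeasurable, h,
      integral_map hm.aemeasurable hq.aestronglyMeasurable, integral_poissonMeasure]
    exact hs.tsum_eq
  · have hms : MeasurableSet {x : ℝ | ∃ k : ℕ, x = (k : ℝ)} := by
      have : {x : ℝ | ∃ k : ℕ, x = (k : ℝ)} = Set.range (fun k : ℕ => (k : ℝ)) := by
        ext x; simp [eq_comm]
      rw [this]
      exact (Set.countable_range _).measurableSet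
    have : ∀ᵐ x ∂(Measure.map V P), ∃ k : ℕ, x = (k : ℝ) := by
      rw [h, ae_map_iff hm.aemeasurable hms]
      exact Filter.Eventually.of_forall fun k => ⟨k, rfl⟩
    exact (ae_map_iff hV.aemeasurable hms).1 this

lemma aux_gauss_map (s : ℝ) (hs : 0 ≤ s) :
    gaussianReal 0 (Real.toNNReal s) = (gaussianReal 0 1).map (fun z => Real.sqrt s * z) := by
  rw [gaussianReal_map_const_mul]
  congr 1
  · simp
  · ext; simp [Real.sq_sqrt hs, hs]

lemma aux_gauss_integral {Ω : Type*} {m0 : MeasurableSpace Ω} (P : Measure Ω)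
    (U : Ω → ℝ) (hU : Measurable U) (s : ℝ) (hs : 0 ≤ s)
    (h : Measure.map U P = gaussianReal 0 (Real.toNNReal s)) (g : ℝ → ℝ) (hg : Measurable g) :
    (Integrable (fun ω => g (U ω)) P ↔ Integrable (fun z => g (Real.sqrt s * z)) (gaussianReal 0 1))
    ∧ ∫ ω, g (U ω) ∂P = ∫ z, g (Real.sqrt s * z) ∂(gaussianReal 0 1) := by
  have hm : Measurable (fun z : ℝ => Real.sqrt s * z) := by fun_prop
  rw [aux_gauss_map s hs] at h
  constructor
  · have h1 := integrable_map_measure (μ := P) (f := U) (g := g) hg.aestronglyMeasurable hU.aemeasurable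
    have h2 := integrable_map_measure (μ := gaussianReal 0 1) (f := fun z : ℝ => Real.sqrt s * z)
      (g := g) hg.aestronglyMeasurable hm.aemeasurable
    rw [h] at h1
    exact h1.symm.trans h2
  · rw [← integral_map (f := g) hU.aemeasurable hg.aestronglyMeasurable, h,
      integral_map hm.aemeasurable hg.aestronglyMeasurable]

lemma aux_gauss_pow (p : ℕ) : Integrable (fun z : ℝ => |z| ^ p) (gaussianReal 0 1) := by
  have := (memLp_id_gaussianReal (μ := 0) (v := 1) (p : NNReal)).integrable_norm_pow'
  simpa using this

lemma aux_gauss_cube : Integrable (fun z : ℝ => (1 + |z|) ^ 3) (gaussianReal 0 1) := by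
  have h : (fun z : ℝ => (1 + |z|) ^ 3)
      = fun z => 1 + 3 * |z| ^ 1 + 3 * |z| ^ 2 + |z| ^ 3 := by ext z; ring
  rw [h]
  exact (((integrable_const _).add ((aux_gauss_pow 1).const_mul 3)).add
    ((aux_gauss_pow 2).const_mul 3)).add (aux_gauss_pow 3)

lemma aux_gauss_sq : ∫ z : ℝ, z ^ 2 ∂(gaussianReal 0 1) = 1 := by
  have h := variance_id_gaussianReal (μ := 0) (v := 1)
  rw [variance_of_integral_eq_zero (by fun_prop) (by simp [integral_id_gaussianReal])] at h
  simpa using h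

lemma aux_gauss_G (K : ℝ) (hK : 0 ≤ K) :
    Integrable (fun z : ℝ => z ^ 2 / (1 + K * |z|)) (gaussianReal 0 1) ∧
    0 < ∫ z : ℝ, z ^ 2 / (1 + K * |z|) ∂(gaussianReal 0 1) := by
  have hint : Integrable (fun z : ℝ => z ^ 2 / (1 + K * |z|)) (gaussianReal 0 1) := by
    refine (aux_gauss_pow 2).mono' (Measurable.aestronglyMeasurable (by fun_prop)) ?_
    refine Filter.Eventually.of_forall fun z => ?_
    have h1 : 1 ≤ 1 + K * |z| := by have := mul_nonneg hK (abs_nonneg z); linarith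
    rw [Real.norm_of_nonneg (by positivity), sq_abs]
    exact div_le_self (sq_nonneg z) h1
  refine ⟨hint, ?_⟩
  have hnn : 0 ≤ fun z : ℝ => z ^ 2 / (1 + K * |z|) := fun z => by simp only [Pi.zero_apply]; positivity
  rw [integral_pos_iff_support_of_nonneg hnn hint]
  have hne : (1 : NNReal) ≠ 0 := one_ne_zero
  have : NullSingletonClass (gaussianReal 0 1) := nullSingletonClass_gaussianReal hne
  have hsup : Function.support (fun z : ℝ => z ^ 2 / (1 + K * |z|)) = {0}ᶜ := by
    ext z
    have h1 : 1 + K * |z| ≠ 0 := by positivity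
    simp [h1]
  rw [hsup, prob_compl_eq_one_sub (measurableSet_singleton 0), measure_singleton]
  simp

lemma aux_sqrt_taylor (a u h : ℝ) (ha : 0 < a) :
    Real.sqrt (a ^ 2 + u ^ 2) + u / Real.sqrt (a ^ 2 + u ^ 2) * h
      + h ^ 2 * a ^ 2 / (2 * Real.sqrt (a ^ 2 + u ^ 2) ^ 2 * (Real.sqrt (a ^ 2 + u ^ 2) + |h|))
      ≤ Real.sqrt (a ^ 2 + (u + h) ^ 2) := by
  set A := Real.sqrt (a ^ 2 + u ^ 2) with hA
  set B := Real.sqrt (a ^ 2 + (u + h) ^ 2) with hB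
  have hA2 : A ^ 2 = a ^ 2 + u ^ 2 := Real.sq_sqrt (by positivity)
  have hB2 : B ^ 2 = a ^ 2 + (u + h) ^ 2 := Real.sq_sqrt (by positivity)
  have hApos : 0 < A := Real.sqrt_pos.2 (by positivity)
  have hBpos : 0 < B := Real.sqrt_pos.2 (by positivity)
  have huA : |u| ≤ A := by
    rw [← Real.sqrt_sq_eq_abs]; exact Real.sqrt_le_sqrt (by nlinarith)
  have hBA : B ≤ A + |h| := by
    apply Real.sqrt_le_iff.2
    refine ⟨by positivity, ?_⟩
    have h1 : u * h ≤ A * |h| := by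
      calc u * h ≤ |u * h| := le_abs_self _
        _ = |u| * |h| := abs_mul _ _
        _ ≤ A * |h| := by gcongr
    nlinarith [sq_abs h]
  set t := A + u / A * h with ht
  have htB : B ^ 2 - t ^ 2 = h ^ 2 * a ^ 2 / A ^ 2 := by
    have e : t ^ 2 = A ^ 2 + 2 * u * h + u ^ 2 * h ^ 2 / A ^ 2 := by
      rw [ht]; field_simp; ring
    have e2 : h ^ 2 * a ^ 2 / A ^ 2 = h ^ 2 - u ^ 2 * h ^ 2 / A ^ 2 := by
      field_simp; rw [hA2]; ring
    rw [e, e2, hB2, hA2]; ring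
  have htle : t ≤ B := by
    have h0 : 0 ≤ h ^ 2 * a ^ 2 / A ^ 2 := by positivity
    exact abs_le_of_sq_le_sq' (by linarith) hBpos.le |>.2
  have hD : (B - t) * (2 * (A + |h|)) ≥ h ^ 2 * a ^ 2 / A ^ 2 := by
    rw [← htB]
    have : B ^ 2 - t ^ 2 = (B - t) * (B + t) := by ring
    rw [this]
    exact mul_le_mul_of_nonneg_left (by linarith) (by linarith)
  have hpos : 0 < A + |h| := by positivity
  have : h ^ 2 * a ^ 2 / (2 * A ^ 2 * (A + |h|)) ≤ B - t := by
    rw [div_le_iff₀ (by positivity)]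
    rw [ge_iff_le, div_le_iff₀ (by positivity)] at hD
    linarith
  linarith

lemma aux_sqrt_lip (a u e : ℝ) :
    Real.sqrt (a ^ 2 + u ^ 2) - |e| ≤ Real.sqrt (a ^ 2 + (u + e) ^ 2) := by
  set B := Real.sqrt (a ^ 2 + (u + e) ^ 2) with hB
  have hB0 : 0 ≤ B := Real.sqrt_nonneg _
  have hB2 : B ^ 2 = a ^ 2 + (u + e) ^ 2 := Real.sq_sqrt (by positivity)
  have huB : |u + e| ≤ B := by
    rw [← Real.sqrt_sq_eq_abs]; exact Real.sqrt_le_sqrt (by nlinarith)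
  have : Real.sqrt (a ^ 2 + u ^ 2) ≤ B + |e| := by
    apply Real.sqrt_le_iff.2
    refine ⟨by positivity, ?_⟩
    have h1 : -((u + e) * e) ≤ B * |e| := by
      calc -((u + e) * e) ≤ |(u + e) * e| := neg_le_abs _
        _ = |u + e| * |e| := abs_mul _ _
        _ ≤ B * |e| := by gcongr
    nlinarith [sq_abs e]
  linarith

/-- pointwise one-step inequality for the test function -/
lemma aux_f_step (a u m s r δ q K U V : ℝ) (ha : 0 < a) (hδ : 0 < δ) (hK : 0 ≤ K) (hq : 0 < q)
    (hs : |s| * q ≤ K * Real.sqrt (a ^ 2 + u ^ 2)) :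
    Real.sqrt (a ^ 2 + u ^ 2) + (u / Real.sqrt (a ^ 2 + u ^ 2) * s) * U
      + (s ^ 2 * a ^ 2 / (2 * Real.sqrt (a ^ 2 + u ^ 2) ^ 3)) * (U ^ 2 / (1 + K * (|U| / q)))
      - |m| * δ - |r| * |V|
      ≤ Real.sqrt (a ^ 2 + (u + m * δ + s * U + r * V) ^ 2) := by
  have h1 := aux_sqrt_taylor a u (s * U) ha
  have h2 := aux_sqrt_lip a (u + s * U) (m * δ + r * V)
  have h3 : |m * δ + r * V| ≤ |m| * δ + |r| * |V| := by
    calc _ ≤ |m * δ| + |r * V| := abs_add_le _ _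
      _ = _ := by rw [abs_mul, abs_mul, abs_of_pos hδ]
  have e : u + s * U + (m * δ + r * V) = u + m * δ + s * U + r * V := by ring
  rw [e] at h2
  set A := Real.sqrt (a ^ 2 + u ^ 2) with hA
  have hApos : 0 < A := Real.sqrt_pos.2 (by positivity)
  have h4 : (s ^ 2 * a ^ 2 / (2 * A ^ 3)) * (U ^ 2 / (1 + K * (|U| / q)))
      ≤ (s * U) ^ 2 * a ^ 2 / (2 * A ^ 2 * (A + |s * U|)) := by
    have hden : A + |s * U| ≤ A * (1 + K * (|U| / q)) := by
      have : |s| * |U| ≤ A * K * (|U| / q) := by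
        have := mul_le_mul_of_nonneg_right hs (show 0 ≤ |U| / q by positivity)
        calc |s| * |U| = |s| * q * (|U| / q) := by field_simp
          _ ≤ K * A * (|U| / q) := this
          _ = _ := by ring
      rw [abs_mul]; linarith
    have hp : 0 < 1 + K * (|U| / q) := by positivity
    calc _ = (s * U) ^ 2 * a ^ 2 / (2 * A ^ 2 * (A * (1 + K * (|U| / q)))) := by
          rw [div_mul_div_comm]; congr 1 <;> ring
      _ ≤ _ := by
          apply div_le_div_of_nonneg_left (by positivity) (by positivity)
          gcongr
  have e5 : u / A * (s * U) = u / A * s * U := by ring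
  rw [e5] at h1
  linarith

lemma aux_w_bound (a u s s0 Ls : ℝ) (ha : 0 < a) (ha1 : a ≤ 1)
    (hs : |s - s0| ≤ Ls * |u|) :
    s0 ^ 2 * (a ^ 3 / Real.sqrt (a ^ 2 + u ^ 2) ^ 3)
      ≤ 4 * a * (s ^ 2 * a ^ 2 / (2 * Real.sqrt (a ^ 2 + u ^ 2) ^ 3)) + 2 * Ls ^ 2 * a := by
  set A := Real.sqrt (a ^ 2 + u ^ 2) with hA
  have hApos : 0 < A := Real.sqrt_pos.2 (by positivity)
  have hA2 : A ^ 2 = a ^ 2 + u ^ 2 := Real.sq_sqrt (by positivity)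
  have haA : a ≤ A := Real.le_sqrt_of_sq_le (by nlinarith)
  have h1 : s0 ^ 2 ≤ 2 * s ^ 2 + 2 * Ls ^ 2 * u ^ 2 := by
    have : (s - s0) ^ 2 ≤ Ls ^ 2 * u ^ 2 := by
      rw [← sq_abs (s - s0), ← sq_abs u, ← mul_pow]
      exact pow_le_pow_left₀ (abs_nonneg _) hs 2
    nlinarith [sq_nonneg (2 * s - s0)]
  have h2 : u ^ 2 * (a ^ 3 / A ^ 3) ≤ a := by
    calc u ^ 2 * (a ^ 3 / A ^ 3) ≤ A ^ 2 * (a ^ 3 / A ^ 3) := by exact mul_le_mul_of_nonneg_right (by nlinarith) (by positivity)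
      _ = a ^ 2 * (a / A) := by field_simp
      _ ≤ a ^ 2 * 1 := by gcongr; exact (div_le_one hApos).2 haA
      _ ≤ a := by nlinarith
  have h3 := mul_le_mul_of_nonneg_right h1 (show 0 ≤ a ^ 3 / A ^ 3 by positivity)
  have h4 : 4 * a * (s ^ 2 * a ^ 2 / (2 * A ^ 3)) = 2 * s ^ 2 * (a ^ 3 / A ^ 3) := by
    field_simp; ring
  rw [h4]
  nlinarith [mul_le_mul_of_nonneg_left h2 (show 0 ≤ 2 * Ls ^ 2 by positivity)]

/-- pointwise bound between grid points -/
lemma aux_offgrid (a u m s r δ t ε K U V : ℝ) (hδ : 0 < δ) (hδ1 : δ < 1) (hε : 0 < ε)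
    (hae : a = ε + Real.sqrt δ)
    (hK : 1 ≤ K) (hm : |m| ≤ K * (1 + |u|)) (hs : |s| ≤ K * (1 + |u|)) (ht : 0 ≤ t) (htδ : t ≤ δ)
    (hV : ∃ k : ℕ, V = k) (hX : |u + m * t + s * U + r * V| ≤ ε) :
    1 ≤ V ^ 2 + 216 * K ^ 3 * ((1 + |U| / Real.sqrt δ) ^ 3
      * (a ^ 3 / Real.sqrt (a ^ 2 + u ^ 2) ^ 3 + a)) := by
  set q := Real.sqrt δ with hq
  have hqpos : 0 < q := Real.sqrt_pos.2 hδ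
  have hq2 : q ^ 2 = δ := Real.sq_sqrt hδ.le
  have hq1 : q ≤ 1 := by nlinarith
  set A := Real.sqrt (a ^ 2 + u ^ 2) with hA
  have ha : 0 < a := by linarith
  have hApos : 0 < A := Real.sqrt_pos.2 (by positivity)
  have hA2 : A ^ 2 = a ^ 2 + u ^ 2 := Real.sq_sqrt (by positivity)
  set z := |U| / q with hz
  have hz0 : 0 ≤ z := by positivity
  have hU : |U| = z * q := by rw [hz]; field_simp
  have hw0 : 0 ≤ a ^ 3 / A ^ 3 := by positivity
  have hz1 : 1 ≤ (1 + z) ^ 3 := one_le_pow₀ (by linarith)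
  obtain ⟨k, rfl⟩ := hV
  rcases Nat.eq_zero_or_pos k with hk | hk
  · subst hk
    have hd : |u| ≤ ε + K * (1 + |u|) * (q * q) + K * (1 + |u|) * (z * q) := by
      have e : u = (u + m * t + s * U + r * ((0 : ℕ) : ℝ)) - m * t - s * U := by
        push_cast; ring
      calc |u| = |(u + m * t + s * U + r * ((0 : ℕ) : ℝ)) - m * t - s * U| := by rw [← e]
        _ ≤ |(u + m * t + s * U + r * ((0 : ℕ) : ℝ))| + |m * t| + |s * U| := by
            refine (abs_sub _ _).trans ?_
            gcongr
            exact abs_sub _ _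
        _ ≤ _ := by
            rw [abs_mul, abs_mul, hU, abs_of_nonneg ht]
            have : t ≤ q * q := by nlinarith
            gcongr
    have hAad : A ≤ a + |u| := by
      apply Real.sqrt_le_iff.2
      refine ⟨by positivity, ?_⟩
      have := mul_nonneg ha.le (abs_nonneg u)
      nlinarith [sq_abs u]
    have huA : |u| ≤ A := by
      rw [← Real.sqrt_sq_eq_abs]; exact Real.sqrt_le_sqrt (by nlinarith)
    have hqa : q ≤ a := by linarith
    have hqq : q * q ≤ a := by nlinarith
    have hA3 : A ≤ a * (2 + K + K * z) + K * A * (a * (1 + z)) := by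
      have i1 : K * (1 + |u|) * (q * q) ≤ K * (1 + A) * a := by gcongr
      have i2 : K * (1 + |u|) * (z * q) ≤ K * (1 + A) * (z * a) := by gcongr
      have : ε ≤ a := by linarith
      linarith
    have hK3 : 1 ≤ K ^ 3 := one_le_pow₀ hK
    rcases le_total (K * (a * (1 + z))) (1 / 2) with hc | hc
    · have hA4 : A ≤ 6 * K * (1 + z) * a := by
        have : A * (K * (a * (1 + z))) ≤ A * (1 / 2) := mul_le_mul_of_nonneg_left hc hApos.le
        have h5 : A ≤ 2 * (a * (2 + K + K * z)) := by linarith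
        have h6 : 2 + K + K * z ≤ 3 * K * (1 + z) := by
          have : 0 ≤ K * z := by positivity
          linarith
        have h7 : a * (2 + K + K * z) ≤ a * (3 * K * (1 + z)) :=
          mul_le_mul_of_nonneg_left h6 ha.le
        linarith
      have h7 : A ^ 3 ≤ (6 * K * (1 + z) * a) ^ 3 := pow_le_pow_left₀ hApos.le hA4 3
      have h8 : 1 ≤ 216 * K ^ 3 * (1 + z) ^ 3 * (a ^ 3 / A ^ 3) := by
        rw [← mul_div_assoc, le_div_iff₀ (by positivity)]
        calc 1 * A ^ 3 ≤ (6 * K * (1 + z) * a) ^ 3 := by linarith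
          _ = _ := by ring
      have : 0 ≤ 216 * K ^ 3 * (1 + z) ^ 3 * a := by positivity
      push_cast
      linarith
    · have h8 : 1 ≤ 216 * K ^ 3 * ((1 + z) ^ 3 * a) := by
        have h9 : K * (a * (1 + z)) ≤ K ^ 3 * ((1 + z) ^ 3 * a) := by
          have : 1 + z ≤ (1 + z) ^ 3 := le_self_pow₀ (by linarith) (by norm_num)
          have : K ≤ K ^ 3 := le_self_pow₀ (by linarith) (by norm_num)
          rw [mul_comm a]
          gcongr
        linarith
      have : 0 ≤ 216 * K ^ 3 * ((1 + z) ^ 3 * (a ^ 3 / A ^ 3)) := by positivity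
      push_cast
      linarith
  · have : (1 : ℝ) ≤ (k : ℝ) := by exact_mod_cast hk
    have h1 : (1 : ℝ) ≤ (k : ℝ) ^ 2 := one_le_pow₀ this
    have : 0 ≤ 216 * K ^ 3 * ((1 + z) ^ 3 * (a ^ 3 / A ^ 3 + a)) := by positivity
    linarith

lemma aux_sq_step (y m s r δ L U V : ℝ) (hδ : 0 < δ) (hδ1 : δ < 1) (hL : 0 ≤ L)
    (hm : |m| ≤ L * (1 + |y|)) (hs : |s| ≤ L * (1 + |y|)) (hr : |r| ≤ L * (1 + |y|))
    (hV : ∃ k : ℕ, V = k) :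
    (y + m * δ + s * U + r * V) ^ 2 ≤ y ^ 2 + (2 * y * s) * U
      + (4 * L + 6 * L ^ 2) * ((1 + y ^ 2) * (δ + U ^ 2 + V ^ 2)) := by
  have hVV : |V| ≤ V ^ 2 ∧ 0 ≤ V := by
    obtain ⟨k, rfl⟩ := hV
    rcases Nat.eq_zero_or_pos k with hk | hk
    · subst hk; simp
    · have : (1 : ℝ) ≤ (k : ℝ) := by exact_mod_cast hk
      refine ⟨?_, by positivity⟩
      rw [abs_of_pos (by linarith)]
      nlinarith
  have hy1 : |y| * (1 + |y|) ≤ 2 * (1 + y ^ 2) := by nlinarith [sq_abs y, abs_nonneg y]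
  have hy2 : (1 + |y|) ^ 2 ≤ 2 * (1 + y ^ 2) := by nlinarith [sq_abs y, abs_nonneg y, sq_nonneg (1 - |y|)]
  have hsq : ∀ c : ℝ, |c| ≤ L * (1 + |y|) → c ^ 2 ≤ 2 * L ^ 2 * (1 + y ^ 2) := by
    intro c hc
    have h1 : c ^ 2 ≤ (L * (1 + |y|)) ^ 2 := by
      rw [← sq_abs c]; exact pow_le_pow_left₀ (abs_nonneg _) hc 2
    have h2 : (L * (1 + |y|)) ^ 2 ≤ L ^ 2 * (2 * (1 + y ^ 2)) := by
      rw [mul_pow]; gcongr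
    linarith
  have hab : ∀ c : ℝ, |c| ≤ L * (1 + |y|) → |y * c| ≤ 2 * L * (1 + y ^ 2) := by
    intro c hc
    rw [abs_mul]
    calc |y| * |c| ≤ |y| * (L * (1 + |y|)) := by gcongr
      _ = L * (|y| * (1 + |y|)) := by ring
      _ ≤ L * (2 * (1 + y ^ 2)) := by gcongr
      _ = _ := by ring
  have t1 : y * m * δ ≤ 2 * L * (1 + y ^ 2) * δ := by
    exact mul_le_mul_of_nonneg_right ((le_abs_self _).trans (hab m hm)) hδ.le
  have t2 : y * r * V ≤ 2 * L * (1 + y ^ 2) * V ^ 2 := by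
    calc y * r * V ≤ |y * r| * |V| := by rw [← abs_mul]; exact le_abs_self _
      _ ≤ _ := by
        gcongr
        · exact hab r hr
        · exact hVV.1
  have t3 : (m * δ + s * U + r * V) ^ 2 ≤ 3 * (m ^ 2 * δ ^ 2 + s ^ 2 * U ^ 2 + r ^ 2 * V ^ 2) := by
    nlinarith [sq_nonneg (m * δ - s * U), sq_nonneg (m * δ - r * V), sq_nonneg (s * U - r * V)]
  have t4 : m ^ 2 * δ ^ 2 ≤ 2 * L ^ 2 * (1 + y ^ 2) * δ := by
    have : δ ^ 2 ≤ δ := by nlinarith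
    gcongr
    exact hsq m hm
  have t5 : s ^ 2 * U ^ 2 ≤ 2 * L ^ 2 * (1 + y ^ 2) * U ^ 2 := by gcongr; exact hsq s hs
  have t6 : r ^ 2 * V ^ 2 ≤ 2 * L ^ 2 * (1 + y ^ 2) * V ^ 2 := by gcongr; exact hsq r hr
  have t7 : 0 ≤ L * (1 + y ^ 2) * U ^ 2 := by positivity
  have e : (y + m * δ + s * U + r * V) ^ 2 = y ^ 2 + (2 * y * s) * U + 2 * (y * m * δ)
      + 2 * (y * r * V) + (m * δ + s * U + r * V) ^ 2 := by ring
  rw [e]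
  linarith

lemma aux_indep {Ω : Type*} {m0 : MeasurableSpace Ω} (P : Measure Ω)
    (Y U : Ω → ℝ) (hYU : IndepFun Y U P) (φ ψ : ℝ → ℝ) (hφ : Measurable φ) (hψ : Measurable ψ)
    (h1 : Integrable (fun ω => φ (Y ω)) P) (h2 : Integrable (fun ω => ψ (U ω)) P) :
    Integrable (fun ω => φ (Y ω) * ψ (U ω)) P ∧
    ∫ ω, φ (Y ω) * ψ (U ω) ∂P = (∫ ω, φ (Y ω) ∂P) * ∫ ω, ψ (U ω) ∂P := by
  have h := hYU.comp hφ hψ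
  exact ⟨h.integrable_mul h1 h2,
    h.integral_fun_mul_eq_mul_integral h1.aestronglyMeasurable h2.aestronglyMeasurable⟩

lemma aux_moment_step {Ω : Type*} {m0 : MeasurableSpace Ω} (P : Measure Ω) [IsProbabilityMeasure P]
    (Y U V : Ω → ℝ) (hY : Measurable Y) (hU : Measurable U) (hV : Measurable V)
    (hYU : IndepFun Y U P) (hYV : IndepFun Y V P)
    (μ σ ρ : ℝ → ℝ) (hμ_meas : Measurable μ) (hσ_meas : Measurable σ) (hρ_meas : Measurable ρ)
    (δ c L : ℝ) (hδ : 0 < δ) (hδ1 : δ < 1) (hL : 0 ≤ L)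
    (hμ : ∀ y, |μ y| ≤ L * (1 + |y|)) (hσ : ∀ y, |σ y| ≤ L * (1 + |y|))
    (hρ : ∀ y, |ρ y| ≤ L * (1 + |y|))
    (hU1 : Integrable U P) (hU0 : ∫ ω, U ω ∂P = 0)
    (hU2 : Integrable (fun ω => U ω ^ 2) P) (hU2e : ∫ ω, U ω ^ 2 ∂P = δ)
    (hV2 : Integrable (fun ω => V ω ^ 2) P) (hV2e : ∫ ω, V ω ^ 2 ∂P ≤ c * δ)
    (hVn : ∀ᵐ ω ∂P, ∃ k : ℕ, V ω = k) (hY2 : Integrable (fun ω => Y ω ^ 2) P) :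
    Integrable (fun ω => (Y ω + μ (Y ω) * δ + σ (Y ω) * U ω + ρ (Y ω) * V ω) ^ 2) P ∧
    ∫ ω, (1 + (Y ω + μ (Y ω) * δ + σ (Y ω) * U ω + ρ (Y ω) * V ω) ^ 2) ∂P
      ≤ (1 + (4 * L + 6 * L ^ 2) * (2 + c) * δ) * ∫ ω, (1 + Y ω ^ 2) ∂P := by
  have hbd : ∀ y : ℝ, |2 * y * σ y| ≤ 4 * L * (1 + y ^ 2) := by
    intro y
    rw [abs_mul, abs_mul, abs_two]
    have h1 : |y| * (1 + |y|) ≤ 2 * (1 + y ^ 2) := by nlinarith [sq_abs y, abs_nonneg y]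
    calc 2 * |y| * |σ y| ≤ 2 * |y| * (L * (1 + |y|)) := by gcongr; exact hσ y
      _ = 2 * L * (|y| * (1 + |y|)) := by ring
      _ ≤ 2 * L * (2 * (1 + y ^ 2)) := by gcongr
      _ = _ := by ring
  have hI1 : Integrable (fun ω => 1 + Y ω ^ 2) P := (integrable_const _).add hY2
  have hI2 : Integrable (fun ω => 2 * Y ω * σ (Y ω)) P := by
    refine (hI1.const_mul (4 * L)).mono' (Measurable.aestronglyMeasurable (by fun_prop)) ?_
    exact Filter.Eventually.of_forall fun ω => hbd (Y ω)
  obtain ⟨hA, hAe⟩ := aux_indep P Y U hYU (fun y => 2 * y * σ y) (fun u => u) (by fun_prop)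
    (by fun_prop) hI2 hU1
  obtain ⟨hB, hBe⟩ := aux_indep P Y U hYU (fun y => 1 + y ^ 2) (fun u => u ^ 2) (by fun_prop)
    (by fun_prop) hI1 hU2
  obtain ⟨hC, hCe⟩ := aux_indep P Y V hYV (fun y => 1 + y ^ 2) (fun u => u ^ 2) (by fun_prop)
    (by fun_prop) hI1 hV2
  set D := 4 * L + 6 * L ^ 2 with hD
  have hD0 : 0 ≤ D := by positivity
  have hR1 : Integrable (fun ω => δ * (1 + Y ω ^ 2) + (1 + Y ω ^ 2) * U ω ^ 2) P :=
    (hI1.const_mul δ).add hB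
  have hR2 : Integrable (fun ω => δ * (1 + Y ω ^ 2) + (1 + Y ω ^ 2) * U ω ^ 2
    + (1 + Y ω ^ 2) * V ω ^ 2) P := hR1.add hC
  have hR3 : Integrable (fun ω => (1 + Y ω ^ 2) + (2 * Y ω * σ (Y ω)) * U ω) P := hI1.add hA
  have hR : Integrable (fun ω => ((1 + Y ω ^ 2) + (2 * Y ω * σ (Y ω)) * U ω) +
     D * (δ * (1 + Y ω ^ 2) + (1 + Y ω ^ 2) * U ω ^ 2 + (1 + Y ω ^ 2) * V ω ^ 2)) P :=
    hR3.add (hR2.const_mul D)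
  have hle : ∀ᵐ ω ∂P, 1 + (Y ω + μ (Y ω) * δ + σ (Y ω) * U ω + ρ (Y ω) * V ω) ^ 2 ≤
     ((1 + Y ω ^ 2) + (2 * Y ω * σ (Y ω)) * U ω) +
     D * (δ * (1 + Y ω ^ 2) + (1 + Y ω ^ 2) * U ω ^ 2 + (1 + Y ω ^ 2) * V ω ^ 2) := by
    filter_upwards [hVn] with ω hω
    have := aux_sq_step (Y ω) (μ (Y ω)) (σ (Y ω)) (ρ (Y ω)) δ L (U ω) (V ω) hδ hδ1 hL
      (hμ _) (hσ _) (hρ _) hω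
    rw [← hD] at this
    nlinarith
  have hint : Integrable (fun ω => (Y ω + μ (Y ω) * δ + σ (Y ω) * U ω + ρ (Y ω) * V ω) ^ 2) P := by
    refine hR.mono' (Measurable.aestronglyMeasurable (by fun_prop)) ?_
    filter_upwards [hle] with ω hω
    rw [Real.norm_of_nonneg (by positivity)]
    linarith
  refine ⟨hint, ?_⟩
  refine (integral_mono_ae ((integrable_const _).add hint) hR hle).trans ?_
  rw [integral_add hR3 (hR2.const_mul D), integral_add hI1 hA, integral_const_mul,
    integral_add hR1 hC, integral_add (hI1.const_mul δ) hB, integral_const_mul, hAe, hBe, hCe,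
    hU0, hU2e]
  have hpos : 0 ≤ ∫ ω, (1 + Y ω ^ 2) ∂P := integral_nonneg fun ω => by
    simp only [Pi.zero_apply]; positivity
  set E := ∫ ω, (1 + Y ω ^ 2) ∂P
  have : D * (E * ∫ ω, V ω ^ 2 ∂P) ≤ D * (E * (c * δ)) := by gcongr
  nlinarith

lemma aux_f_integral {Ω : Type*} {m0 : MeasurableSpace Ω} (P : Measure Ω) [IsProbabilityMeasure P]
    (Y : Ω → ℝ) (hY : Measurable Y) (hY2 : Integrable (fun ω => Y ω ^ 2) P) (a ζ : ℝ)
    (ha : 0 < a) (ha1 : a ≤ 1) :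
    Integrable (fun ω => Real.sqrt (a ^ 2 + (Y ω - ζ) ^ 2)) P ∧
    ∫ ω, Real.sqrt (a ^ 2 + (Y ω - ζ) ^ 2) ∂P ≤ (2 + |ζ|) * ∫ ω, (1 + Y ω ^ 2) ∂P := by
  have hI1 : Integrable (fun ω => 1 + Y ω ^ 2) P := (integrable_const _).add hY2
  have hb : ∀ y : ℝ, Real.sqrt (a ^ 2 + (y - ζ) ^ 2) ≤ (2 + |ζ|) * (1 + y ^ 2) := by
    intro y
    have h1 : Real.sqrt (a ^ 2 + (y - ζ) ^ 2) ≤ 1 + |y| + |ζ| := by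
      apply Real.sqrt_le_iff.2
      refine ⟨by positivity, ?_⟩
      have h2 : (y - ζ) ^ 2 ≤ (|y| + |ζ|) ^ 2 := by
        rw [← sq_abs (y - ζ)]
        exact pow_le_pow_left₀ (abs_nonneg _) (abs_sub _ _) 2
      nlinarith [abs_nonneg y, abs_nonneg ζ]
    have h3 : |y| ≤ 1 + y ^ 2 := by nlinarith [sq_abs y, sq_nonneg (|y| - 1), sq_nonneg (|y|)]
    have h4 : 0 ≤ |ζ| * y ^ 2 := by positivity
    nlinarith [sq_nonneg y]
  have hint : Integrable (fun ω => Real.sqrt (a ^ 2 + (Y ω - ζ) ^ 2)) P := by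
    refine (hI1.const_mul (2 + |ζ|)).mono' (Measurable.aestronglyMeasurable (by fun_prop)) ?_
    refine Filter.Eventually.of_forall fun ω => ?_
    rw [Real.norm_of_nonneg (Real.sqrt_nonneg _)]
    exact hb _
  refine ⟨hint, ?_⟩
  rw [← integral_const_mul]
  exact integral_mono hint (hI1.const_mul _) fun ω => hb _

/-- one step inequality for the expected test function -/
lemma aux_f_exp_step {Ω : Type*} {m0 : MeasurableSpace Ω} (P : Measure Ω) [IsProbabilityMeasure P]
    (Y U V : Ω → ℝ) (hY : Measurable Y) (hU : Measurable U)
    (hYU : IndepFun Y U P) (hYV : IndepFun Y V P)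
    (μ σ ρ : ℝ → ℝ) (hμ_meas : Measurable μ) (hσ_meas : Measurable σ) (hρ_meas : Measurable ρ)
    (δ c L K c0 a ζ Ls : ℝ) (hδ : 0 < δ) (hL : 0 ≤ L) (hK : 0 ≤ K)
    (ha : 0 < a) (ha1 : a ≤ 1)
    (hμ : ∀ y, |μ y| ≤ L * (1 + |y|)) (hσ : ∀ y, |σ y| ≤ L * (1 + |y|))
    (hρ : ∀ y, |ρ y| ≤ L * (1 + |y|))
    (hσK : ∀ y, |σ y| * Real.sqrt δ ≤ K * Real.sqrt (a ^ 2 + (y - ζ) ^ 2))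
    (hσL : ∀ y, |σ y - σ ζ| ≤ Ls * |y - ζ|) (hσ0 : σ ζ ≠ 0)
    (hU1 : Integrable U P) (hU0 : ∫ ω, U ω ∂P = 0)
    (hc0 : 0 < c0)
    (hUG : Integrable (fun ω => U ω ^ 2 / (1 + K * (|U ω| / Real.sqrt δ))) P)
    (hUGe : ∫ ω, U ω ^ 2 / (1 + K * (|U ω| / Real.sqrt δ)) ∂P = c0 * δ)
    (hV2 : Integrable (fun ω => V ω ^ 2) P) (hV2e : ∫ ω, V ω ^ 2 ∂P ≤ c * δ)
    (hVn : ∀ᵐ ω ∂P, ∃ k : ℕ, V ω = k) (hY2 : Integrable (fun ω => Y ω ^ 2) P)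
    (hY'2 : Integrable (fun ω => Real.sqrt
      (a ^ 2 + ((Y ω + μ (Y ω) * δ + σ (Y ω) * U ω + ρ (Y ω) * V ω) - ζ) ^ 2)) P) :
    Integrable (fun ω => a ^ 3 / Real.sqrt (a ^ 2 + (Y ω - ζ) ^ 2) ^ 3) P ∧
    δ * ∫ ω, a ^ 3 / Real.sqrt (a ^ 2 + (Y ω - ζ) ^ 2) ^ 3 ∂P ≤
      4 * a / (σ ζ ^ 2 * c0) * ((∫ ω, Real.sqrt
        (a ^ 2 + ((Y ω + μ (Y ω) * δ + σ (Y ω) * U ω + ρ (Y ω) * V ω) - ζ) ^ 2) ∂P)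
          - ∫ ω, Real.sqrt (a ^ 2 + (Y ω - ζ) ^ 2) ∂P
          + 2 * L * (1 + c) * δ * ∫ ω, (1 + Y ω ^ 2) ∂P) + 2 * Ls ^ 2 / σ ζ ^ 2 * a * δ := by
  have hApos : ∀ y : ℝ, 0 < Real.sqrt (a ^ 2 + (y - ζ) ^ 2) :=
    fun y => Real.sqrt_pos.2 (by positivity)
  have haA : ∀ y : ℝ, a ≤ Real.sqrt (a ^ 2 + (y - ζ) ^ 2) :=
    fun y => Real.le_sqrt_of_sq_le (by nlinarith [sq_nonneg (y - ζ)])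
  have huA : ∀ y : ℝ, |y - ζ| ≤ Real.sqrt (a ^ 2 + (y - ζ) ^ 2) := fun y => by
    rw [← Real.sqrt_sq_eq_abs]; exact Real.sqrt_le_sqrt (by nlinarith)
  have hI1 : Integrable (fun ω => 1 + Y ω ^ 2) P := (integrable_const _).add hY2
  have hy1 : ∀ y : ℝ, 1 + |y| ≤ 2 * (1 + y ^ 2) := fun y => by
    nlinarith [sq_abs y, sq_nonneg (|y| - 1), sq_nonneg (|y|)]
  have hy2 : ∀ y : ℝ, (1 + |y|) ^ 2 ≤ 2 * (1 + y ^ 2) := fun y => by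
    nlinarith [sq_abs y, abs_nonneg y, sq_nonneg (1 - |y|)]
  obtain ⟨hf, -⟩ := aux_f_integral P Y hY hY2 a ζ ha ha1
  -- the weight
  have hw : Integrable (fun ω => a ^ 3 / Real.sqrt (a ^ 2 + (Y ω - ζ) ^ 2) ^ 3) P := by
    refine (integrable_const (1 : ℝ)).mono' (Measurable.aestronglyMeasurable (by fun_prop)) ?_
    refine Filter.Eventually.of_forall fun ω => ?_
    have := hApos (Y ω)
    rw [Real.norm_of_nonneg (by positivity)]
    exact (div_le_one (by positivity)).2 (pow_le_pow_left₀ ha.le (haA _) 3)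
  refine ⟨hw, ?_⟩
  -- linear coefficient
  have h1 : Integrable (fun ω => (Y ω - ζ) / Real.sqrt (a ^ 2 + (Y ω - ζ) ^ 2) * σ (Y ω)) P := by
    refine (hI1.const_mul (L * 2)).mono' (Measurable.aestronglyMeasurable (by fun_prop)) ?_
    refine Filter.Eventually.of_forall fun ω => ?_
    rw [Real.norm_eq_abs, abs_mul, abs_div, abs_of_pos (hApos _)]
    calc _ ≤ 1 * (L * (1 + |Y ω|)) := by
            gcongr
            · exact (div_le_one (hApos _)).2 (huA _)
            · exact hσ _
      _ ≤ 1 * (L * (2 * (1 + Y ω ^ 2))) := by gcongr; exact hy1 _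
      _ = _ := by ring
  have h2 : Integrable (fun ω => σ (Y ω) ^ 2 * a ^ 2 /
      (2 * Real.sqrt (a ^ 2 + (Y ω - ζ) ^ 2) ^ 3)) P := by
    refine (hI1.const_mul (L ^ 2 / a)).mono' (Measurable.aestronglyMeasurable (by fun_prop)) ?_
    refine Filter.Eventually.of_forall fun ω => ?_
    have := hApos (Y ω)
    rw [Real.norm_of_nonneg (by positivity)]
    have hs2 : σ (Y ω) ^ 2 ≤ L ^ 2 * (2 * (1 + Y ω ^ 2)) := by
      rw [← sq_abs]
      calc |σ (Y ω)| ^ 2 ≤ (L * (1 + |Y ω|)) ^ 2 := pow_le_pow_left₀ (abs_nonneg _) (hσ _) 2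
        _ = L ^ 2 * (1 + |Y ω|) ^ 2 := by ring
        _ ≤ _ := by gcongr; exact hy2 _
    calc _ ≤ (L ^ 2 * (2 * (1 + Y ω ^ 2))) * a ^ 2 / (2 * a ^ 3) := by
            gcongr
            exact haA _
      _ = _ := by field_simp
  have h3 : Integrable (fun ω => |ρ (Y ω)|) P := by
    refine (hI1.const_mul (L * 2)).mono' (Measurable.aestronglyMeasurable (by fun_prop)) ?_
    refine Filter.Eventually.of_forall fun ω => ?_
    rw [Real.norm_eq_abs, abs_abs]
    calc _ ≤ (L * (1 + |Y ω|)) := hρ _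
      _ ≤ (L * (2 * (1 + Y ω ^ 2))) := by gcongr; exact hy1 _
      _ = _ := by ring
  obtain ⟨hA, hAe⟩ := aux_indep P Y U hYU
    (fun y => (y - ζ) / Real.sqrt (a ^ 2 + (y - ζ) ^ 2) * σ y) (fun u => u) (by fun_prop)
    (by fun_prop) h1 hU1
  obtain ⟨hB, hBe⟩ := aux_indep P Y U hYU
    (fun y => σ y ^ 2 * a ^ 2 / (2 * Real.sqrt (a ^ 2 + (y - ζ) ^ 2) ^ 3))
    (fun u => u ^ 2 / (1 + K * (|u| / Real.sqrt δ))) (by fun_prop)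
    (by fun_prop) h2 hUG
  obtain ⟨hC, hCe⟩ := aux_indep P Y V hYV (fun y => |ρ y|) (fun u => u ^ 2) (by fun_prop)
    (by fun_prop) h3 hV2
  set H : Ω → ℝ := fun ω => σ (Y ω) ^ 2 * a ^ 2 / (2 * Real.sqrt (a ^ 2 + (Y ω - ζ) ^ 2) ^ 3)
    with hH
  -- integrate the pointwise bound
  have hS1 : Integrable (fun ω => Real.sqrt (a ^ 2 + (Y ω - ζ) ^ 2) + (Y ω - ζ) / Real.sqrt (a ^ 2 + (Y ω - ζ) ^ 2) * σ (Y ω) * U ω) P := hf.add hA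
  have hS2 : Integrable (fun ω => Real.sqrt (a ^ 2 + (Y ω - ζ) ^ 2) + (Y ω - ζ) / Real.sqrt (a ^ 2 + (Y ω - ζ) ^ 2) * σ (Y ω) * U ω + σ (Y ω) ^ 2 * a ^ 2 / (2 * Real.sqrt (a ^ 2 + (Y ω - ζ) ^ 2) ^ 3) *
      (U ω ^ 2 / (1 + K * (|U ω| / Real.sqrt δ)))) P := hS1.add hB
  have hT1 : Integrable (fun ω => Real.sqrt
      (a ^ 2 + ((Y ω + μ (Y ω) * δ + σ (Y ω) * U ω + ρ (Y ω) * V ω) - ζ) ^ 2) + 2 * L * δ * (1 + Y ω ^ 2)) P := hY'2.add (hI1.const_mul (2 * L * δ))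
  have hT2 : Integrable (fun ω => Real.sqrt
      (a ^ 2 + ((Y ω + μ (Y ω) * δ + σ (Y ω) * U ω + ρ (Y ω) * V ω) - ζ) ^ 2) + 2 * L * δ * (1 + Y ω ^ 2) + |ρ (Y ω)| * V ω ^ 2) P := hT1.add hC
  have key : (∫ ω, Real.sqrt (a ^ 2 + (Y ω - ζ) ^ 2) ∂P) + (∫ ω, H ω ∂P) * (c0 * δ) ≤
      (∫ ω, Real.sqrt
        (a ^ 2 + ((Y ω + μ (Y ω) * δ + σ (Y ω) * U ω + ρ (Y ω) * V ω) - ζ) ^ 2) ∂P)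
      + 2 * L * δ * (∫ ω, (1 + Y ω ^ 2) ∂P) + (∫ ω, |ρ (Y ω)| ∂P) * ∫ ω, V ω ^ 2 ∂P := by
    have hle := integral_mono_ae hS2 hT2 (by
      filter_upwards [hVn] with ω hω
      have hVV : |V ω| ≤ V ω ^ 2 := by
        obtain ⟨k, hk⟩ := hω
        rw [hk]
        rcases Nat.eq_zero_or_pos k with hk | hk
        · subst hk; simp
        · have : (1 : ℝ) ≤ (k : ℝ) := by exact_mod_cast hk
          rw [abs_of_pos (by linarith)]
          nlinarith
      have hst := aux_f_step a (Y ω - ζ) (μ (Y ω)) (σ (Y ω)) (ρ (Y ω)) δ (Real.sqrt δ) K (U ω) (V ω)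
        ha hδ hK (Real.sqrt_pos.2 hδ) (hσK _)
      have e : Y ω - ζ + μ (Y ω) * δ + σ (Y ω) * U ω + ρ (Y ω) * V ω
        = (Y ω + μ (Y ω) * δ + σ (Y ω) * U ω + ρ (Y ω) * V ω) - ζ := by ring
      rw [e] at hst
      have i1 : |μ (Y ω)| * δ ≤ 2 * L * δ * (1 + Y ω ^ 2) := by
        calc |μ (Y ω)| * δ ≤ (L * (1 + |Y ω|)) * δ := by gcongr; exact hμ _
          _ ≤ (L * (2 * (1 + Y ω ^ 2))) * δ := by gcongr; exact hy1 _
          _ = _ := by ring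
      have i2 : |ρ (Y ω)| * |V ω| ≤ |ρ (Y ω)| * V ω ^ 2 := by gcongr
      linarith)
    rw [integral_add hS1 hB, integral_add hf hA, hAe, hBe, hU0, hUGe, integral_add hT1 hC,
      integral_add hY'2 (hI1.const_mul (2 * L * δ)), hCe, integral_const_mul] at hle
    simpa using hle
  have hrho : (∫ ω, |ρ (Y ω)| ∂P) ≤ 2 * L * ∫ ω, (1 + Y ω ^ 2) ∂P := by
    rw [← integral_const_mul]
    refine integral_mono h3 (hI1.const_mul _) fun ω => ?_
    calc _ ≤ (L * (1 + |Y ω|)) := hρ _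
      _ ≤ (L * (2 * (1 + Y ω ^ 2))) := by gcongr; exact hy1 _
      _ = _ := by ring
  have hE0 : 0 ≤ ∫ ω, (1 + Y ω ^ 2) ∂P := integral_nonneg fun ω => by
    simp only [Pi.zero_apply]; positivity
  have hV0 : 0 ≤ ∫ ω, V ω ^ 2 ∂P := integral_nonneg fun ω => by
    simp only [Pi.zero_apply]; positivity
  have hprod : (∫ ω, |ρ (Y ω)| ∂P) * ∫ ω, V ω ^ 2 ∂P ≤
      (2 * L * ∫ ω, (1 + Y ω ^ 2) ∂P) * (c * δ) := by gcongr
  have hwH : σ ζ ^ 2 * (∫ ω, a ^ 3 / Real.sqrt (a ^ 2 + (Y ω - ζ) ^ 2) ^ 3 ∂P)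
      ≤ 4 * a * (∫ ω, H ω ∂P) + 2 * Ls ^ 2 * a := by
    have hle := integral_mono (hw.const_mul (σ ζ ^ 2)) ((h2.const_mul (4 * a)).add
      (integrable_const (2 * Ls ^ 2 * a))) (fun ω => by
        simpa using aux_w_bound a (Y ω - ζ) (σ (Y ω)) (σ ζ) Ls ha ha1 (hσL _))
    simp only [Pi.add_apply] at hle
    rw [integral_const_mul, integral_add (h2.const_mul (4 * a)) (integrable_const _),
      integral_const_mul] at hle
    simpa using hle
  have hs2 : 0 < σ ζ ^ 2 := by positivity
  set w := ∫ ω, a ^ 3 / Real.sqrt (a ^ 2 + (Y ω - ζ) ^ 2) ^ 3 ∂P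
  set h := ∫ ω, H ω ∂P
  set E := ∫ ω, (1 + Y ω ^ 2) ∂P
  set f1 := ∫ ω, Real.sqrt
        (a ^ 2 + ((Y ω + μ (Y ω) * δ + σ (Y ω) * U ω + ρ (Y ω) * V ω) - ζ) ^ 2) ∂P
  set f0 := ∫ ω, Real.sqrt (a ^ 2 + (Y ω - ζ) ^ 2) ∂P
  have k1 : h * (c0 * δ) ≤ f1 - f0 + 2 * L * (1 + c) * δ * E := by linarith
  have k2 : h * δ ≤ (f1 - f0 + 2 * L * (1 + c) * δ * E) / c0 := by
    rw [le_div_iff₀ hc0]; linarith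
  have k3 : w ≤ (4 * a * h + 2 * Ls ^ 2 * a) / σ ζ ^ 2 := by
    rw [le_div_iff₀ hs2]; linarith
  calc δ * w ≤ δ * ((4 * a * h + 2 * Ls ^ 2 * a) / σ ζ ^ 2) := by gcongr
    _ = 4 * a / σ ζ ^ 2 * (h * δ) + 2 * Ls ^ 2 / σ ζ ^ 2 * a * δ := by field_simp
    _ ≤ 4 * a / σ ζ ^ 2 * ((f1 - f0 + 2 * L * (1 + c) * δ * E) / c0)
        + 2 * Ls ^ 2 / σ ζ ^ 2 * a * δ := by gcongr
    _ = _ := by field_simp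

/-- probability bound between grid points -/
lemma aux_offgrid_prob {Ω : Type*} {m0 : MeasurableSpace Ω} (P : Measure Ω) [IsProbabilityMeasure P]
    (Y U V : Ω → ℝ) (hY : Measurable Y)
    (hYU : IndepFun Y U P)
    (μ σ ρ : ℝ → ℝ)
    (δ c K a ζ M t ε : ℝ) (hδ : 0 < δ) (hδ1 : δ < 1) (hε : 0 < ε) (hK : 1 ≤ K)
    (hae : a = ε + Real.sqrt δ) (ht : 0 ≤ t) (htδ : t ≤ δ)
    (hμ : ∀ y, |μ y| ≤ K * (1 + |y - ζ|)) (hσ : ∀ y, |σ y| ≤ K * (1 + |y - ζ|))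
    (hUM : Integrable (fun ω => (1 + |U ω| / Real.sqrt δ) ^ 3) P)
    (hUMe : ∫ ω, (1 + |U ω| / Real.sqrt δ) ^ 3 ∂P ≤ M)
    (hV2 : Integrable (fun ω => V ω ^ 2) P) (hV2e : ∫ ω, V ω ^ 2 ∂P ≤ c * δ)
    (hVn : ∀ᵐ ω ∂P, ∃ k : ℕ, V ω = k)
    (hw : Integrable (fun ω => a ^ 3 / Real.sqrt (a ^ 2 + (Y ω - ζ) ^ 2) ^ 3) P)  :
    P {ω | |Y ω + μ (Y ω) * t + σ (Y ω) * U ω + ρ (Y ω) * V ω - ζ| ≤ ε} ≤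
      ENNReal.ofReal (c * δ + 216 * K ^ 3 * M *
        ((∫ ω, a ^ 3 / Real.sqrt (a ^ 2 + (Y ω - ζ) ^ 2) ^ 3 ∂P) + a)) := by
  have ha : 0 < a := by have := Real.sqrt_nonneg δ; linarith
  have hApos : ∀ y : ℝ, 0 < Real.sqrt (a ^ 2 + (y - ζ) ^ 2) :=
    fun y => Real.sqrt_pos.2 (by positivity)
  have hwa : Integrable (fun ω => a ^ 3 / Real.sqrt (a ^ 2 + (Y ω - ζ) ^ 2) ^ 3 + a) P :=
    hw.add (integrable_const a)
  obtain ⟨hA, hAe⟩ := aux_indep P Y U hYU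
    (fun y => a ^ 3 / Real.sqrt (a ^ 2 + (y - ζ) ^ 2) ^ 3 + a)
    (fun u => (1 + |u| / Real.sqrt δ) ^ 3) (by fun_prop)
    (by fun_prop) hwa hUM
  have hG : Integrable (fun ω => V ω ^ 2 + 216 * K ^ 3 *
    ((a ^ 3 / Real.sqrt (a ^ 2 + (Y ω - ζ) ^ 2) ^ 3 + a) * (1 + |U ω| / Real.sqrt δ) ^ 3)) P :=
    hV2.add (hA.const_mul _)
  have hGnn : ∀ ω, 0 ≤ V ω ^ 2 + 216 * K ^ 3 *
    ((a ^ 3 / Real.sqrt (a ^ 2 + (Y ω - ζ) ^ 2) ^ 3 + a) * (1 + |U ω| / Real.sqrt δ) ^ 3) := by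
    intro ω
    have := hApos (Y ω)
    positivity
  have hpt : ∀ᵐ ω ∂P, ω ∈ {ω | |Y ω + μ (Y ω) * t + σ (Y ω) * U ω + ρ (Y ω) * V ω - ζ| ≤ ε} →
      ω ∈ {ω | (1 : ENNReal) ≤ ENNReal.ofReal (V ω ^ 2 + 216 * K ^ 3 *
    ((a ^ 3 / Real.sqrt (a ^ 2 + (Y ω - ζ) ^ 2) ^ 3 + a) * (1 + |U ω| / Real.sqrt δ) ^ 3))} := by
    filter_upwards [hVn] with ω hω hX
    change |Y ω + μ (Y ω) * t + σ (Y ω) * U ω + ρ (Y ω) * V ω - ζ| ≤ ε at hX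
    change (1 : ENNReal) ≤ ENNReal.ofReal _
    have e : Y ω + μ (Y ω) * t + σ (Y ω) * U ω + ρ (Y ω) * V ω - ζ =
      Y ω - ζ + μ (Y ω) * t + σ (Y ω) * U ω + ρ (Y ω) * V ω := by ring
    rw [e] at hX
    have := aux_offgrid a (Y ω - ζ) (μ (Y ω)) (σ (Y ω)) (ρ (Y ω)) δ t ε K (U ω) (V ω) hδ hδ1 hε hae
      hK (hμ _) (hσ _) ht htδ hω hX
    rw [ENNReal.one_le_ofReal, mul_comm (a ^ 3 / _ + a)]
    exact this
  refine (measure_mono_ae hpt).trans ?_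
  have h1 := mul_meas_ge_le_lintegral₀ (μ := P) hG.aestronglyMeasurable.aemeasurable.ennreal_ofReal 1
  rw [one_mul] at h1
  refine h1.trans ?_
  rw [← ofReal_integral_eq_lintegral_ofReal hG (Filter.Eventually.of_forall hGnn)]
  apply ENNReal.ofReal_le_ofReal
  rw [integral_add hV2 (hA.const_mul _), integral_const_mul, hAe, integral_add hw (integrable_const a)]
  have hw0 : 0 ≤ ∫ ω, a ^ 3 / Real.sqrt (a ^ 2 + (Y ω - ζ) ^ 2) ^ 3 ∂P := integral_nonneg fun ω => by
    have := hApos (Y ω)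
    simp only [Pi.zero_apply]; positivity
  have hia : ∫ _ : Ω, a ∂P = a := by simp
  rw [hia]
  set w := ∫ ω, a ^ 3 / Real.sqrt (a ^ 2 + (Y ω - ζ) ^ 2) ^ 3 ∂P
  have : 216 * K ^ 3 * ((w + a) * ∫ ω, (1 + |U ω| / Real.sqrt δ) ^ 3 ∂P) ≤
    216 * K ^ 3 * ((w + a) * M) := by gcongr
  linarith

lemma aux_lip_growth (f : ℝ → ℝ) (S : Set ℝ) (h : ∃ K : NNReal, LipschitzOnWith K f S) :
    ∃ C : ℝ, 0 ≤ C ∧ ∀ y ∈ S, |f y| ≤ C * (1 + |y|) := by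
  obtain ⟨K, hK⟩ := h
  rcases S.eq_empty_or_nonempty with rfl | ⟨p, hp⟩
  · exact ⟨0, le_rfl, by simp⟩
  · refine ⟨|f p| + K * (1 + |p|), by positivity, fun y hy => ?_⟩
    have h1 := hK.dist_le_mul y hy p hp
    rw [Real.dist_eq, Real.dist_eq] at h1
    have h2 : |f y| ≤ |f y - f p| + |f p| := by
      have := abs_add_le (f y - f p) (f p); simpa using this
    have h3 : (K : ℝ) * |y - p| ≤ K * (|y| + |p|) := by gcongr; exact abs_sub _ _
    have h4 : 0 ≤ |f p| * |y| := by positivity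
    have h5 : 0 ≤ (K : ℝ) * (|p| * |y|) := by positivity
    have h6 : 0 ≤ (K : ℝ) := K.2
    nlinarith

lemma aux_mu_growth (μ : ℝ → ℝ) (m : ℕ) (hm : 0 < m) (ζ : Fin m → ℝ)
    (hμ_low : ∃ K : NNReal, LipschitzOnWith K μ (Set.Iio (ζ ⟨0, hm⟩)))
    (hμ_high : ∃ K : NNReal, LipschitzOnWith K μ (Set.Ioi (ζ ⟨m - 1, Nat.sub_lt hm one_pos⟩)))
    (hμ_mid : ∀ (k : Fin m) (h : (k : ℕ) + 1 < m),
      ∃ K : NNReal, LipschitzOnWith K μ (Set.Ioo (ζ k) (ζ ⟨(k : ℕ) + 1, h⟩))) :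
    ∃ C : ℝ, 0 ≤ C ∧ ∀ y, |μ y| ≤ C * (1 + |y|) := by
  obtain ⟨C1, hC1, h1⟩ := aux_lip_growth μ _ hμ_low
  obtain ⟨C2, hC2, h2⟩ := aux_lip_growth μ _ hμ_high
  have h3 : ∀ k : Fin m, ∃ C : ℝ, 0 ≤ C ∧ ∀ (h : (k : ℕ) + 1 < m),
      ∀ y ∈ Set.Ioo (ζ k) (ζ ⟨(k : ℕ) + 1, h⟩), |μ y| ≤ C * (1 + |y|) := by
    intro k
    by_cases h : (k : ℕ) + 1 < m
    · obtain ⟨C, hC, hh⟩ := aux_lip_growth μ _ (hμ_mid k h)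
      exact ⟨C, hC, fun _ => hh⟩
    · exact ⟨0, le_rfl, fun h' => absurd h' h⟩
  choose C3 hC3 h3 using h3
  have hsum0 : 0 ≤ ∑ k, C3 k := Finset.sum_nonneg fun k _ => hC3 k
  have hsum0' : 0 ≤ ∑ k, |μ (ζ k)| := Finset.sum_nonneg fun k _ => abs_nonneg _
  refine ⟨C1 + C2 + ∑ k, C3 k + ∑ k, |μ (ζ k)|, by positivity, fun y => ?_⟩
  have hy : 0 ≤ 1 + |y| := by positivity
  have mono : ∀ c : ℝ, |μ y| ≤ c * (1 + |y|) → c ≤ C1 + C2 + ∑ k, C3 k + ∑ k, |μ (ζ k)| →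
      |μ y| ≤ (C1 + C2 + ∑ k, C3 k + ∑ k, |μ (ζ k)|) * (1 + |y|) :=
    fun c h h' => h.trans (mul_le_mul_of_nonneg_right h' hy)
  by_cases hz : ∃ k, y = ζ k
  · obtain ⟨k, rfl⟩ := hz
    refine mono (|μ (ζ k)|) ?_ ?_
    · nlinarith [abs_nonneg (ζ k), abs_nonneg (μ (ζ k))]
    · have := Finset.single_le_sum (f := fun k => |μ (ζ k)|) (fun k _ => abs_nonneg _)
        (Finset.mem_univ k)
      linarith
  push Not at hz
  by_cases hlow : y < ζ ⟨0, hm⟩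
  · exact mono C1 (h1 y hlow) (by linarith)
  by_cases hhigh : ζ ⟨m - 1, Nat.sub_lt hm one_pos⟩ < y
  · exact mono C2 (h2 y hhigh) (by linarith)
  have hex : ∃ k : Fin m, ∃ h : (k : ℕ) + 1 < m, y ∈ Set.Ioo (ζ k) (ζ ⟨(k : ℕ) + 1, h⟩) := by
    by_contra hcon
    push Not at hcon
    have hall : ∀ j : ℕ, ∀ h : j < m, ζ ⟨j, h⟩ < y := by
      intro j
      induction j with
      | zero => intro h; exact lt_of_le_of_ne (not_lt.1 hlow) (hz _).symm
      | succ j ih =>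
        intro h
        have hj := ih (by omega)
        by_contra hnot
        exact hcon ⟨j, by omega⟩ h ⟨hj, lt_of_le_of_ne (not_lt.1 hnot) (hz _)⟩
    exact hhigh (hall _ _)
  obtain ⟨k, h, hk⟩ := hex
  refine mono (C3 k) (h3 k h y hk) ?_
  have := Finset.single_le_sum (f := C3) (fun k _ => hC3 k) (Finset.mem_univ k)
  linarith

set_option maxHeartbeats 4000000 in
lemma aux_core
    {Ω : Type*} {m0 : MeasurableSpace Ω}
    (F : Filtration ℝ m0) (P : Measure Ω) [IsProbabilityMeasure P]
    (T : ℝ) (hT : 0 < T)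
    (lam : ℝ → ℝ)
    (hlam_pos : ∀ t ∈ Set.Icc (0:ℝ) T, 0 < lam t)
    (lamB : ℝ) (hlamB : ∀ t ∈ Set.Icc (0:ℝ) T, lam t ≤ lamB)
    (W N : ℝ → Ω → ℝ)
    (hW_adapted : ∀ t ∈ Set.Icc (0:ℝ) T, Measurable[F t] (W t))
    (hN_adapted : ∀ t ∈ Set.Icc (0:ℝ) T, Measurable[F t] (N t))
    (hW_gauss : ∀ s t : ℝ, 0 ≤ s → s ≤ t → t ≤ T →
      Measure.map (fun ω => W t ω - W s ω) P = gaussianReal 0 (Real.toNNReal (t - s)))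
    (hN_poisson : ∀ s t : ℝ, 0 ≤ s → s ≤ t → t ≤ T →
      Measure.map (fun ω => N t ω - N s ω) P
        = Measure.map (fun k : ℕ => (k : ℝ))
            (poissonMeasure (Real.toNNReal (∫ u in s..t, lam u))))
    (h_indep : ∀ s t : ℝ, 0 ≤ s → s ≤ t → t ≤ T →
      Indep (MeasurableSpace.comap (fun ω => (W t ω - W s ω, N t ω - N s ω)) inferInstance)
        (F s) P)
    (μ σ ρ : ℝ → ℝ) (hμ_meas : Measurable μ) (hσ_meas : Measurable σ) (hρ_meas : Measurable ρ)
    (ζ L Ls : ℝ) (hL : 1 ≤ L)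
    (hμ : ∀ y, |μ y| ≤ L * (1 + |y|)) (hσ : ∀ y, |σ y| ≤ L * (1 + |y|))
    (hρ : ∀ y, |ρ y| ≤ L * (1 + |y|))
    (hσL : ∀ y, |σ y - σ ζ| ≤ Ls * |y - ζ|) (hσ0 : σ ζ ≠ 0) :
    ∃ C : ℝ, 0 < C ∧ ∀ (x : ℝ) (n : ℕ), 0 < n → T / n < 1 → ∀ ε : ℝ, 0 < ε →
      ∫⁻ t in Set.Icc (0:ℝ) T, P {ω | |emProc μ σ ρ W N (T / n) x t ω - ζ| ≤ ε}
        ≤ ENNReal.ofReal (C * (1 + x ^ 2) * (ε + Real.sqrt (T / n))) := by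
  have hlamB0 : 0 < lamB := (hlam_pos 0 ⟨le_rfl, hT.le⟩).trans_le (hlamB 0 ⟨le_rfl, hT.le⟩)
  -- constants
  obtain ⟨K, hKdef⟩ : ∃ K, K = L * (1 + |ζ|) := ⟨_, rfl⟩
  have hK1 : 1 ≤ K := by
    rw [hKdef]; exact one_le_mul_of_one_le_of_one_le hL (by linarith [abs_nonneg ζ])
  have hKg : ∀ y : ℝ, L * (1 + |y|) ≤ K * (1 + |y - ζ|) := by
    intro y
    have : |y| ≤ |y - ζ| + |ζ| := by
      have := abs_add_le (y - ζ) ζ; simpa using this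
    rw [hKdef, mul_assoc]
    have h2 : 0 ≤ |ζ| * |y - ζ| := by positivity
    gcongr
    linarith
  obtain ⟨hGint, hc0⟩ := aux_gauss_G (2 * K) (by linarith)
  obtain ⟨c0, hc0def⟩ : ∃ c0, c0 = ∫ z : ℝ, z ^ 2 / (1 + 2 * K * |z|) ∂(gaussianReal 0 1) :=
    ⟨_, rfl⟩
  rw [← hc0def] at hc0
  obtain ⟨M, hMdef⟩ : ∃ M, M = ∫ z : ℝ, (1 + |z|) ^ 3 ∂(gaussianReal 0 1) := ⟨_, rfl⟩
  have hM0 : 0 ≤ M := by rw [hMdef]; exact integral_nonneg fun z => by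
                          simp only [Pi.zero_apply]; positivity
  obtain ⟨c, hcdef⟩ : ∃ c, c = lamB + lamB ^ 2 := ⟨_, rfl⟩
  have hcpos : 0 < c := by rw [hcdef]; positivity
  obtain ⟨D, hDdef⟩ : ∃ D, D = (4 * L + 6 * L ^ 2) * (2 + c) := ⟨_, rfl⟩
  have hDpos : 0 < D := by rw [hDdef]; positivity
  obtain ⟨B, hBdef⟩ : ∃ B, B = Real.exp (D * T) := ⟨_, rfl⟩
  have hBpos : 0 < B := by rw [hBdef]; positivity
  obtain ⟨C1, hC1def⟩ : ∃ C1, C1 = 4 / (σ ζ ^ 2 * c0) * (B * ((2 + |ζ|) + 2 * L * (1 + c) * T))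
    + 2 * Ls ^ 2 / σ ζ ^ 2 * T := ⟨_, rfl⟩
  have hs2 : 0 < σ ζ ^ 2 := by positivity
  have hC1pos : 0 ≤ C1 := by rw [hC1def]; positivity
  refine ⟨T + c * T + 216 * K ^ 3 * M * (C1 + T), by positivity, ?_⟩
  intro x n hn hδ1 ε hε
  have hn' : (0 : ℝ) < n := by exact_mod_cast hn
  obtain ⟨δ, hδdef⟩ : ∃ δ, δ = T / n := ⟨_, rfl⟩
  rw [← hδdef] at hδ1 ⊢
  have hδ : 0 < δ := by rw [hδdef]; positivity
  have hnδ : n * δ = T := by rw [hδdef]; field_simp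
  obtain ⟨a, hae⟩ : ∃ a, a = ε + Real.sqrt δ := ⟨_, rfl⟩
  rw [← hae]
  have hsq : 0 < Real.sqrt δ := Real.sqrt_pos.2 hδ
  have hsq1 : Real.sqrt δ ≤ 1 := Real.sqrt_le_iff.2 ⟨zero_le_one, by linarith⟩
  have hsq2 : Real.sqrt δ ^ 2 = δ := Real.sq_sqrt hδ.le
  have hsqa : Real.sqrt δ ≤ a := by linarith
  have hδa : δ ≤ a := by nlinarith
  have ha : 0 < a := by linarith
  have hx1 : 1 ≤ 1 + x ^ 2 := by nlinarith [sq_nonneg x]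
  -- trivial case
  by_cases ha1 : a ≤ 1
  swap
  · calc _ ≤ ∫⁻ t in Set.Icc (0:ℝ) T, 1 := lintegral_mono fun t => prob_le_one
      _ = ENNReal.ofReal T := by simp
      _ ≤ _ := by
        apply ENNReal.ofReal_le_ofReal
        have h1 : T ≤ T + c * T + 216 * K ^ 3 * M * (C1 + T) := by
          have : 0 ≤ c * T + 216 * K ^ 3 * M * (C1 + T) := by positivity
          linarith
        calc T = T * 1 * 1 := by ring
          _ ≤ _ := by gcongr; linarith
  -- facts about increments
  have hWm : ∀ t ∈ Set.Icc (0:ℝ) T, Measurable (W t) := fun t ht => (hW_adapted t ht).mono (F.le t) le_rfl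
  have hNm : ∀ t ∈ Set.Icc (0:ℝ) T, Measurable (N t) := fun t ht => (hN_adapted t ht).mono (F.le t) le_rfl
  have hindU : ∀ (s t : ℝ) (Y : Ω → ℝ), 0 ≤ s → s ≤ t → t ≤ T → Measurable[F s] Y →
      IndepFun Y (fun ω => W t ω - W s ω) P ∧ IndepFun Y (fun ω => N t ω - N s ω) P := by
    intro s t Y h0 hst htT hY
    have h := h_indep s t h0 hst htT
    constructor
    · rw [IndepFun_iff_Indep]
      refine indep_of_indep_of_le h.symm hY.comap_le ?_
      have e : (fun ω => W t ω - W s ω) = Prod.fst ∘ (fun ω => (W t ω - W s ω, N t ω - N s ω)) := rfl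
      rw [e, ← MeasurableSpace.comap_comp]
      exact MeasurableSpace.comap_mono measurable_fst.comap_le
    · rw [IndepFun_iff_Indep]
      refine indep_of_indep_of_le h.symm hY.comap_le ?_
      have e : (fun ω => N t ω - N s ω) = Prod.snd ∘ (fun ω => (W t ω - W s ω, N t ω - N s ω)) := rfl
      rw [e, ← MeasurableSpace.comap_comp]
      exact MeasurableSpace.comap_mono measurable_snd.comap_le
  have hVfacts : ∀ s t : ℝ, 0 ≤ s → s ≤ t → t ≤ T → t - s ≤ δ →
      Integrable (fun ω => (N t ω - N s ω) ^ 2) P ∧ ∫ ω, (N t ω - N s ω) ^ 2 ∂P ≤ c * δ ∧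
      ∀ᵐ ω ∂P, ∃ k : ℕ, N t ω - N s ω = k := by
    intro s t h0 hst htT hd
    obtain ⟨h1, h2, h3⟩ := aux_poisson_integral P (fun ω => N t ω - N s ω)
      ((hNm t ⟨h0.trans hst, htT⟩).sub (hNm s ⟨h0, hst.trans htT⟩)) _ (hN_poisson s t h0 hst htT)
    refine ⟨h1, ?_, h3⟩
    rw [h2]
    have hr : ((Real.toNNReal (∫ u in s..t, lam u) : NNReal) : ℝ) ≤ lamB * δ := by
      rw [Real.coe_toNNReal']
      refine max_le ?_ (by positivity)
      have := intervalIntegral.norm_integral_le_of_norm_le_const (a := s) (b := t) (f := lam)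
        (C := lamB) (fun u hu => by
          rw [Set.uIoc_of_le hst] at hu
          have hu' : u ∈ Set.Icc (0 : ℝ) T := ⟨h0.trans hu.1.le, hu.2.trans htT⟩
          rw [Real.norm_of_nonneg (hlam_pos u hu').le]
          exact hlamB u hu')
      calc _ ≤ ‖∫ u in s..t, lam u‖ := le_abs_self _
        _ ≤ lamB * |t - s| := this
        _ ≤ lamB * δ := by rw [abs_of_nonneg (by linarith)]; gcongr
    have hr0 : (0 : ℝ) ≤ (Real.toNNReal (∫ u in s..t, lam u) : NNReal) := NNReal.coe_nonneg _
    set r := ((Real.toNNReal (∫ u in s..t, lam u) : NNReal) : ℝ)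
    have h5 : r ^ 2 ≤ (lamB * δ) ^ 2 := pow_le_pow_left₀ hr0 hr 2
    have h6 : (lamB * δ) ^ 2 ≤ lamB ^ 2 * δ := by
      rw [mul_pow]; gcongr; nlinarith
    rw [hcdef]
    linarith
  -- grid points
  set Y : ℕ → Ω → ℝ := emGrid μ σ ρ W N δ x with hYdef
  have hYsucc : ∀ j, Y (j + 1) = fun ω => Y j ω + μ (Y j ω) * δ
      + σ (Y j ω) * (W (((j : ℝ) + 1) * δ) ω - W ((j : ℝ) * δ) ω)
      + ρ (Y j ω) * (N (((j : ℝ) + 1) * δ) ω - N ((j : ℝ) * δ) ω) := fun j => rfl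
  have hjT : ∀ j : ℕ, j ≤ n → (j : ℝ) * δ ≤ T := by
    intro j hj
    rw [← hnδ]
    have : (j : ℝ) ≤ n := by exact_mod_cast hj
    gcongr
  have hj1T : ∀ j : ℕ, j < n → ((j : ℝ) + 1) * δ ≤ T := by
    intro j hj
    have := hjT (j + 1) hj
    push_cast at this
    exact this
  have hj0 : ∀ j : ℕ, 0 ≤ (j : ℝ) * δ := fun j => by positivity
  have hjj : ∀ j : ℕ, (j : ℝ) * δ ≤ ((j : ℝ) + 1) * δ := fun j => by gcongr; linarith
  have hYF : ∀ j : ℕ, j ≤ n → Measurable[F ((j : ℝ) * δ)] (Y j) := by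
    intro j
    induction j with
    | zero => intro _; exact measurable_const
    | succ j ih =>
      intro hj
      have hj' : j < n := hj
      have e : (((j + 1 : ℕ) : ℝ)) * δ = ((j : ℝ) + 1) * δ := by push_cast; ring
      rw [e, hYsucc]
      have hle : F ((j : ℝ) * δ) ≤ F (((j : ℝ) + 1) * δ) := F.mono (hjj j)
      have m1 : Measurable[F (((j : ℝ) + 1) * δ)] (Y j) := (ih hj'.le).mono hle le_rfl
      have m2 := hW_adapted (((j : ℝ) + 1) * δ) ⟨(hj0 j).trans (hjj j), hj1T j hj'⟩
      have m3 := (hW_adapted ((j : ℝ) * δ) ⟨hj0 j, hjT j hj'.le⟩).mono hle le_rfl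
      have m4 := hN_adapted (((j : ℝ) + 1) * δ) ⟨(hj0 j).trans (hjj j), hj1T j hj'⟩
      have m5 := (hN_adapted ((j : ℝ) * δ) ⟨hj0 j, hjT j hj'.le⟩).mono hle le_rfl
      exact ((m1.add ((hμ_meas.comp m1).mul_const δ)).add ((hσ_meas.comp m1).mul (m2.sub m3))).add
        ((hρ_meas.comp m1).mul (m4.sub m5))
  have hYm : ∀ j : ℕ, j ≤ n → Measurable (Y j) := fun j hj => (hYF j hj).mono (F.le _) le_rfl
  have hUm : ∀ j : ℕ, j < n → Measurable (fun ω => W (((j : ℝ) + 1) * δ) ω - W ((j : ℝ) * δ) ω) :=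
    fun j hj => (hWm _ ⟨(hj0 j).trans (hjj j), hj1T j hj⟩).sub (hWm _ ⟨hj0 j, hjT j hj.le⟩)
  have hVm : ∀ j : ℕ, j < n → Measurable (fun ω => N (((j : ℝ) + 1) * δ) ω - N ((j : ℝ) * δ) ω) :=
    fun j hj => (hNm _ ⟨(hj0 j).trans (hjj j), hj1T j hj⟩).sub (hNm _ ⟨hj0 j, hjT j hj.le⟩)
  have hdj : ∀ j : ℕ, ((j : ℝ) + 1) * δ - (j : ℝ) * δ = δ := fun j => by ring
  have hUg : ∀ j : ℕ, j < n → ∀ g : ℝ → ℝ, Measurable g →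
      (Integrable (fun ω => g (W (((j : ℝ) + 1) * δ) ω - W ((j : ℝ) * δ) ω)) P ↔
        Integrable (fun z => g (Real.sqrt δ * z)) (gaussianReal 0 1)) ∧
      ∫ ω, g (W (((j : ℝ) + 1) * δ) ω - W ((j : ℝ) * δ) ω) ∂P
        = ∫ z, g (Real.sqrt δ * z) ∂(gaussianReal 0 1) := by
    intro j hj g hg
    have := hW_gauss _ _ (hj0 j) (hjj j) (hj1T j hj)
    rw [hdj] at this
    exact aux_gauss_integral P _ (hUm j hj) δ hδ.le this g hg
  have hU1 : ∀ j : ℕ, j < n → Integrable (fun ω => W (((j : ℝ) + 1) * δ) ω - W ((j : ℝ) * δ) ω) P ∧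
      ∫ ω, (W (((j : ℝ) + 1) * δ) ω - W ((j : ℝ) * δ) ω) ∂P = 0 := by
    intro j hj
    obtain ⟨h1, h2⟩ := hUg j hj (fun u => u) (by fun_prop)
    refine ⟨h1.2 ?_, ?_⟩
    · refine Integrable.const_mul ?_ _
      refine (aux_gauss_pow 1).mono' (by fun_prop) (Filter.Eventually.of_forall fun z => ?_)
      simp
    · rw [h2, integral_const_mul, integral_id_gaussianReal, mul_zero]
  have hU2 : ∀ j : ℕ, j < n →
      Integrable (fun ω => (W (((j : ℝ) + 1) * δ) ω - W ((j : ℝ) * δ) ω) ^ 2) P ∧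
      ∫ ω, (W (((j : ℝ) + 1) * δ) ω - W ((j : ℝ) * δ) ω) ^ 2 ∂P = δ := by
    intro j hj
    obtain ⟨h1, h2⟩ := hUg j hj (fun u => u ^ 2) (by fun_prop)
    simp only [mul_pow, hsq2] at h1 h2
    refine ⟨h1.2 ?_, ?_⟩
    · refine Integrable.const_mul ?_ _
      simpa using aux_gauss_pow 2
    · rw [h2, integral_const_mul, aux_gauss_sq, mul_one]
  have hUG : ∀ j : ℕ, j < n →
      Integrable (fun ω => (W (((j : ℝ) + 1) * δ) ω - W ((j : ℝ) * δ) ω) ^ 2 /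
        (1 + 2 * K * (|W (((j : ℝ) + 1) * δ) ω - W ((j : ℝ) * δ) ω| / Real.sqrt δ))) P ∧
      ∫ ω, (W (((j : ℝ) + 1) * δ) ω - W ((j : ℝ) * δ) ω) ^ 2 /
        (1 + 2 * K * (|W (((j : ℝ) + 1) * δ) ω - W ((j : ℝ) * δ) ω| / Real.sqrt δ)) ∂P = c0 * δ := by
    intro j hj
    obtain ⟨h1, h2⟩ := hUg j hj (fun u => u ^ 2 / (1 + 2 * K * (|u| / Real.sqrt δ))) (by fun_prop)
    have e : ∀ z : ℝ, (Real.sqrt δ * z) ^ 2 / (1 + 2 * K * (|Real.sqrt δ * z| / Real.sqrt δ))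
        = δ * (z ^ 2 / (1 + 2 * K * |z|)) := by
      intro z
      rw [abs_mul, abs_of_pos hsq, mul_div_cancel_left₀ _ hsq.ne', mul_pow, hsq2, mul_div_assoc]
    simp only [e] at h1 h2
    refine ⟨h1.2 (hGint.const_mul _), ?_⟩
    rw [h2, integral_const_mul, ← hc0def, mul_comm]
  -- second moments
  have hmom : ∀ j : ℕ, j ≤ n → Integrable (fun ω => Y j ω ^ 2) P ∧
      ∫ ω, (1 + Y j ω ^ 2) ∂P ≤ (1 + D * δ) ^ j * (1 + x ^ 2) := by
    intro j
    induction j with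
    | zero =>
      intro _
      have e : ∀ ω, Y 0 ω = x := fun ω => rfl
      simp [e]
    | succ j ih =>
      intro hj
      have hj' : j < n := hj
      obtain ⟨ih1, ih2⟩ := ih hj'.le
      obtain ⟨i1, i2⟩ := hindU _ _ (Y j) (hj0 j) (hjj j) (hj1T j hj') (hYF j hj'.le)
      obtain ⟨v1, v2, v3⟩ := hVfacts _ _ (hj0 j) (hjj j) (hj1T j hj') (hdj j).le
      obtain ⟨s1, s2⟩ := aux_moment_step P (Y j) _ _ (hYm j hj'.le) (hUm j hj') (hVm j hj') i1 i2
        μ σ ρ hμ_meas hσ_meas hρ_meas δ c L hδ hδ1 (by linarith) hμ hσ hρ (hU1 j hj').1 (hU1 j hj').2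
        (hU2 j hj').1 (hU2 j hj').2 v1 v2 v3 ih1
      rw [hYsucc]
      refine ⟨s1, s2.trans ?_⟩
      rw [← hDdef, pow_succ]
      have : 0 ≤ 1 + D * δ := by positivity
      calc _ ≤ (1 + D * δ) * ((1 + D * δ) ^ j * (1 + x ^ 2)) := by gcongr
        _ = _ := by ring
  have hmomB : ∀ j : ℕ, j ≤ n → ∫ ω, (1 + Y j ω ^ 2) ∂P ≤ B * (1 + x ^ 2) := by
    intro j hj
    refine (hmom j hj).2.trans ?_
    gcongr
    calc (1 + D * δ) ^ j ≤ (Real.exp (D * δ)) ^ j := by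
          gcongr
          have := Real.add_one_le_exp (D * δ); linarith
      _ = Real.exp (D * (j * δ)) := by rw [← Real.exp_nat_mul]; congr 1; ring
      _ ≤ B := by
          rw [hBdef]
          apply Real.exp_le_exp.2
          exact mul_le_mul_of_nonneg_left (hjT j hj) hDpos.le
  -- weights
  set w : ℕ → ℝ := fun j => ∫ ω, a ^ 3 / Real.sqrt (a ^ 2 + (Y j ω - ζ) ^ 2) ^ 3 ∂P with hw
  set f : ℕ → ℝ := fun j => ∫ ω, Real.sqrt (a ^ 2 + (Y j ω - ζ) ^ 2) ∂P with hf
  have hσK : ∀ y, |σ y| * Real.sqrt δ ≤ 2 * K * Real.sqrt (a ^ 2 + (y - ζ) ^ 2) := by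
    intro y
    have haA : a ≤ Real.sqrt (a ^ 2 + (y - ζ) ^ 2) :=
      Real.le_sqrt_of_sq_le (by nlinarith [sq_nonneg (y - ζ)])
    have huA : |y - ζ| ≤ Real.sqrt (a ^ 2 + (y - ζ) ^ 2) := by
      rw [← Real.sqrt_sq_eq_abs]; exact Real.sqrt_le_sqrt (by nlinarith)
    set A := Real.sqrt (a ^ 2 + (y - ζ) ^ 2)
    calc |σ y| * Real.sqrt δ ≤ K * (1 + |y - ζ|) * Real.sqrt δ := by
          gcongr; exact (hσ y).trans (hKg y)
      _ = K * (Real.sqrt δ + |y - ζ| * Real.sqrt δ) := by ring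
      _ ≤ K * (A + A * 1) := by gcongr; linarith
      _ = _ := by ring
  have hstep : ∀ j : ℕ, j < n →
      Integrable (fun ω => a ^ 3 / Real.sqrt (a ^ 2 + (Y j ω - ζ) ^ 2) ^ 3) P ∧
      δ * w j ≤ 4 * a / (σ ζ ^ 2 * c0) * (f (j + 1) - f j)
        + δ * (4 * a / (σ ζ ^ 2 * c0) * (2 * L * (1 + c) * (B * (1 + x ^ 2)))
          + 2 * Ls ^ 2 / σ ζ ^ 2 * a) := by
    intro j hj'
    obtain ⟨i1, i2⟩ := hindU _ _ (Y j) (hj0 j) (hjj j) (hj1T j hj') (hYF j hj'.le)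
    obtain ⟨v1, v2, v3⟩ := hVfacts _ _ (hj0 j) (hjj j) (hj1T j hj') (hdj j).le
    have hnext := (aux_f_integral P (Y (j + 1)) (hYm _ hj') (hmom _ hj').1 a ζ ha ha1).1
    rw [hYsucc] at hnext
    obtain ⟨s1, s2⟩ := aux_f_exp_step P (Y j) _ _ (hYm j hj'.le) (hUm j hj') i1 i2
        μ σ ρ hμ_meas hσ_meas hρ_meas δ c L (2 * K) c0 a ζ Ls hδ (by linarith) (by linarith) ha ha1
        hμ hσ hρ hσK hσL hσ0 (hU1 j hj').1 (hU1 j hj').2 hc0 (hUG j hj').1 (hUG j hj').2 v1 v2 v3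
        (hmom j hj'.le).1 hnext
    refine ⟨s1, ?_⟩
    have hfs : f (j + 1) = ∫ ω, Real.sqrt (a ^ 2 + ((Y j ω + μ (Y j ω) * δ
      + σ (Y j ω) * (W (((j : ℝ) + 1) * δ) ω - W ((j : ℝ) * δ) ω)
      + ρ (Y j ω) * (N (((j : ℝ) + 1) * δ) ω - N ((j : ℝ) * δ) ω)) - ζ) ^ 2) ∂P := rfl
    rw [← hfs] at s2
    refine s2.trans ?_
    have hE := hmomB j hj'.le
    have hcoef : 0 ≤ 4 * a / (σ ζ ^ 2 * c0) := by positivity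
    have h2 : 2 * L * (1 + c) * δ * (∫ ω, (1 + Y j ω ^ 2) ∂P)
        ≤ 2 * L * (1 + c) * δ * (B * (1 + x ^ 2)) := by gcongr
    calc _ ≤ 4 * a / (σ ζ ^ 2 * c0) * (f (j + 1) - f j + 2 * L * (1 + c) * δ * (B * (1 + x ^ 2)))
          + 2 * Ls ^ 2 / σ ζ ^ 2 * a * δ := by
          gcongr
      _ = _ := by ring
  have hfn : f n ≤ (2 + |ζ|) * (B * (1 + x ^ 2)) := by
    refine (aux_f_integral P (Y n) (hYm _ le_rfl) (hmom _ le_rfl).1 a ζ ha ha1).2.trans ?_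
    gcongr
    exact hmomB n le_rfl
  have hf0 : 0 ≤ f 0 := integral_nonneg fun ω => Real.sqrt_nonneg _
  have hwsum : ∑ j ∈ Finset.range n, δ * w j ≤ C1 * (1 + x ^ 2) * a := by
    refine (Finset.sum_le_sum fun j hj => (hstep j (Finset.mem_range.1 hj)).2).trans ?_
    rw [Finset.sum_add_distrib, ← Finset.mul_sum, Finset.sum_range_sub, Finset.sum_const,
      Finset.card_range, nsmul_eq_mul, ← mul_assoc, hnδ]
    have hcoef : 0 ≤ 4 * a / (σ ζ ^ 2 * c0) := by positivity
    calc _ ≤ 4 * a / (σ ζ ^ 2 * c0) * ((2 + |ζ|) * (B * (1 + x ^ 2))) +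
          T * (4 * a / (σ ζ ^ 2 * c0) * (2 * L * (1 + c) * (B * (1 + x ^ 2)))
          + 2 * Ls ^ 2 / σ ζ ^ 2 * a * (1 + x ^ 2)) := by
          have h0 : 0 ≤ 2 * Ls ^ 2 / σ ζ ^ 2 * a := by positivity
          refine add_le_add (mul_le_mul_of_nonneg_left (by linarith) hcoef)
            (mul_le_mul_of_nonneg_left ?_ hT.le)
          exact add_le_add le_rfl (le_mul_of_one_le_right h0 hx1)
      _ = _ := by rw [hC1def]; ring
  have hw0 : ∀ j, 0 ≤ w j := fun j => integral_nonneg fun ω => by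
    have : 0 < Real.sqrt (a ^ 2 + (Y j ω - ζ) ^ 2) := Real.sqrt_pos.2 (by positivity)
    simp only [Pi.zero_apply]; positivity
  -- between grid points
  have hoff : ∀ j : ℕ, j < n → ∀ t ∈ Set.Ico ((j : ℝ) * δ) (((j : ℝ) + 1) * δ),
      P {ω | |emProc μ σ ρ W N δ x t ω - ζ| ≤ ε} ≤
        ENNReal.ofReal (c * δ + 216 * K ^ 3 * M * (w j + a)) := by
    intro j hj t ht
    have hfl : ⌊t / δ⌋.toNat = j := by
      have : ⌊t / δ⌋ = (j : ℤ) := by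
        rw [Int.floor_eq_iff]
        constructor
        · rw [le_div_iff₀ hδ]; exact_mod_cast ht.1
        · rw [div_lt_iff₀ hδ]; exact_mod_cast ht.2
      rw [this]; rfl
    have htT : t ≤ T := ht.2.le.trans (hj1T j hj)
    obtain ⟨i1, i2⟩ := hindU _ t (Y j) (hj0 j) ht.1 htT (hYF j hj.le)
    have htd : t - (j : ℝ) * δ ≤ δ := by have := ht.2; linarith
    obtain ⟨v1, v2, v3⟩ := hVfacts _ t (hj0 j) ht.1 htT htd
    have hts : 0 ≤ t - (j : ℝ) * δ := by linarith [ht.1]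
    have hUmt : Measurable (fun ω => W t ω - W ((j : ℝ) * δ) ω) :=
      (hWm t ⟨(hj0 j).trans ht.1, htT⟩).sub (hWm _ ⟨hj0 j, hjT j hj.le⟩)
    obtain ⟨g1, g2⟩ := aux_gauss_integral P _ hUmt _ hts (hW_gauss _ t (hj0 j) ht.1 htT)
      (fun u => (1 + |u| / Real.sqrt δ) ^ 3) (by fun_prop)
    have hle : ∀ z : ℝ, (1 + |Real.sqrt (t - (j : ℝ) * δ) * z| / Real.sqrt δ) ^ 3 ≤ (1 + |z|) ^ 3 := by
      intro z
      gcongr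
      rw [abs_mul, abs_of_nonneg (Real.sqrt_nonneg _), div_le_iff₀ hsq, mul_comm]
      gcongr
    have hint : Integrable (fun z : ℝ => (1 + |Real.sqrt (t - (j : ℝ) * δ) * z| / Real.sqrt δ) ^ 3)
        (gaussianReal 0 1) := by
      refine aux_gauss_cube.mono' (Measurable.aestronglyMeasurable (by fun_prop)) ?_
      refine Filter.Eventually.of_forall fun z => ?_
      rw [Real.norm_of_nonneg (by positivity)]
      exact hle z
    have hres := aux_offgrid_prob P (Y j) (fun ω => W t ω - W ((j : ℝ) * δ) ω)
      (fun ω => N t ω - N ((j : ℝ) * δ) ω) (hYm j hj.le) i1 μ σ ρ δ c K a ζ M (t - (j : ℝ) * δ) ε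
      hδ hδ1 hε hK1 hae hts htd (fun y => (hμ y).trans (hKg y)) (fun y => (hσ y).trans (hKg y))
      (g1.2 hint) (by
        rw [g2, hMdef]
        exact integral_mono hint aux_gauss_cube hle) v1 v2 v3 (hstep j hj).1
    have hset : {ω | |emProc μ σ ρ W N δ x t ω - ζ| ≤ ε} =
      {ω | |Y j ω + μ (Y j ω) * (t - (j : ℝ) * δ) + σ (Y j ω) * (W t ω - W ((j : ℝ) * δ) ω)
        + ρ (Y j ω) * (N t ω - N ((j : ℝ) * δ) ω) - ζ| ≤ ε} := by
      simp only [emProc, lastGrid, hfl, hYdef]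
    rw [hset]
    exact hres
  -- conclusion
  have hcover : Set.Ico (0:ℝ) T ⊆ ⋃ j : Fin n, Set.Ico (((j : ℕ) : ℝ) * δ) ((((j : ℕ) : ℝ) + 1) * δ) := by
    intro t ht
    have htd : 0 ≤ t / δ := div_nonneg ht.1 hδ.le
    have h1 : (⌊t / δ⌋₊ : ℝ) * δ ≤ t := by
      rw [← le_div_iff₀ hδ]; exact Nat.floor_le htd
    have h2 : t < ((⌊t / δ⌋₊ : ℝ) + 1) * δ := by
      rw [← div_lt_iff₀ hδ]; exact Nat.lt_floor_add_one _
    have h3 : ⌊t / δ⌋₊ < n := by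
      rw [Nat.floor_lt htd, div_lt_iff₀ hδ, hnδ]; exact ht.2
    exact Set.mem_iUnion.2 ⟨⟨_, h3⟩, h1, h2⟩
  have hb0 : ∀ j, 0 ≤ c * δ + 216 * K ^ 3 * M * (w j + a) := fun j => by
    have := hw0 j
    positivity
  calc ∫⁻ t in Set.Icc (0:ℝ) T, P {ω | |emProc μ σ ρ W N δ x t ω - ζ| ≤ ε}
      = ∫⁻ t in Set.Ico (0:ℝ) T, P {ω | |emProc μ σ ρ W N δ x t ω - ζ| ≤ ε} :=
        setLIntegral_congr Ico_ae_eq_Icc.symm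
    _ ≤ ∫⁻ t in ⋃ j : Fin n, Set.Ico (((j : ℕ) : ℝ) * δ) ((((j : ℕ) : ℝ) + 1) * δ),
          P {ω | |emProc μ σ ρ W N δ x t ω - ζ| ≤ ε} := lintegral_mono_set hcover
    _ ≤ ∑' j : Fin n, ∫⁻ t in Set.Ico (((j : ℕ) : ℝ) * δ) ((((j : ℕ) : ℝ) + 1) * δ),
          P {ω | |emProc μ σ ρ W N δ x t ω - ζ| ≤ ε} := lintegral_iUnion_le _ _
    _ ≤ ∑' j : Fin n, ENNReal.ofReal (δ * (c * δ + 216 * K ^ 3 * M * (w j + a))) := by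
        refine ENNReal.tsum_le_tsum fun j => ?_
        refine (setLIntegral_mono' measurableSet_Ico (hoff j j.2)).trans ?_
        rw [setLIntegral_const, Real.volume_Ico, hdj, mul_comm, ENNReal.ofReal_mul hδ.le]
    _ = ENNReal.ofReal (∑ j ∈ Finset.range n, δ * (c * δ + 216 * K ^ 3 * M * (w j + a))) := by
        rw [tsum_fintype, ENNReal.ofReal_sum_of_nonneg (fun j _ => mul_nonneg hδ.le (hb0 j)),
          Finset.sum_range]
    _ ≤ _ := by
        apply ENNReal.ofReal_le_ofReal
        have e : ∑ j ∈ Finset.range n, δ * (c * δ + 216 * K ^ 3 * M * (w j + a))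
          = 216 * K ^ 3 * M * (∑ j ∈ Finset.range n, δ * w j)
            + T * (c * δ + 216 * K ^ 3 * M * a) := by
          rw [← hnδ, Finset.mul_sum]
          have : (n : ℝ) * δ * (c * δ + 216 * K ^ 3 * M * a)
            = ∑ j ∈ Finset.range n, δ * (c * δ + 216 * K ^ 3 * M * a) := by
            rw [Finset.sum_const, Finset.card_range, nsmul_eq_mul]; ring
          rw [this, ← Finset.sum_add_distrib]
          exact Finset.sum_congr rfl fun j _ => by ring
        rw [e]
        have hxa : a ≤ (1 + x ^ 2) * a := le_mul_of_one_le_left ha.le hx1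
        calc _ ≤ 216 * K ^ 3 * M * (C1 * (1 + x ^ 2) * a)
              + T * (c * ((1 + x ^ 2) * a) + 216 * K ^ 3 * M * ((1 + x ^ 2) * a)) := by
              gcongr
              exact hδa.trans hxa
          _ ≤ 216 * K ^ 3 * M * (C1 * (1 + x ^ 2) * a)
              + T * (c * ((1 + x ^ 2) * a) + 216 * K ^ 3 * M * ((1 + x ^ 2) * a))
              + T * (1 + x ^ 2) * a := le_add_of_nonneg_right (by positivity)
          _ = _ := by ring


/-- Occupation time estimate for the Euler–Maruyama process:
`∫_0^T P(|X^{(δ),x}_t - ζ_k| ≤ ε) dt ≤ C (1 + x²)(ε + δ^{1/2})`. -/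
theorem em_occupation_time
    {Ω : Type*} {m0 : MeasurableSpace Ω}
    (F : Filtration ℝ m0) (P : Measure Ω) [IsProbabilityMeasure P]
    (T : ℝ) (hT : 0 < T)
    (lam : ℝ → ℝ) (hlam_meas : Measurable lam)
    (hlam_pos : ∀ t ∈ Set.Icc (0:ℝ) T, 0 < lam t)
    (lamB : ℝ) (hlamB : ∀ t ∈ Set.Icc (0:ℝ) T, lam t ≤ lamB)
    (W N : ℝ → Ω → ℝ)
    (hW0 : ∀ ω, W 0 ω = 0) (hN0 : ∀ ω, N 0 ω = 0)
    (hW_adapted : ∀ t ∈ Set.Icc (0:ℝ) T, Measurable[F t] (W t))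
    (hN_adapted : ∀ t ∈ Set.Icc (0:ℝ) T, Measurable[F t] (N t))
    (hW_cont : ∀ᵐ ω ∂P, ContinuousOn (fun t => W t ω) (Set.Icc 0 T))
    (hN_mono : ∀ᵐ ω ∂P, ∀ s t : ℝ, 0 ≤ s → s ≤ t → t ≤ T → N s ω ≤ N t ω)
    (hN_rc : ∀ᵐ ω ∂P, ∀ t ∈ Set.Ico (0:ℝ) T,
      Filter.Tendsto (fun u => N u ω) (nhdsWithin t (Set.Ioi t)) (nhds (N t ω)))
    (hN_int : ∀ᵐ ω ∂P, ∀ t ∈ Set.Icc (0:ℝ) T, ∃ k : ℕ, N t ω = k)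
    (hW_gauss : ∀ s t : ℝ, 0 ≤ s → s ≤ t → t ≤ T →
      Measure.map (fun ω => W t ω - W s ω) P = gaussianReal 0 (Real.toNNReal (t - s)))
    (hN_poisson : ∀ s t : ℝ, 0 ≤ s → s ≤ t → t ≤ T →
      Measure.map (fun ω => N t ω - N s ω) P
        = Measure.map (fun k : ℕ => (k : ℝ))
            (poissonMeasure (Real.toNNReal (∫ u in s..t, lam u))))
    (h_indep : ∀ s t : ℝ, 0 ≤ s → s ≤ t → t ≤ T →
      Indep (MeasurableSpace.comap (fun ω => (W t ω - W s ω, N t ω - N s ω)) inferInstance)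
        (F s) P)
    (hWN_indep : ∀ s t : ℝ, 0 ≤ s → s ≤ t → t ≤ T →
      IndepFun (fun ω => W t ω - W s ω) (fun ω => N t ω - N s ω) P)
    (μ σ ρ : ℝ → ℝ) (hμ_meas : Measurable μ) (hσ_meas : Measurable σ) (hρ_meas : Measurable ρ)
    (m : ℕ) (hm : 0 < m) (ζ : Fin m → ℝ) (hζ : StrictMono ζ)
    (hμ_low : ∃ K : NNReal, LipschitzOnWith K μ (Set.Iio (ζ ⟨0, hm⟩)))
    (hμ_high : ∃ K : NNReal, LipschitzOnWith K μ (Set.Ioi (ζ ⟨m - 1, Nat.sub_lt hm one_pos⟩)))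
    (hμ_mid : ∀ (k : Fin m) (h : (k : ℕ) + 1 < m),
      ∃ K : NNReal, LipschitzOnWith K μ (Set.Ioo (ζ k) (ζ ⟨(k : ℕ) + 1, h⟩)))
    (hσ_lip : ∃ K : NNReal, LipschitzWith K σ)
    (hσ_nz : ∀ k : Fin m, σ (ζ k) ≠ 0)
    (hρ_lip : ∃ K : NNReal, LipschitzWith K ρ)
    :
    ∃ C : ℝ, 0 < C ∧ ∀ (k : Fin m) (x : ℝ) (n : ℕ), 0 < n → T / n < 1 → ∀ ε : ℝ, 0 < ε →
      ∫⁻ t in Set.Icc (0:ℝ) T, P {ω | |emProc μ σ ρ W N (T / n) x t ω - ζ k| ≤ ε}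
        ≤ ENNReal.ofReal (C * (1 + x ^ 2) * (ε + Real.sqrt (T / n))) := by
  obtain ⟨C1, hC1, h1⟩ := aux_mu_growth μ m hm ζ hμ_low hμ_high hμ_mid
  obtain ⟨Ks, hKs⟩ := hσ_lip
  obtain ⟨C2, hC2, h2⟩ := aux_lip_growth σ Set.univ ⟨Ks, hKs.lipschitzOnWith⟩
  obtain ⟨Kr, hKr⟩ := hρ_lip
  obtain ⟨C3, hC3, h3⟩ := aux_lip_growth ρ Set.univ ⟨Kr, hKr.lipschitzOnWith⟩
  have hcore : ∀ k : Fin m, _ := fun k => aux_core F P T hT lam hlam_pos lamB hlamB W N hW_adapted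
    hN_adapted hW_gauss hN_poisson h_indep μ σ ρ hμ_meas hσ_meas hρ_meas (ζ k) (1 + C1 + C2 + C3) Ks
    (by linarith)
    (fun y => (h1 y).trans (mul_le_mul_of_nonneg_right (by linarith) (by positivity)))
    (fun y => (h2 y trivial).trans (mul_le_mul_of_nonneg_right (by linarith) (by positivity)))
    (fun y => (h3 y trivial).trans (mul_le_mul_of_nonneg_right (by linarith) (by positivity)))
    (fun y => by
      have := hKs.dist_le_mul y (ζ k)
      rwa [Real.dist_eq, Real.dist_eq] at this) (hσ_nz k)
  choose C hC hmain using hcore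
  have hle : ∀ k, C k ≤ 1 + ∑ k, C k := fun k => by
    have := Finset.single_le_sum (f := C) (fun k _ => (hC k).le) (Finset.mem_univ k)
    linarith
  have hnn : 0 ≤ ∑ k, C k := Finset.sum_nonneg fun k _ => (hC k).le
  refine ⟨1 + ∑ k, C k, by linarith, fun k x n hn hδ ε hε => ?_⟩
  refine (hmain k x n hn hδ ε hε).trans (ENNReal.ofReal_le_ofReal ?_)
  have := Real.sqrt_nonneg (T / n)
  have := hle k
  gcongr
end

section
/- There exists a constant C ∈ (0,∞) such that for all k ∈ {1,…,m}, all x ∈ ℝ, every n ∈ ℕ with δ = T/n ∈ (0,1), all ε ∈ (0,∞), and all t ∈ [0,T], it holds that E[ ∫_0^t 1_{[ζ_k−ε, ζ_k+ε]}(X^{(δ),x}_s) · σ(X^{(δ),x}_{s̲})^2 ds ] ≤ C(1 + |x|) · ε. -/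
open MeasureTheory ProbabilityTheory

namespace EMLT

/-- A random variable with finite moments of all orders. -/
def AL {Ω : Type*} {m0 : MeasurableSpace Ω} (P : Measure Ω) (Z : Ω → ℝ) : Prop :=
  ∀ p : NNReal, MemLp Z p P

section AL
variable {Ω : Type*} {m0 : MeasurableSpace Ω} {P : Measure Ω} {Z Y : Ω → ℝ}

lemma AL.add (hZ : AL P Z) (hY : AL P Y) : AL P (fun ω => Z ω + Y ω) :=
  fun p => (hZ p).add (hY p)

lemma AL.sub (hZ : AL P Z) (hY : AL P Y) : AL P (fun ω => Z ω - Y ω) :=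
  fun p => (hZ p).sub (hY p)

lemma AL.const [IsFiniteMeasure P] (c : ℝ) : AL P (fun _ => c) :=
  fun p => memLp_const c

lemma AL.mul (hZ : AL P Z) (hY : AL P Y) : AL P (fun ω => Z ω * Y ω) := by
  intro p
  have : ENNReal.HolderTriple ((2 * p : NNReal) : ENNReal) ((2 * p : NNReal) : ENNReal) p := by
    constructor
    by_cases hp : p = 0
    · subst hp; simp
    · have h2 : (2 * p) ≠ 0 := by positivity
      rw [← ENNReal.coe_inv h2, ← ENNReal.coe_inv hp, ← ENNReal.coe_add]
      congr 1
      rw [mul_inv, ← add_mul]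
      rw [show (2⁻¹ + 2⁻¹ : NNReal) = 1 by rw [← two_mul]; exact mul_inv_cancel₀ two_ne_zero]
      simp
  exact (hY (2 * p)).mul (hZ (2 * p))

lemma AL.abs (hZ : AL P Z) : AL P (fun ω => |Z ω|) :=
  fun p => (hZ p).abs

lemma AL.pow [IsFiniteMeasure P] (hZ : AL P Z) (k : ℕ) : AL P (fun ω => Z ω ^ k) := by
  induction k with
  | zero => simpa using AL.const (P := P) 1
  | succ k ih => simpa [pow_succ] using ih.mul hZ

lemma AL.integrable (hZ : AL P Z) : Integrable Z P := by
  have := hZ 1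
  rw [← memLp_one_iff_integrable]
  simpa using this

lemma AL.of_le (hZ : AL P Z) (hY : AEStronglyMeasurable Y P) (h : ∀ᵐ ω ∂P, |Y ω| ≤ |Z ω|) :
    AL P Y :=
  fun p => (hZ p).mono hY (by simpa using h)

/-- linear growth -/
lemma AL.comp_growth [IsFiniteMeasure P] (hZ : AL P Z) (hZm : Measurable Z) {g : ℝ → ℝ}
    (hg : Measurable g) {K : ℝ} (hK : ∀ y, |g y| ≤ K * (1 + |y|)) : AL P (fun ω => g (Z ω)) := by
  refine AL.of_le (((AL.const 1).add hZ.abs).mul (AL.const K))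
    (hg.comp hZm).aestronglyMeasurable (Filter.Eventually.of_forall fun ω => ?_)
  refine (hK _).trans ?_
  rw [mul_comm]
  exact le_abs_self _

end AL

lemma taylor2 {F G H : ℝ → ℝ} {L : ℝ} (hL : 0 ≤ L) (hF : ∀ y, HasDerivAt F (G y) y)
    (hG : ∀ y, HasDerivAt G (H y) y) (hH : ∀ y z, |H y - H z| ≤ L * |y - z|) (u h : ℝ) :
    |F (u + h) - F u - G u * h - H u * h ^ 2 / 2| ≤ L * |h| ^ 3 := by
  have hseg : ∀ y ∈ segment ℝ u (u + h), |y - u| ≤ |h| := by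
    intro y hy
    have := norm_sub_le_of_mem_segment hy
    simpa using this
  have h1 : ∀ y ∈ segment ℝ u (u + h), |G y - G u - H u * (y - u)| ≤ L * |h| ^ 2 := by
    intro y hy
    have := (convex_segment u (u + h)).norm_image_sub_le_of_norm_hasDerivWithin_le
      (f := fun z => G z - H u * z) (f' := fun z => H z - H u * 1) (C := L * |h|)
      (x := u) (y := y)
      (fun z _ => ((hG z).sub ((hasDerivAt_id z).const_mul (H u))).hasDerivWithinAt)
      (fun z hz => by
        rw [mul_one]
        exact (hH z u).trans (mul_le_mul_of_nonneg_left (hseg z hz) hL))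
      (left_mem_segment _ _ _) hy
    rw [Real.norm_eq_abs, Real.norm_eq_abs] at this
    calc |G y - G u - H u * (y - u)| = |G y - H u * y - (G u - H u * u)| := by congr 1; ring
      _ ≤ L * |h| * |y - u| := this
      _ ≤ L * |h| * |h| := mul_le_mul_of_nonneg_left (hseg y hy) (by positivity)
      _ = _ := by ring
  have := (convex_segment u (u + h)).norm_image_sub_le_of_norm_hasDerivWithin_le
      (f := fun z => F z - G u * z - H u * (z - u) ^ 2 / 2)
      (f' := fun z => G z - G u - H u * (z - u)) (C := L * |h| ^ 2)
      (x := u) (y := u + h)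
      (fun z _ => by
        have e1 := (hF z).sub ((hasDerivAt_id z).const_mul (G u))
        have e2 := ((((hasDerivAt_id z).sub_const u).pow 2).const_mul (H u)).div_const 2
        have := (e1.sub e2).hasDerivWithinAt (s := segment ℝ u (u + h))
        refine this.congr_deriv ?_
        simp; ring)
      h1
      (left_mem_segment _ _ _) (right_mem_segment _ _ _)
  rw [Real.norm_eq_abs, Real.norm_eq_abs] at this
  calc _ = |F (u + h) - G u * (u + h) - H u * (u + h - u) ^ 2 / 2
        - (F u - G u * u - H u * (u - u) ^ 2 / 2)| := by congr 1; ring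
    _ ≤ _ := this
    _ = _ := by rw [add_sub_cancel_left]; ring

/-- base test function -/
noncomputable def bF (u : ℝ) : ℝ := u * Real.arctan u - Real.log (1 + u ^ 2) / 2

lemma bF_deriv (u : ℝ) : HasDerivAt bF (Real.arctan u) u := by
  have h0 : (1 + u ^ 2) ≠ 0 := by positivity
  have e1 := (hasDerivAt_id u).mul (Real.hasDerivAt_arctan u)
  have e2 := ((((hasDerivAt_id u).pow 2).const_add 1).log h0).div_const 2
  have := e1.sub e2
  refine this.congr_deriv ?_
  simp
  field_simp
  ring

lemma bH_lip (y z : ℝ) : |1 / (1 + y ^ 2) - 1 / (1 + z ^ 2)| ≤ 1 * |y - z| := by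
  have h0 : 0 < (1 + y ^ 2) := by positivity
  have h1 : 0 < (1 + z ^ 2) := by positivity
  rw [div_sub_div _ _ h0.ne' h1.ne', abs_div, abs_of_pos (mul_pos h0 h1),
    div_le_iff₀ (mul_pos h0 h1)]
  have : |1 * (1 + z ^ 2) - (1 + y ^ 2) * 1| = |y - z| * |y + z| := by
    rw [← abs_mul, ← abs_neg]; congr 1; ring
  rw [this, one_mul]
  refine mul_le_mul_of_nonneg_left ?_ (abs_nonneg _)
  rw [abs_le]
  constructor <;> nlinarith [sq_nonneg (y - 1/2), sq_nonneg (z - 1/2), sq_nonneg (y * z),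
    sq_nonneg (y + 1/2), sq_nonneg (z + 1/2)]

/-- Test function. -/
noncomputable def tf (ζ ε y : ℝ) : ℝ := ε ^ 2 * bF ((y - ζ) / ε)
/-- its second derivative -/
noncomputable def ph (ζ ε y : ℝ) : ℝ := 1 / (1 + ((y - ζ) / ε) ^ 2)

lemma tf_taylor (ζ ε : ℝ) (hε : 0 < ε) (y h : ℝ) :
    |tf ζ ε (y + h) - tf ζ ε y - ε * Real.arctan ((y - ζ) / ε) * h - ph ζ ε y * h ^ 2 / 2|
      ≤ |h| ^ 3 / ε := by
  have := taylor2 zero_le_one bF_deriv Real.hasDerivAt_arctan bH_lip ((y - ζ) / ε) (h / ε)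
  have e : ε ^ 2 * |bF ((y - ζ) / ε + h / ε) - bF ((y - ζ) / ε) - Real.arctan ((y - ζ) / ε) * (h / ε)
     - 1 / (1 + ((y - ζ) / ε) ^ 2) * (h / ε) ^ 2 / 2| ≤ ε ^ 2 * (1 * |h / ε| ^ 3) :=
    mul_le_mul_of_nonneg_left this (by positivity)
  rw [← abs_of_pos (pow_pos hε 2), ← abs_mul, abs_of_pos (pow_pos hε 2), abs_div, abs_of_pos hε] at e
  unfold tf ph
  have e2 : ε ^ 2 * (1 * (|h| / ε) ^ 3) = |h| ^ 3 / ε := by field_simp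
  rw [e2] at e
  refine le_trans (le_of_eq ?_) e
  congr 1
  rw [← add_div, show y + h - ζ = y - ζ + h by ring]
  field_simp

lemma tf_lip (ζ ε : ℝ) (hε : 0 < ε) (y z : ℝ) : |tf ζ ε y - tf ζ ε z| ≤ 2 * ε * |y - z| := by
  have := convex_univ.norm_image_sub_le_of_norm_hasDerivWithin_le (C := 2)
      (f := bF) (f' := Real.arctan) (x := (z - ζ) / ε) (y := (y - ζ) / ε)
      (fun z _ => (bF_deriv z).hasDerivWithinAt) (fun z _ => by
        rw [Real.norm_eq_abs, abs_le]
        have := Real.pi_lt_four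
        constructor
        · linarith [Real.neg_pi_div_two_lt_arctan z]
        · linarith [Real.arctan_lt_pi_div_two z]) (Set.mem_univ _) (Set.mem_univ _)
  rw [Real.norm_eq_abs, Real.norm_eq_abs] at this
  unfold tf
  rw [← mul_sub, abs_mul, abs_of_pos (pow_pos hε 2)]
  calc _ ≤ ε ^ 2 * (2 * |(y - ζ) / ε - (z - ζ) / ε|) :=
        mul_le_mul_of_nonneg_left this (by positivity)
    _ = _ := by
      rw [← sub_div, abs_div, abs_of_pos hε, sub_sub_sub_cancel_right]; field_simp

lemma tf_cont (ζ ε : ℝ) : Continuous (tf ζ ε) := by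
  have h : Continuous bF := continuous_iff_continuousAt.2 fun u => (bF_deriv u).continuousAt
  unfold tf
  exact continuous_const.mul (h.comp (by fun_prop))

lemma ph_cont (ζ ε : ℝ) : Continuous (ph ζ ε) := by
  unfold ph
  refine continuous_const.div (by fun_prop) fun y => by positivity

lemma ph_nonneg (ζ ε y : ℝ) : 0 ≤ ph ζ ε y := by unfold ph; positivity

lemma ph_le_one (ζ ε y : ℝ) : ph ζ ε y ≤ 1 := by
  unfold ph
  rw [div_le_one (by positivity)]
  nlinarith [sq_nonneg ((y - ζ) / ε)]

lemma ind_le_ph (ζ ε : ℝ) (hε : 0 < ε) (y : ℝ) :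
    (if y ∈ Set.Icc (ζ - ε) (ζ + ε) then (1:ℝ) else 0) ≤ 2 * ph ζ ε y := by
  split_ifs with h
  · unfold ph
    have : ((y - ζ) / ε) ^ 2 ≤ 1 := by
      rw [sq_le_one_iff_abs_le_one, abs_div, abs_of_pos hε, div_le_one hε, abs_le]
      constructor <;> linarith [h.1, h.2]
    rw [← mul_div_assoc, le_div_iff₀ (by positivity)]
    linarith
  · have := ph_nonneg ζ ε y; linarith

lemma growth_of_lip {g : ℝ → ℝ} {S : Set ℝ} (h : ∃ K : NNReal, LipschitzOnWith K g S) :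
    ∃ K : ℝ, ∀ y ∈ S, |g y| ≤ K * (1 + |y|) := by
  obtain ⟨K, hK⟩ := h
  rcases S.eq_empty_or_nonempty with rfl | ⟨z, hz⟩
  · exact ⟨0, by simp⟩
  · refine ⟨|g z| + K * (1 + |z|), fun y hy => ?_⟩
    have h1 := hK.dist_le_mul y hy z hz
    rw [Real.dist_eq, Real.dist_eq] at h1
    have h2 : |g y| ≤ |g y - g z| + |g z| := by
      simpa using abs_add_le (g y - g z) (g z)
    have h3 : |y - z| ≤ |y| + |z| := abs_sub _ _
    have h4 : (K : ℝ) * |y - z| ≤ K * (|y| + |z|) := mul_le_mul_of_nonneg_left h3 K.2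
    have hk : (0:ℝ) ≤ K := K.2
    have := abs_nonneg (g z)
    have := abs_nonneg y
    have := abs_nonneg z
    have : 0 ≤ |g z| * |y| := by positivity
    have : 0 ≤ K * (|z| * |y|) := by positivity
    nlinarith

lemma growth_mu {μ : ℝ → ℝ} (m : ℕ) (hm : 0 < m) (ζ : Fin m → ℝ)
    (hμ_low : ∃ K : NNReal, LipschitzOnWith K μ (Set.Iio (ζ ⟨0, hm⟩)))
    (hμ_high : ∃ K : NNReal, LipschitzOnWith K μ (Set.Ioi (ζ ⟨m - 1, Nat.sub_lt hm one_pos⟩)))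
    (hμ_mid : ∀ (k : Fin m) (h : (k : ℕ) + 1 < m),
      ∃ K : NNReal, LipschitzOnWith K μ (Set.Ioo (ζ k) (ζ ⟨(k : ℕ) + 1, h⟩))) :
    ∃ K : ℝ, ∀ y, |μ y| ≤ K * (1 + |y|) := by
  have key : ∀ j : ℕ, ∀ hj : j < m, ∃ K : ℝ, ∀ y ≤ ζ ⟨j, hj⟩, |μ y| ≤ K * (1 + |y|) := by
    intro j
    induction j with
    | zero =>
      intro hj
      obtain ⟨K, hK⟩ := growth_of_lip hμ_low
      refine ⟨max K |μ (ζ ⟨0, hj⟩)|, fun y hy => ?_⟩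
      rcases hy.lt_or_eq with h | rfl
      · exact (hK y h).trans (mul_le_mul_of_nonneg_right (le_max_left _ _) (by positivity))
      · refine (le_max_right K _).trans (le_mul_of_one_le_right ?_ (by simp))
        exact (abs_nonneg _).trans (le_max_right K _)
    | succ j ih =>
      intro hj
      obtain ⟨K1, hK1⟩ := ih (by omega)
      obtain ⟨K2, hK2⟩ := growth_of_lip (hμ_mid ⟨j, by omega⟩ hj)
      refine ⟨max K1 (max K2 |μ (ζ ⟨j + 1, hj⟩)|), fun y hy => ?_⟩
      rcases hy.lt_or_eq with h | rfl
      · rcases le_or_gt y (ζ ⟨j, by omega⟩) with h' | h'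
        · exact (hK1 y h').trans (mul_le_mul_of_nonneg_right (le_max_left _ _) (by positivity))
        · exact (hK2 y ⟨h', h⟩).trans (mul_le_mul_of_nonneg_right
            ((le_max_left _ _).trans (le_max_right _ _)) (by positivity))
      · have hle : |μ (ζ ⟨j + 1, hj⟩)| ≤ max K1 (max K2 |μ (ζ ⟨j + 1, hj⟩)|) :=
          (le_max_right K2 _).trans (le_max_right _ _)
        exact hle.trans (le_mul_of_one_le_right ((abs_nonneg _).trans hle) (by simp))
  obtain ⟨K1, hK1⟩ := key (m - 1) (Nat.sub_lt hm one_pos)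
  obtain ⟨K2, hK2⟩ := growth_of_lip hμ_high
  refine ⟨max K1 K2, fun y => ?_⟩
  rcases le_or_gt y (ζ ⟨m - 1, Nat.sub_lt hm one_pos⟩) with h | h
  · exact (hK1 y h).trans (mul_le_mul_of_nonneg_right (le_max_left _ _) (by positivity))
  · exact (hK2 y h).trans (mul_le_mul_of_nonneg_right (le_max_right _ _) (by positivity))

/-- The properties of the driving processes that are used in the proof. -/
structure Inc {Ω : Type*} {m0 : MeasurableSpace Ω} (F : Filtration ℝ m0) (P : Measure Ω)
    (T Λ c3 : ℝ) (W N : ℝ → Ω → ℝ) : Prop where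
  Λ0 : 0 ≤ Λ
  mW : ∀ t ∈ Set.Icc (0:ℝ) T, Measurable[F t] (W t)
  mN : ∀ t ∈ Set.Icc (0:ℝ) T, Measurable[F t] (N t)
  alW : ∀ s t : ℝ, 0 ≤ s → s ≤ t → t ≤ T → AL P (fun ω => W t ω - W s ω)
  alN : ∀ s t : ℝ, 0 ≤ s → s ≤ t → t ≤ T → AL P (fun ω => N t ω - N s ω)
  meanW : ∀ s t : ℝ, 0 ≤ s → s ≤ t → t ≤ T → ∫ ω, (W t ω - W s ω) ∂P = 0
  sqW : ∀ s t : ℝ, 0 ≤ s → s ≤ t → t ≤ T → ∫ ω, (W t ω - W s ω) ^ 2 ∂P = t - s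
  cubW : ∀ s t : ℝ, 0 ≤ s → s ≤ t → t ≤ T →
    ∫ ω, |W t ω - W s ω| ^ 3 ∂P = c3 * ((t - s) * √(t - s))
  meanN : ∀ s t : ℝ, 0 ≤ s → s ≤ t → t ≤ T → ∫ ω, |N t ω - N s ω| ∂P ≤ Λ * (t - s)
  sqN : ∀ s t : ℝ, 0 ≤ s → s ≤ t → t ≤ T → ∫ ω, (N t ω - N s ω) ^ 2 ∂P ≤ Λ * (t - s)
  indW : ∀ s t : ℝ, 0 ≤ s → s ≤ t → t ≤ T → ∀ Z : Ω → ℝ, Measurable[F s] Z →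
    IndepFun Z (fun ω => W t ω - W s ω) P
  indN : ∀ s t : ℝ, 0 ≤ s → s ≤ t → t ≤ T → ∀ Z : Ω → ℝ, Measurable[F s] Z →
    IndepFun Z (fun ω => N t ω - N s ω) P
  cW : ∀ᵐ ω ∂P, ContinuousOn (fun t => W t ω) (Set.Icc 0 T)
  moN : ∀ᵐ ω ∂P, ∀ s t : ℝ, 0 ≤ s → s ≤ t → t ≤ T → N s ω ≤ N t ω

lemma gauss_cub (v : NNReal) : ∫ x, |x| ^ 3 ∂(gaussianReal 0 v)
    = (∫ x, |x| ^ 3 ∂(gaussianReal 0 1)) * (v * √v) := by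
  have h := gaussianReal_map_const_mul (μ := 0) (v := 1) (√v)
  have e : (NNReal.mk ((√(v:ℝ)) ^ 2) (sq_nonneg _) * 1 : NNReal) = v := by
    rw [mul_one]; apply NNReal.eq; simp
  rw [e, mul_zero] at h
  rw [← h, integral_map (by fun_prop) (by fun_prop), ← integral_mul_const]
  congr 1
  ext x
  rw [abs_mul, mul_pow, abs_of_nonneg (Real.sqrt_nonneg _)]
  have : (√(v:ℝ)) ^ 3 = v * √v := by
    rw [pow_succ, Real.sq_sqrt v.coe_nonneg]
  rw [this]; ring

lemma poisson_expint (r : NNReal) (t : ℝ) :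
    Integrable (fun n : ℕ => Real.exp (t * (n : ℝ))) (poissonMeasure r) := by
  rw [integrable_poissonMeasure_iff]
  have := (Real.summable_pow_div_factorial (r * Real.exp t)).mul_left (Real.exp (-r))
  refine this.congr fun n => ?_
  rw [Real.norm_eq_abs, abs_of_pos (Real.exp_pos _), mul_pow, ← Real.exp_nat_mul]
  rw [mul_comm t]
  ring

lemma poisson_al (r : NNReal) : AL (poissonMeasure r) (fun n : ℕ => (n : ℝ)) := by
  intro p
  refine memLp_of_mem_interior_integrableExpSet ?_ p
  have : integrableExpSet (fun n : ℕ => (n : ℝ)) (poissonMeasure r) = Set.univ := by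
    ext t
    simpa [integrableExpSet] using poisson_expint r t
  rw [this]; simp

lemma hasSum_exp (r : ℝ) : HasSum (fun n : ℕ => r ^ n / (n.factorial : ℝ)) (Real.exp r) := by
  rw [Real.exp_eq_exp_ℝ]
  exact NormedSpace.expSeries_div_hasSum_exp r

lemma poisson_mean (r : NNReal) : ∫ n : ℕ, (n : ℝ) ∂(poissonMeasure r) = r := by
  have h := hasSum_integral_poissonMeasure (poisson_al r).integrable
  refine h.unique ?_
  rw [← hasSum_nat_add_iff' 1]
  have := (hasSum_exp r).mul_left (Real.exp (-r) * r)
  rw [mul_right_comm, ← Real.exp_add, neg_add_cancel, Real.exp_zero, one_mul] at this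
  simp only [Finset.range_one, Finset.sum_singleton, Nat.cast_zero, smul_zero, sub_zero]
  refine this.congr_fun fun n => ?_
  rw [Nat.factorial_succ]
  push_cast
  rw [smul_eq_mul]
  have : ((n:ℝ) + 1) ≠ 0 := by positivity
  field_simp
  ring

lemma poisson_sq (r : NNReal) : ∫ n : ℕ, (n : ℝ) ^ 2 ∂(poissonMeasure r) = r + r ^ 2 := by
  have h1 : ∫ n : ℕ, ((n : ℝ) ^ 2 - n) ∂(poissonMeasure r) = r ^ 2 := by
    have h := hasSum_integral_poissonMeasure (((poisson_al r).pow 2).sub (poisson_al r)).integrable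
    refine h.unique ?_
    rw [← hasSum_nat_add_iff' 2]
    have := (hasSum_exp r).mul_left (Real.exp (-r) * r ^ 2)
    rw [mul_right_comm, ← Real.exp_add, neg_add_cancel, Real.exp_zero, one_mul] at this
    simp only [Finset.sum_range_succ, Finset.range_zero, Finset.sum_empty, Nat.cast_zero,
      Nat.cast_one]
    norm_num
    refine this.congr_fun fun n => ?_
    rw [Nat.factorial_succ, Nat.factorial_succ]
    push_cast
    have : ((n:ℝ) + 1) ≠ 0 := by positivity
    have : ((n:ℝ) + 1 + 1) ≠ 0 := by positivity
    field_simp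
    ring
  rw [integral_sub ((poisson_al r).pow 2).integrable (poisson_al r).integrable, poisson_mean] at h1
  linarith

lemma Inc.mk' {Ω : Type*} {m0 : MeasurableSpace Ω}
    (F : Filtration ℝ m0) (P : Measure Ω) [IsProbabilityMeasure P]
    (T : ℝ) (hT : 0 < T)
    (lam : ℝ → ℝ) 
    (hlam_pos : ∀ t ∈ Set.Icc (0:ℝ) T, 0 < lam t)
    (lamB : ℝ) (hlamB : ∀ t ∈ Set.Icc (0:ℝ) T, lam t ≤ lamB)
    (W N : ℝ → Ω → ℝ)
    (hW_adapted : ∀ t ∈ Set.Icc (0:ℝ) T, Measurable[F t] (W t))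
    (hN_adapted : ∀ t ∈ Set.Icc (0:ℝ) T, Measurable[F t] (N t))
    (hW_cont : ∀ᵐ ω ∂P, ContinuousOn (fun t => W t ω) (Set.Icc 0 T))
    (hN_mono : ∀ᵐ ω ∂P, ∀ s t : ℝ, 0 ≤ s → s ≤ t → t ≤ T → N s ω ≤ N t ω)
    (hW_gauss : ∀ s t : ℝ, 0 ≤ s → s ≤ t → t ≤ T →
      Measure.map (fun ω => W t ω - W s ω) P = gaussianReal 0 (Real.toNNReal (t - s)))
    (hN_poisson : ∀ s t : ℝ, 0 ≤ s → s ≤ t → t ≤ T →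
      Measure.map (fun ω => N t ω - N s ω) P
        = Measure.map (fun k : ℕ => (k : ℝ))
            (poissonMeasure (Real.toNNReal (∫ u in s..t, lam u))))
    (h_indep : ∀ s t : ℝ, 0 ≤ s → s ≤ t → t ≤ T →
      Indep (MeasurableSpace.comap (fun ω => (W t ω - W s ω, N t ω - N s ω)) inferInstance)
        (F s) P) :
    Inc F P T (lamB + lamB ^ 2 * T) (∫ x, |x| ^ 3 ∂(gaussianReal 0 1)) W N := by
  have hB : 0 ≤ lamB := by
    have h0 : (0:ℝ) ∈ Set.Icc 0 T := ⟨le_rfl, hT.le⟩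
    exact ((hlam_pos 0 h0).trans_le (hlamB 0 h0)).le
  have mW : ∀ t ∈ Set.Icc (0:ℝ) T, Measurable (W t) := fun t ht =>
    (hW_adapted t ht).mono (F.le t) le_rfl
  have mN : ∀ t ∈ Set.Icc (0:ℝ) T, Measurable (N t) := fun t ht =>
    (hN_adapted t ht).mono (F.le t) le_rfl
  have mWi : ∀ s t : ℝ, 0 ≤ s → s ≤ t → t ≤ T → Measurable (fun ω => W t ω - W s ω) :=
    fun s t h0 h1 h2 => (mW t ⟨h0.trans h1, h2⟩).sub (mW s ⟨h0, h1.trans h2⟩)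
  have mNi : ∀ s t : ℝ, 0 ≤ s → s ≤ t → t ≤ T → Measurable (fun ω => N t ω - N s ω) :=
    fun s t h0 h1 h2 => (mN t ⟨h0.trans h1, h2⟩).sub (mN s ⟨h0, h1.trans h2⟩)
  have hlam : ∀ s t : ℝ, 0 ≤ s → s ≤ t → t ≤ T →
      ((Real.toNNReal (∫ u in s..t, lam u) : NNReal) : ℝ) ≤ lamB * (t - s) := by
    intro s t h0 h1 h2
    have h := intervalIntegral.norm_integral_le_of_norm_le_const (a := s) (b := t) (f := lam)
      (C := lamB) (fun u hu => by
        rw [Set.uIoc_of_le h1] at hu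
        have hu' : u ∈ Set.Icc (0:ℝ) T := ⟨h0.trans hu.1.le, hu.2.trans h2⟩
        rw [Real.norm_eq_abs, abs_of_pos (hlam_pos u hu')]
        exact hlamB u hu')
    rw [abs_of_nonneg (sub_nonneg.2 h1)] at h
    rw [Real.coe_toNNReal']
    exact max_le ((le_abs_self _).trans h) (mul_nonneg hB (sub_nonneg.2 h1))
  have cW : ∀ s t : ℝ, 0 ≤ s → s ≤ t → t ≤ T → ∀ g : ℝ → ℝ, Continuous g →
      ∫ ω, g (W t ω - W s ω) ∂P = ∫ x, g x ∂(gaussianReal 0 (Real.toNNReal (t - s))) := by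
    intro s t h0 h1 h2 g hg
    rw [← hW_gauss s t h0 h1 h2, integral_map (mWi s t h0 h1 h2).aemeasurable
      hg.aestronglyMeasurable]
  have cN : ∀ s t : ℝ, 0 ≤ s → s ≤ t → t ≤ T → ∀ g : ℝ → ℝ, Continuous g →
      ∫ ω, g (N t ω - N s ω) ∂P
        = ∫ n : ℕ, g n ∂(poissonMeasure (Real.toNNReal (∫ u in s..t, lam u))) := by
    intro s t h0 h1 h2 g hg
    rw [← integral_map (φ := fun ω => N t ω - N s ω) (mNi s t h0 h1 h2).aemeasurable
      hg.aestronglyMeasurable, hN_poisson s t h0 h1 h2,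
      integral_map (by fun_prop) hg.aestronglyMeasurable]
  have hind : ∀ s t : ℝ, 0 ≤ s → s ≤ t → t ≤ T → ∀ Z : Ω → ℝ, Measurable[F s] Z →
    IndepFun Z (fun ω => (W t ω - W s ω, N t ω - N s ω)) P := by
    intro s t h0 h1 h2 Z hZ
    rw [IndepFun_iff_Indep]
    exact indep_of_indep_of_le_left (h_indep s t h0 h1 h2).symm hZ.comap_le
  refine ⟨by positivity, hW_adapted, hN_adapted, ?_, ?_, ?_, ?_, ?_, ?_, ?_, ?_, ?_,
    hW_cont, hN_mono⟩
  · intro s t h0 h1 h2 p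
    have := memLp_id_gaussianReal (μ := 0) (v := Real.toNNReal (t - s)) p
    rw [← hW_gauss s t h0 h1 h2] at this
    exact (memLp_map_measure_iff aestronglyMeasurable_id (mWi s t h0 h1 h2).aemeasurable).1 this
  · intro s t h0 h1 h2 p
    have := poisson_al (Real.toNNReal (∫ u in s..t, lam u)) p
    have h3 := (memLp_map_measure_iff (f := fun k : ℕ => (k : ℝ)) (g := id) 
      aestronglyMeasurable_id (by fun_prop)).2 this
    rw [← hN_poisson s t h0 h1 h2] at h3
    exact (memLp_map_measure_iff aestronglyMeasurable_id (mNi s t h0 h1 h2).aemeasurable).1 h3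
  · intro s t h0 h1 h2
    rw [cW s t h0 h1 h2 (fun x => x) continuous_id, integral_id_gaussianReal]
  · intro s t h0 h1 h2
    rw [cW s t h0 h1 h2 (fun x => x ^ 2) (by fun_prop)]
    have := variance_fun_id_gaussianReal (μ := 0) (v := Real.toNNReal (t - s))
    rw [variance_of_integral_eq_zero (by fun_prop) (by simp)] at this
    rw [this, Real.coe_toNNReal _ (sub_nonneg.2 h1)]
  · intro s t h0 h1 h2
    rw [cW s t h0 h1 h2 (fun x => |x| ^ 3) (by fun_prop), gauss_cub,
      Real.coe_toNNReal _ (sub_nonneg.2 h1)]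
  · intro s t h0 h1 h2
    rw [cN s t h0 h1 h2 (fun x => |x|) (by fun_prop)]
    simp only [Nat.abs_cast]
    rw [poisson_mean]
    refine (hlam s t h0 h1 h2).trans ?_
    refine mul_le_mul_of_nonneg_right ?_ (sub_nonneg.2 h1)
    have : 0 ≤ lamB ^ 2 * T := by positivity
    linarith
  · intro s t h0 h1 h2
    rw [cN s t h0 h1 h2 (fun x => x ^ 2) (by fun_prop), poisson_sq]
    have h3 := hlam s t h0 h1 h2
    set r : ℝ := ((Real.toNNReal (∫ u in s..t, lam u) : NNReal) : ℝ)
    have hr : 0 ≤ r := NNReal.coe_nonneg _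
    have h4 : r ^ 2 ≤ (lamB * (t - s)) ^ 2 := pow_le_pow_left₀ hr h3 2
    have h5 : (lamB * (t - s)) ^ 2 ≤ lamB ^ 2 * T * (t - s) := by
      have : t - s ≤ T := by linarith
      have h6 : (t - s) * (t - s) ≤ T * (t - s) :=
        mul_le_mul_of_nonneg_right this (sub_nonneg.2 h1)
      nlinarith [sq_nonneg lamB]
    nlinarith
  · intro s t h0 h1 h2 Z hZ
    exact (hind s t h0 h1 h2 Z hZ).comp (φ := id) (ψ := Prod.fst) measurable_id measurable_fst
  · intro s t h0 h1 h2 Z hZ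
    exact (hind s t h0 h1 h2 Z hZ).comp (φ := id) (ψ := Prod.snd) measurable_id measurable_snd

lemma tf_growth (ζ ε : ℝ) (hε : 0 < ε) (y : ℝ) :
    |tf ζ ε y| ≤ (|tf ζ ε 0| + 2 * ε) * (1 + |y|) := by
  have h := tf_lip ζ ε hε y 0
  rw [sub_zero] at h
  have h2 : |tf ζ ε y| ≤ |tf ζ ε y - tf ζ ε 0| + |tf ζ ε 0| := by
    simpa using abs_add_le (tf ζ ε y - tf ζ ε 0) (tf ζ ε 0)
  have h3 : 0 ≤ |tf ζ ε 0| * |y| := by positivity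
  nlinarith [abs_nonneg y]

lemma int_prod {Ω : Type*} {m0 : MeasurableSpace Ω} {P : Measure Ω} {Z Y : Ω → ℝ}
    (h : IndepFun Z Y P) (hZ : AL P Z) (hY : AL P Y) :
    ∫ ω, Z ω * Y ω ∂P = (∫ ω, Z ω ∂P) * ∫ ω, Y ω ∂P :=
  h.integral_fun_mul_eq_mul_integral hZ.integrable.1 hY.integrable.1

lemma int6_le {Ω : Type*} {m0 : MeasurableSpace Ω} {P : Measure Ω}
    {g1 g2 g3 g4 g5 g6 k : Ω → ℝ} {c3 c4 c5 c6 : ℝ}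
    (i1 : Integrable g1 P) (i2 : Integrable g2 P) (i3 : Integrable g3 P) (i4 : Integrable g4 P)
    (i5 : Integrable g5 P) (i6 : Integrable g6 P) (ik : Integrable k P)
    (h : ∀ ω, g1 ω + g2 ω + c3 * g3 ω - c4 * g4 ω - c5 * g5 ω - c6 * g6 ω ≤ k ω) :
    ∫ ω, g1 ω ∂P + ∫ ω, g2 ω ∂P + c3 * ∫ ω, g3 ω ∂P - c4 * ∫ ω, g4 ω ∂P - c5 * ∫ ω, g5 ω ∂P
      - c6 * ∫ ω, g6 ω ∂P ≤ ∫ ω, k ω ∂P := by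
  have j3 := i3.const_mul c3
  have j4 := i4.const_mul c4
  have j5 := i5.const_mul c5
  have j6 := i6.const_mul c6
  have k2 : Integrable (fun ω => g1 ω + g2 ω) P := i1.add i2
  have k3 : Integrable (fun ω => g1 ω + g2 ω + c3 * g3 ω) P := k2.add j3
  have k4 : Integrable (fun ω => g1 ω + g2 ω + c3 * g3 ω - c4 * g4 ω) P := k3.sub j4
  have k5 : Integrable (fun ω => g1 ω + g2 ω + c3 * g3 ω - c4 * g4 ω - c5 * g5 ω) P := k4.sub j5
  have k6 : Integrable (fun ω => g1 ω + g2 ω + c3 * g3 ω - c4 * g4 ω - c5 * g5 ω - c6 * g6 ω) P :=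
    k5.sub j6
  have := integral_mono k6 ik h
  rwa [integral_sub k5 j6, integral_sub k4 j5, integral_sub k3 j4, integral_add k2 j3,
    integral_add i1 i2, integral_const_mul, integral_const_mul, integral_const_mul,
    integral_const_mul] at this

lemma step_le {Ω : Type*} {m0 : MeasurableSpace Ω} {F : Filtration ℝ m0} {P : Measure Ω}
    [IsProbabilityMeasure P] {T Λ c3 : ℝ} {W N : ℝ → Ω → ℝ} (I : Inc F P T Λ c3 W N)
    {s t : ℝ} (h0 : 0 ≤ s) (h1 : s ≤ t) (h2 : t ≤ T) {Z A B D : Ω → ℝ}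
    (mZ : Measurable[F s] Z) (mA : Measurable[F s] A) (mB : Measurable[F s] B)
    (mD : Measurable[F s] D) (aZ : AL P Z) (aA : AL P A) (aB : AL P B) (aD : AL P D)
    (ζ ε : ℝ) (hε : 0 < ε) :
    (t - s) * ∫ ω, ph ζ ε (Z ω) * B ω ^ 2 ∂P ≤
      2 * (∫ ω, tf ζ ε (Z ω + A ω * (t - s) + B ω * (W t ω - W s ω) + D ω * (N t ω - N s ω)) ∂P
        - ∫ ω, tf ζ ε (Z ω) ∂P)
      + 4 * ε * ((t - s) * (∫ ω, |A ω| ∂P + Λ * ∫ ω, |D ω| ∂P))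
      + 2 / ε * (∫ ω, |B ω| ^ 3 ∂P) * c3 * ((t - s) * √(t - s)) := by
  have hle := F.le s
  have mZ' := mZ.mono hle le_rfl
  have mA' := mA.mono hle le_rfl
  have mB' := mB.mono hle le_rfl
  have mD' := mD.mono hle le_rfl
  have aW := I.alW s t h0 h1 h2
  have aN := I.alN s t h0 h1 h2
  have mWs : ∀ u ∈ Set.Icc (0:ℝ) T, Measurable (W u) := fun u hu => (I.mW u hu).mono (F.le u) le_rfl
  have mNs : ∀ u ∈ Set.Icc (0:ℝ) T, Measurable (N u) := fun u hu => (I.mN u hu).mono (F.le u) le_rfl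
  have m1 := mWs s ⟨h0, h1.trans h2⟩
  have m2 := mWs t ⟨h0.trans h1, h2⟩
  have m3 := mNs s ⟨h0, h1.trans h2⟩
  have m4 := mNs t ⟨h0.trans h1, h2⟩
  have mat : Measurable (fun y : ℝ => ε * Real.arctan ((y - ζ) / ε)) := by fun_prop
  have mph := (ph_cont ζ ε).measurable
  have mtf := (tf_cont ζ ε).measurable
  -- the coefficient of the martingale term
  have aG : AL P (fun ω => ε * Real.arctan ((Z ω - ζ) / ε) * B ω) := by
    refine AL.mul (AL.of_le (AL.const (ε * 2)) (mat.comp mZ').aestronglyMeasurable ?_) aB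
    refine Filter.Eventually.of_forall fun ω => ?_
    rw [abs_mul, abs_mul]
    refine mul_le_mul_of_nonneg_left ?_ (abs_nonneg _)
    rw [abs_two, abs_le]
    have := Real.pi_lt_four
    constructor
    · linarith [Real.neg_pi_div_two_lt_arctan ((Z ω - ζ) / ε)]
    · linarith [Real.arctan_lt_pi_div_two ((Z ω - ζ) / ε)]
  have mG : Measurable[F s] (fun ω => ε * Real.arctan ((Z ω - ζ) / ε) * B ω) :=
    (mat.comp mZ).mul mB
  have aH : AL P (fun ω => ph ζ ε (Z ω) * B ω ^ 2) := by
    refine AL.mul (AL.of_le (AL.const 1) (mph.comp mZ').aestronglyMeasurable ?_) (aB.pow 2)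
    refine Filter.Eventually.of_forall fun ω => ?_
    rw [abs_one, abs_of_nonneg (ph_nonneg _ _ _)]
    exact ph_le_one _ _ _
  have mH : Measurable[F s] (fun ω => ph ζ ε (Z ω) * B ω ^ 2) :=
    (mph.comp mZ).mul (mB.pow_const 2)
  have mB3 : Measurable[F s] (fun ω => |B ω| ^ 3) :=
    (continuous_abs.pow 3).measurable.comp mB
  have mDa : Measurable[F s] (fun ω => |D ω|) := continuous_abs.measurable.comp mD
  have atZ : AL P (fun ω => tf ζ ε (Z ω)) := aZ.comp_growth mZ' mtf (tf_growth ζ ε hε)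
  have aX : AL P (fun ω => Z ω + A ω * (t - s) + B ω * (W t ω - W s ω) + D ω * (N t ω - N s ω)) :=
    ((aZ.add (aA.mul (AL.const _))).add (aB.mul aW)).add (aD.mul aN)
  have atX := aX.comp_growth (by fun_prop) mtf (tf_growth ζ ε hε)
  -- expectations of the products
  have e1 : ∫ ω, ε * Real.arctan ((Z ω - ζ) / ε) * B ω * (W t ω - W s ω) ∂P = 0 := by
    rw [int_prod (I.indW s t h0 h1 h2 _ mG) aG aW, I.meanW s t h0 h1 h2, mul_zero]
  have e2 : ∫ ω, ph ζ ε (Z ω) * B ω ^ 2 * (W t ω - W s ω) ^ 2 ∂P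
      = (∫ ω, ph ζ ε (Z ω) * B ω ^ 2 ∂P) * (t - s) := by
    rw [int_prod (Z := fun ω => ph ζ ε (Z ω) * B ω ^ 2) (Y := fun ω => (W t ω - W s ω) ^ 2)
      ((I.indW s t h0 h1 h2 _ mH).comp (φ := id) (ψ := fun x => x ^ 2) measurable_id
        (by fun_prop)) aH (aW.pow 2), I.sqW s t h0 h1 h2]
  have e3 : ∫ ω, |B ω| ^ 3 * |W t ω - W s ω| ^ 3 ∂P
      = (∫ ω, |B ω| ^ 3 ∂P) * (c3 * ((t - s) * √(t - s))) := by
    rw [int_prod (Z := fun ω => |B ω| ^ 3) (Y := fun ω => |W t ω - W s ω| ^ 3)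
      ((I.indW s t h0 h1 h2 _ mB3).comp (φ := id) (ψ := fun x => |x| ^ 3) measurable_id
        (by fun_prop)) (aB.abs.pow 3) (aW.abs.pow 3), I.cubW s t h0 h1 h2]
  have e4 : ∫ ω, |D ω| * |N t ω - N s ω| ∂P ≤ (∫ ω, |D ω| ∂P) * (Λ * (t - s)) := by
    rw [int_prod (Z := fun ω => |D ω|) (Y := fun ω => |N t ω - N s ω|)
      ((I.indN s t h0 h1 h2 _ mDa).comp (φ := id) (ψ := fun x => |x|) measurable_id
        (by fun_prop)) aD.abs aN.abs]
    exact mul_le_mul_of_nonneg_left (I.meanN s t h0 h1 h2)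
      (integral_nonneg fun ω => abs_nonneg _)
  have i1 := atZ.integrable
  have i2 := (aG.mul aW).integrable
  have i3 := (aH.mul (aW.pow 2)).integrable
  have i4 := ((aB.abs.pow 3).mul (aW.abs.pow 3)).integrable
  have i5 := aA.abs.integrable
  have i6 := (aD.abs.mul aN.abs).integrable
  have hpt : ∀ ω, tf ζ ε (Z ω) + ε * Real.arctan ((Z ω - ζ) / ε) * B ω * (W t ω - W s ω)
      + (1 / 2) * (ph ζ ε (Z ω) * B ω ^ 2 * (W t ω - W s ω) ^ 2)
      - (1 / ε) * (|B ω| ^ 3 * |W t ω - W s ω| ^ 3)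
      - (2 * ε * (t - s)) * |A ω| - (2 * ε) * (|D ω| * |N t ω - N s ω|)
      ≤ tf ζ ε (Z ω + A ω * (t - s) + B ω * (W t ω - W s ω) + D ω * (N t ω - N s ω)) := by
    intro ω
    have t1 := (abs_le.1 (tf_taylor ζ ε hε (Z ω) (B ω * (W t ω - W s ω)))).1
    have t2 := (abs_le.1 (tf_lip ζ ε hε
      (Z ω + A ω * (t - s) + B ω * (W t ω - W s ω) + D ω * (N t ω - N s ω))
      (Z ω + B ω * (W t ω - W s ω)))).1
    have t3 : |Z ω + A ω * (t - s) + B ω * (W t ω - W s ω) + D ω * (N t ω - N s ω)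
      - (Z ω + B ω * (W t ω - W s ω))| ≤ |A ω| * (t - s) + |D ω| * |N t ω - N s ω| := by
      rw [← abs_of_nonneg (sub_nonneg.2 h1), ← abs_mul, abs_of_nonneg (sub_nonneg.2 h1),
        ← abs_mul]
      refine le_trans (le_of_eq ?_) (abs_add_le _ _)
      congr 1; ring
    have t4 := mul_le_mul_of_nonneg_left t3 (by positivity : 0 ≤ 2 * ε)
    rw [abs_mul, mul_pow] at t1
    have t5 : |B ω| ^ 3 * |W t ω - W s ω| ^ 3 / ε = (1 / ε) * (|B ω| ^ 3 * |W t ω - W s ω| ^ 3) := by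
      ring
    rw [t5] at t1
    nlinarith
  have hIneq := int6_le i1 i2 i3 i4 i5 i6 atX.integrable hpt
  rw [e1, e2, e3] at hIneq
  have e5 := mul_le_mul_of_nonneg_left e4 (by positivity : 0 ≤ 2 * ε)
  have e6 : 2 / ε * (∫ ω, |B ω| ^ 3 ∂P) * c3 * ((t - s) * √(t - s))
     = 2 * (1 / ε * ((∫ ω, |B ω| ^ 3 ∂P) * (c3 * ((t - s) * √(t - s))))) := by ring
  rw [e6]
  nlinarith

/-- One cell of the Euler scheme started at time `a`. -/
noncomputable def cell {Ω : Type*} (Y A B D : Ω → ℝ) (W N : ℝ → Ω → ℝ) (a s : ℝ) (ω : Ω) : ℝ :=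
  Y ω + A ω * (s - a) + B ω * (W s ω - W a ω) + D ω * (N s ω - N a ω)

section cell
variable {Ω : Type*} {m0 : MeasurableSpace Ω} {F : Filtration ℝ m0} {P : Measure Ω}
    [IsProbabilityMeasure P] {T Λ c3 : ℝ} {W N : ℝ → Ω → ℝ}
    {a : ℝ} {Y A B D : Ω → ℝ}

lemma cell_meas (I : Inc F P T Λ c3 W N) (h0 : 0 ≤ a) 
    (mY : Measurable[F a] Y) (mA : Measurable[F a] A) (mB : Measurable[F a] B)
    (mD : Measurable[F a] D) {s : ℝ} (has : a ≤ s) (hs : s ≤ T) :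
    Measurable[F s] (cell Y A B D W N a s) := by
  have hle := F.mono has
  have mW1 := I.mW s ⟨h0.trans has, hs⟩
  have mN1 := I.mN s ⟨h0.trans has, hs⟩
  have mW0 := (I.mW a ⟨h0, has.trans hs⟩).mono hle le_rfl
  have mN0 := (I.mN a ⟨h0, has.trans hs⟩).mono hle le_rfl
  have mY' := mY.mono hle le_rfl
  have mA' := mA.mono hle le_rfl
  have mB' := mB.mono hle le_rfl
  have mD' := mD.mono hle le_rfl
  exact ((mY'.add (mA'.mul_const (s - a))).add (mB'.mul (mW1.sub mW0))).add
    (mD'.mul (mN1.sub mN0))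

lemma cell_al (I : Inc F P T Λ c3 W N) (h0 : 0 ≤ a) 
    (aY : AL P Y) (aA : AL P A) (aB : AL P B) (aD : AL P D)
    {s : ℝ} (has : a ≤ s) (hs : s ≤ T) :
    AL P (cell Y A B D W N a s) :=
  ((aY.add (aA.mul (AL.const _))).add (aB.mul (I.alW a s h0 has hs))).add
    (aD.mul (I.alN a s h0 has hs))

lemma cell_self (ω : Ω) : cell Y A B D W N a a ω = Y ω := by simp [cell]

/-- Riemann sum estimate -/
lemma riemann_le (I : Inc F P T Λ c3 W N) (h0 : 0 ≤ a) {δ : ℝ} (hδ : 0 < δ) (hT : a + δ ≤ T)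
    (mY : Measurable[F a] Y) (mA : Measurable[F a] A) (mB : Measurable[F a] B)
    (mD : Measurable[F a] D)
    (aY : AL P Y) (aA : AL P A) (aB : AL P B) (aD : AL P D)
    (ζ ε : ℝ) (hε : 0 < ε) (M : ℕ) (hM : 0 < M) :
    ∑ i ∈ Finset.range M, δ / M * ∫ ω, ph ζ ε (cell Y A B D W N a (a + i * (δ / M)) ω) * B ω ^ 2 ∂P
    ≤ 2 * (∫ ω, tf ζ ε (cell Y A B D W N a (a + δ) ω) ∂P - ∫ ω, tf ζ ε (Y ω) ∂P)
      + 4 * ε * (δ * (∫ ω, |A ω| ∂P + Λ * ∫ ω, |D ω| ∂P))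
      + 2 / ε * (∫ ω, |B ω| ^ 3 ∂P) * c3 * (δ * √(δ / M)) := by
  have hM' : (0:ℝ) < M := by exact_mod_cast hM
  set h := δ / M with hh
  have hpos : 0 < h := by positivity
  have hMh : M * h = δ := by rw [hh]; field_simp
  have step : ∀ i ∈ Finset.range M,
      h * ∫ ω, ph ζ ε (cell Y A B D W N a (a + i * h) ω) * B ω ^ 2 ∂P ≤
      2 * (∫ ω, tf ζ ε (cell Y A B D W N a (a + (i + 1 : ℕ) * h) ω) ∂P
        - ∫ ω, tf ζ ε (cell Y A B D W N a (a + i * h) ω) ∂P)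
      + (4 * ε * (h * (∫ ω, |A ω| ∂P + Λ * ∫ ω, |D ω| ∂P))
      + 2 / ε * (∫ ω, |B ω| ^ 3 ∂P) * c3 * (h * √h)) := by
    intro i hi
    have hi' : ((i:ℝ) + 1) ≤ M := by exact_mod_cast Finset.mem_range.1 hi
    have has : a ≤ a + i * h := by
      have : 0 ≤ (i:ℝ) * h := by positivity
      linarith
    have hst : a + i * h ≤ a + (i + 1 : ℕ) * h := by push_cast; nlinarith
    have htT : a + (i + 1 : ℕ) * h ≤ T := by
      have : ((i:ℝ) + 1) * h ≤ M * h := mul_le_mul_of_nonneg_right hi' hpos.le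
      push_cast; linarith
    have hle := F.mono has
    have := step_le I (h0.trans has) hst htT
      (cell_meas I h0 mY mA mB mD has (hst.trans htT))
      (mA.mono hle le_rfl) (mB.mono hle le_rfl) (mD.mono hle le_rfl)
      (cell_al I h0 aY aA aB aD has (hst.trans htT)) aA aB aD ζ ε hε
    have hd : a + (i + 1 : ℕ) * h - (a + i * h) = h := by push_cast; ring
    rw [hd] at this
    have hc : ∀ ω, cell Y A B D W N a (a + i * h) ω + A ω * h
        + B ω * (W (a + (i + 1 : ℕ) * h) ω - W (a + i * h) ω)
        + D ω * (N (a + (i + 1 : ℕ) * h) ω - N (a + i * h) ω)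
        = cell Y A B D W N a (a + (i + 1 : ℕ) * h) ω := by
      intro ω; simp only [cell]; push_cast; ring
    simp only [hc] at this
    linarith
  refine (Finset.sum_le_sum step).trans ?_
  rw [Finset.sum_add_distrib, ← Finset.mul_sum,
    Finset.sum_range_sub (fun i : ℕ => ∫ ω, tf ζ ε (cell Y A B D W N a (a + i * h) ω) ∂P) M]
  simp only [Nat.cast_zero, zero_mul, add_zero, cell_self, Finset.sum_const, Finset.card_range,
    nsmul_eq_mul, hMh]
  refine le_of_eq ?_
  rw [← hMh]; ring

end cell

lemma lint_floor_le (a h : ℝ) (hh : 0 < h) (u : ℕ → ENNReal) (M : ℕ) :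
    ∫⁻ s in Set.Ico a (a + M * h), u ⌊(s - a) / h⌋₊ ≤
      ∑ i ∈ Finset.range M, ENNReal.ofReal h * u i := by
  induction M with
  | zero => simp
  | succ M ih =>
    have hsub : Set.Ico a (a + (M + 1 : ℕ) * h) ⊆
        Set.Ico a (a + M * h) ∪ Set.Ico (a + M * h) (a + (M + 1 : ℕ) * h) := by
      intro s hs
      rcases lt_or_ge s (a + M * h) with h' | h'
      · exact Or.inl ⟨hs.1, h'⟩
      · exact Or.inr ⟨h', hs.2⟩
    refine (lintegral_mono_set hsub).trans ((lintegral_union_le _ _ _).trans ?_)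
    rw [Finset.sum_range_succ]
    refine add_le_add ih (le_of_eq ?_)
    rw [setLIntegral_congr_fun (g := fun _ => u M) measurableSet_Ico]
    · rw [setLIntegral_const, Real.volume_Ico, mul_comm]
      congr 2
      push_cast; ring
    · intro s hs
      have : ⌊(s - a) / h⌋₊ = M := by
        rw [Nat.floor_eq_iff (div_nonneg (by nlinarith [hs.1, (Nat.cast_nonneg M : (0:ℝ) ≤ M)]) hh.le)]
        rw [le_div_iff₀ hh, div_lt_iff₀ hh]
        have h2 := hs.2
        push_cast at h2
        constructor <;> linarith [hs.1]
      simp only [this]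

section cell
variable {Ω : Type*} {m0 : MeasurableSpace Ω} {F : Filtration ℝ m0} {P : Measure Ω}
    [IsProbabilityMeasure P] {T Λ c3 : ℝ} {W N : ℝ → Ω → ℝ}
    {a : ℝ} {Y A B D : Ω → ℝ}

lemma cell_tendsto (h0 : 0 ≤ a) {δ : ℝ} (hδ : 0 < δ) (hT : a + δ ≤ T) (ζ ε : ℝ) (ω : Ω)
    (hW : ContinuousOn (fun t => W t ω) (Set.Icc 0 T))
    (hN : ∀ s t : ℝ, 0 ≤ s → s ≤ t → t ≤ T → N s ω ≤ N t ω) :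
    ∀ᵐ s ∂(volume.restrict (Set.Ico a (a + δ))),
      Filter.Tendsto (fun M : ℕ => ENNReal.ofReal (ph ζ ε (cell Y A B D W N a
        (a + ⌊(s - a) / (δ / (M + 1 : ℕ))⌋₊ * (δ / (M + 1 : ℕ))) ω) * B ω ^ 2)) Filter.atTop
        (nhds (ENNReal.ofReal (ph ζ ε (cell Y A B D W N a s ω) * B ω ^ 2))) := by
  set N' : ℝ → ℝ := fun u => N (max 0 (min u T)) ω with hN'
  have hT0 : 0 ≤ T := by linarith
  have hmono : Monotone N' := by
    intro u v huv
    refine hN _ _ (le_max_left _ _) (max_le_max le_rfl (min_le_min huv le_rfl)) ?_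
    exact max_le hT0 (min_le_right _ _)
  have hae : ∀ᵐ s ∂(volume : Measure ℝ), ContinuousAt N' s := by
    have := hmono.countable_not_continuousAt.ae_notMem (volume : Measure ℝ)
    filter_upwards [this] with s hs
    simpa using hs
  filter_upwards [ae_restrict_of_ae hae, ae_restrict_mem measurableSet_Ico] with s hs hmem
  set sM : ℕ → ℝ := fun M => a + ⌊(s - a) / (δ / (M + 1 : ℕ))⌋₊ * (δ / (M + 1 : ℕ)) with hsM
  have hpos : ∀ M : ℕ, 0 < δ / (M + 1 : ℕ) := fun M => by positivity
  have hle : ∀ M, sM M ≤ s := by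
    intro M
    have := Nat.floor_le (div_nonneg (sub_nonneg.2 hmem.1) (hpos M).le)
    rw [le_div_iff₀ (hpos M)] at this
    simp only [hsM]; linarith
  have hge : ∀ M, a ≤ sM M := by
    intro M
    have : 0 ≤ (⌊(s - a) / (δ / (M + 1 : ℕ))⌋₊ : ℝ) * (δ / (M + 1 : ℕ)) :=
      mul_nonneg (Nat.cast_nonneg _) (hpos M).le
    simp only [hsM]; linarith
  have hge' : ∀ M, s - δ / (M + 1 : ℕ) ≤ sM M := by
    intro M
    have := Nat.lt_floor_add_one ((s - a) / (δ / (M + 1 : ℕ)))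
    rw [div_lt_iff₀ (hpos M)] at this
    simp only [hsM]; linarith
  have hmesh : Filter.Tendsto (fun M : ℕ => δ / ((M + 1 : ℕ) : ℝ)) Filter.atTop (nhds 0) :=
    (tendsto_const_div_atTop_nhds_zero_nat δ).comp (Filter.tendsto_add_atTop_nat 1)
  have hlim : Filter.Tendsto sM Filter.atTop (nhds s) := by
    refine tendsto_of_tendsto_of_tendsto_of_le_of_le
      (g := fun M : ℕ => s - δ / ((M + 1 : ℕ) : ℝ)) (h := fun _ => s) ?_ tendsto_const_nhds hge' hle
    simpa using tendsto_const_nhds.sub hmesh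
  have hs0 : s ∈ Set.Icc 0 T := ⟨h0.trans hmem.1, hmem.2.le.trans hT⟩
  have hsM0 : ∀ M, sM M ∈ Set.Icc 0 T := fun M => ⟨h0.trans (hge M), (hle M).trans hs0.2⟩
  have hWl : Filter.Tendsto (fun M => W (sM M) ω) Filter.atTop (nhds (W s ω)) :=
    (hW s hs0).tendsto.comp (tendsto_nhdsWithin_iff.2 ⟨hlim, Filter.Eventually.of_forall hsM0⟩)
  have hNe : ∀ u ∈ Set.Icc 0 T, N' u = N u ω := by
    intro u hu
    simp only [hN', min_eq_left hu.2, max_eq_right hu.1]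
  have hNl : Filter.Tendsto (fun M => N (sM M) ω) Filter.atTop (nhds (N s ω)) := by
    have := hs.tendsto.comp hlim
    rw [hNe s hs0] at this
    refine this.congr fun M => ?_
    simp only [Function.comp, hNe _ (hsM0 M)]
  refine ENNReal.tendsto_ofReal (Filter.Tendsto.mul_const _ ?_)
  refine ((ph_cont ζ ε).tendsto _).comp ?_
  unfold cell
  exact ((tendsto_const_nhds.add ((hlim.sub_const a).const_mul _)).add
    ((hWl.sub_const _).const_mul _)).add ((hNl.sub_const _).const_mul _)

lemma cell_lint (I : Inc F P T Λ c3 W N) (h0 : 0 ≤ a) {δ : ℝ} (hδ : 0 < δ) (hT : a + δ ≤ T)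
    (mY : Measurable[F a] Y) (mA : Measurable[F a] A) (mB : Measurable[F a] B)
    (mD : Measurable[F a] D)
    (aY : AL P Y) (aA : AL P A) (aB : AL P B) (aD : AL P D)
    (ζ ε : ℝ) (hε : 0 < ε) (R : ℝ)
    (hR : R = 2 * (∫ ω, tf ζ ε (cell Y A B D W N a (a + δ) ω) ∂P - ∫ ω, tf ζ ε (Y ω) ∂P)
      + 4 * ε * (δ * (∫ ω, |A ω| ∂P + Λ * ∫ ω, |D ω| ∂P))) :
    0 ≤ R ∧ ∃ L : Ω → ENNReal, Measurable L ∧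
      (∀ᵐ ω ∂P, ∫⁻ s in Set.Ico a (a + δ), 
        ENNReal.ofReal (ph ζ ε (cell Y A B D W N a s ω) * B ω ^ 2) ≤ L ω) ∧
      ∫⁻ ω, L ω ∂P ≤ ENNReal.ofReal R := by
  set hM : ℕ → ℝ := fun M => δ / (M + 1 : ℕ) with hhM
  have hpos : ∀ M : ℕ, 0 < hM M := fun M => by simp only [hhM]; positivity
  have hmesh : Filter.Tendsto hM Filter.atTop (nhds 0) :=
    (tendsto_const_div_atTop_nhds_zero_nat δ).comp (Filter.tendsto_add_atTop_nat 1)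
  have hMh : ∀ M : ℕ, (M + 1 : ℕ) * hM M = δ := fun M => by simp only [hhM]; field_simp
  set K : ℝ := 2 / ε * (∫ ω, |B ω| ^ 3 ∂P) * c3 with hK
  set g : ℝ → Ω → ℝ := fun s ω => ph ζ ε (cell Y A B D W N a s ω) * B ω ^ 2 with hg
  have hg0 : ∀ s ω, 0 ≤ g s ω := fun s ω => mul_nonneg (ph_nonneg _ _ _) (sq_nonneg _)
  have hlimR : Filter.Tendsto (fun M : ℕ => R + K * (δ * √(hM M))) Filter.atTop (nhds R) := by
    have : Filter.Tendsto (fun M : ℕ => √(hM M)) Filter.atTop (nhds 0) := by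
      have := (Real.continuous_sqrt.tendsto 0).comp hmesh
      rwa [Real.sqrt_zero] at this
    simpa using tendsto_const_nhds.add ((this.const_mul δ).const_mul K)
  have hriem : ∀ M : ℕ, ∑ i ∈ Finset.range (M + 1), hM M * ∫ ω, g (a + i * hM M) ω ∂P
      ≤ R + K * (δ * √(hM M)) := by
    intro M
    rw [hR, hK]
    exact riemann_le I h0 hδ hT mY mA mB mD aY aA aB aD ζ ε hε (M + 1) (Nat.succ_pos M)
  have hnn : ∀ M : ℕ, 0 ≤ ∑ i ∈ Finset.range (M + 1), hM M * ∫ ω, g (a + i * hM M) ω ∂P :=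
    fun M => Finset.sum_nonneg fun i _ => mul_nonneg (hpos M).le (integral_nonneg (hg0 _))
  have hpt : ∀ M : ℕ, ∀ i ∈ Finset.range (M + 1), a ≤ a + i * hM M ∧ a + i * hM M ≤ T := by
    intro M i hi
    have h1 : 0 ≤ (i:ℝ) * hM M := mul_nonneg (Nat.cast_nonneg _) (hpos M).le
    have hi' : (i:ℝ) ≤ (M + 1 : ℕ) := by exact_mod_cast (Finset.mem_range.1 hi).le
    have h2 := mul_le_mul_of_nonneg_right hi' (hpos M).le
    rw [hMh] at h2
    constructor <;> linarith
  have mB' : Measurable B := mB.mono (F.le a) le_rfl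
  have gm : ∀ s, a ≤ s → s ≤ T → Measurable (g s) := by
    intro s h1 h2
    exact ((ph_cont ζ ε).measurable.comp ((cell_meas I h0 mY mA mB mD h1 h2).mono (F.le s)
      le_rfl)).mul (mB'.pow_const 2)
  have gi : ∀ s, a ≤ s → s ≤ T → Integrable (g s) P := by
    intro s h1 h2
    refine (aB.pow 2).integrable.mono' (gm s h1 h2).aestronglyMeasurable ?_
    refine Filter.Eventually.of_forall fun ω => ?_
    rw [Real.norm_eq_abs, abs_of_nonneg (hg0 s ω)]
    exact mul_le_of_le_one_left (sq_nonneg _) (ph_le_one _ _ _)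
  set S : ℕ → Ω → ENNReal := fun M ω => ∑ i ∈ Finset.range (M + 1),
    ENNReal.ofReal (hM M) * ENNReal.ofReal (g (a + i * hM M) ω) with hS
  have mS : ∀ M, Measurable (S M) := by
    intro M
    refine Finset.measurable_fun_sum _ fun i hi => ?_
    exact ((gm _ (hpt M i hi).1 (hpt M i hi).2).ennreal_ofReal).const_mul _
  have iS : ∀ M, ∫⁻ ω, S M ω ∂P ≤ ENNReal.ofReal (R + K * (δ * √(hM M))) := by
    intro M
    refine le_trans (le_of_eq ?_) (ENNReal.ofReal_le_ofReal (hriem M))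
    simp only [hS]
    rw [lintegral_finset_sum', ENNReal.ofReal_sum_of_nonneg]
    · refine Finset.sum_congr rfl fun i hi => ?_
      rw [lintegral_const_mul' _ _ ENNReal.ofReal_ne_top, ENNReal.ofReal_mul (hpos M).le,
        ofReal_integral_eq_lintegral_ofReal (gi _ (hpt M i hi).1 (hpt M i hi).2)
          (Filter.Eventually.of_forall (hg0 _))]
    · intro i _; exact mul_nonneg (hpos M).le (integral_nonneg (hg0 _))
    · intro i hi
      exact (((gm _ (hpt M i hi).1 (hpt M i hi).2).ennreal_ofReal).const_mul _).aemeasurable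
  refine ⟨ge_of_tendsto' hlimR fun M => (hnn M).trans (hriem M),
    fun ω => Filter.liminf (fun M => S M ω) Filter.atTop, ?_, ?_, ?_⟩
  · exact Measurable.liminf mS
  · filter_upwards [I.cW, I.moN] with ω hW hN
    have ht := cell_tendsto (Y := Y) (A := A) (B := B) (D := D) h0 hδ hT ζ ε ω hW hN
    calc ∫⁻ s in Set.Ico a (a + δ), ENNReal.ofReal (g s ω)
        = ∫⁻ s in Set.Ico a (a + δ), Filter.liminf (fun M : ℕ =>
            ENNReal.ofReal (g (a + ⌊(s - a) / hM M⌋₊ * hM M) ω)) Filter.atTop := by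
          refine lintegral_congr_ae ?_
          filter_upwards [ht] with s hs
          exact hs.liminf_eq.symm
      _ ≤ Filter.liminf (fun M : ℕ => ∫⁻ s in Set.Ico a (a + δ),
            ENNReal.ofReal (g (a + ⌊(s - a) / hM M⌋₊ * hM M) ω)) Filter.atTop := by
          refine lintegral_liminf_le fun M => ?_
          have : Measurable (fun n : ℕ => ENNReal.ofReal (g (a + n * hM M) ω)) :=
            measurable_of_countable _
          exact this.comp (Nat.measurable_floor.comp (by fun_prop))
      _ ≤ _ := by
          refine Filter.liminf_le_liminf (Filter.Eventually.of_forall fun M => ?_)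
          have := lint_floor_le a (hM M) (hpos M)
            (fun n : ℕ => ENNReal.ofReal (g (a + n * hM M) ω)) (M + 1)
          rw [hMh M] at this
          exact this
  · refine (lintegral_liminf_le mS).trans ?_
    rw [← (ENNReal.tendsto_ofReal hlimR).liminf_eq]
    exact Filter.liminf_le_liminf (Filter.Eventually.of_forall iS)

end cell

section grid
variable {Ω : Type*} {m0 : MeasurableSpace Ω} {F : Filtration ℝ m0} {P : Measure Ω}
    [IsProbabilityMeasure P] {T Λ c3 : ℝ} {W N : ℝ → Ω → ℝ}
    {a : ℝ} {Y A B D : Ω → ℝ}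

lemma sq_growth {K y g : ℝ} (h : |g| ≤ K * (1 + |y|)) : g ^ 2 ≤ 2 * K ^ 2 * (1 + y ^ 2) := by
  have h1 : g ^ 2 ≤ (K * (1 + |y|)) ^ 2 := by
    rw [← sq_abs g]
    exact pow_le_pow_left₀ (abs_nonneg _) h 2
  have h2 : (1 + |y|) ^ 2 ≤ 2 * (1 + y ^ 2) := by
    rw [← sq_abs y]; nlinarith [sq_nonneg (1 - |y|)]
  nlinarith [mul_le_mul_of_nonneg_left h2 (sq_nonneg K)]

lemma sq_pt {K δ y A B D w n : ℝ} (hδ : 0 < δ) (hδ1 : δ < 1)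
    (hA : |A| ≤ K * (1 + |y|)) (hB : |B| ≤ K * (1 + |y|)) (hD : |D| ≤ K * (1 + |y|)) :
    1 + (y + A * δ + B * w + D * n) ^ 2 ≤ (1 + (1 + 8 * K ^ 2) * δ) * (1 + y ^ 2)
      + 2 * (y * B * w) + 6 * K ^ 2 * ((1 + y ^ 2) * w ^ 2)
      + (1 + 2 * K ^ 2) * ((1 + y ^ 2) * |n|) + 6 * K ^ 2 * ((1 + y ^ 2) * n ^ 2) := by
  have gA := sq_growth hA
  have gB := sq_growth hB
  have gD := sq_growth hD
  have e1 : (y + A * δ + B * w + D * n) ^ 2 ≤ y ^ 2 + 2 * y * (A * δ) + 2 * (y * B * w)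
      + 2 * y * (D * n) + 3 * (A * δ) ^ 2 + 3 * (B * w) ^ 2 + 3 * (D * n) ^ 2 := by
    nlinarith [sq_nonneg (A * δ - B * w), sq_nonneg (A * δ - D * n), sq_nonneg (B * w - D * n)]
  have e2 : 2 * y * (A * δ) ≤ (y ^ 2 + A ^ 2) * δ := by
    nlinarith [mul_nonneg hδ.le (sq_nonneg (y - A))]
  have e3 : (A * δ) ^ 2 ≤ A ^ 2 * δ := by
    have : δ ^ 2 ≤ δ := by nlinarith
    nlinarith [mul_le_mul_of_nonneg_left this (sq_nonneg A)]
  have e4 : 2 * y * (D * n) ≤ (y ^ 2 + D ^ 2) * |n| := by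
    have h1 : 2 * y * (D * n) ≤ |2 * y * D| * |n| := by
      rw [← abs_mul]; exact (le_abs_self _).trans_eq (by ring_nf)
    have h2 : |2 * y * D| ≤ y ^ 2 + D ^ 2 := by
      rw [abs_le]; constructor <;> nlinarith [sq_nonneg (y - D), sq_nonneg (y + D)]
    exact h1.trans (mul_le_mul_of_nonneg_right h2 (abs_nonneg _))
  have f1 := mul_le_mul_of_nonneg_right gA hδ.le
  have f2 := mul_le_mul_of_nonneg_right gB (sq_nonneg w)
  have f3 := mul_le_mul_of_nonneg_right gD (sq_nonneg n)
  have f4 := mul_le_mul_of_nonneg_right gD (abs_nonneg n)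
  have f5 := abs_nonneg n
  have f6 : y ^ 2 * |n| ≤ (1 + y ^ 2) * |n| := by nlinarith
  have f7 : y ^ 2 * δ ≤ (1 + y ^ 2) * δ := by nlinarith
  nlinarith

lemma sq_step (I : Inc F P T Λ c3 W N) (h0 : 0 ≤ a) {δ K : ℝ} (hδ : 0 < δ) (hδ1 : δ < 1)
    (hT : a + δ ≤ T)
    (mY : Measurable[F a] Y) (mB : Measurable[F a] B)
    (aY : AL P Y) (aA : AL P A) (aB : AL P B) (aD : AL P D)
    (hA : ∀ ω, |A ω| ≤ K * (1 + |Y ω|)) (hB : ∀ ω, |B ω| ≤ K * (1 + |Y ω|))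
    (hD : ∀ ω, |D ω| ≤ K * (1 + |Y ω|)) :
    ∫ ω, (1 + cell Y A B D W N a (a + δ) ω ^ 2) ∂P
      ≤ (1 + (1 + 14 * K ^ 2 + (1 + 8 * K ^ 2) * Λ) * δ) * ∫ ω, (1 + Y ω ^ 2) ∂P := by
  have hle : a ≤ a + δ := by linarith
  have aX := cell_al I h0 aY aA aB aD hle hT
  have aW := I.alW a (a + δ) h0 hle hT
  have aN := I.alN a (a + δ) h0 hle hT
  have aV : AL P (fun ω => 1 + Y ω ^ 2) := (AL.const 1).add (aY.pow 2)
  have mV : Measurable[F a] (fun ω => 1 + Y ω ^ 2) := by fun_prop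
  have mYB : Measurable[F a] (fun ω => Y ω * B ω) := by fun_prop
  have e1 : ∫ ω, Y ω * B ω * (W (a + δ) ω - W a ω) ∂P = 0 := by
    rw [int_prod (I.indW _ _ h0 hle hT _ mYB) (aY.mul aB) aW, I.meanW _ _ h0 hle hT, mul_zero]
  have e2 : ∫ ω, (1 + Y ω ^ 2) * (W (a + δ) ω - W a ω) ^ 2 ∂P
      = (∫ ω, (1 + Y ω ^ 2) ∂P) * δ := by
    rw [int_prod (Z := fun ω => 1 + Y ω ^ 2) (Y := fun ω => (W (a + δ) ω - W a ω) ^ 2)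
      ((I.indW _ _ h0 hle hT _ mV).comp (φ := id) (ψ := fun x => x ^ 2) measurable_id
        (by fun_prop)) aV (aW.pow 2), I.sqW _ _ h0 hle hT]
    ring
  have hV0 : 0 ≤ ∫ ω, (1 + Y ω ^ 2) ∂P := integral_nonneg fun ω => by positivity
  have e3 : ∫ ω, (1 + Y ω ^ 2) * |N (a + δ) ω - N a ω| ∂P
      ≤ (∫ ω, (1 + Y ω ^ 2) ∂P) * (Λ * δ) := by
    rw [int_prod (Z := fun ω => 1 + Y ω ^ 2) (Y := fun ω => |N (a + δ) ω - N a ω|)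
      ((I.indN _ _ h0 hle hT _ mV).comp (φ := id) (ψ := fun x => |x|) measurable_id
        (by fun_prop)) aV aN.abs]
    refine mul_le_mul_of_nonneg_left ?_ hV0
    have := I.meanN _ _ h0 hle hT
    rwa [add_sub_cancel_left] at this
  have e4 : ∫ ω, (1 + Y ω ^ 2) * (N (a + δ) ω - N a ω) ^ 2 ∂P
      ≤ (∫ ω, (1 + Y ω ^ 2) ∂P) * (Λ * δ) := by
    rw [int_prod (Z := fun ω => 1 + Y ω ^ 2) (Y := fun ω => (N (a + δ) ω - N a ω) ^ 2)
      ((I.indN _ _ h0 hle hT _ mV).comp (φ := id) (ψ := fun x => x ^ 2) measurable_id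
        (by fun_prop)) aV (aN.pow 2)]
    refine mul_le_mul_of_nonneg_left ?_ hV0
    have := I.sqN _ _ h0 hle hT
    rwa [add_sub_cancel_left] at this
  have i1 := (aV.integrable).const_mul (1 + (1 + 8 * K ^ 2) * δ)
  have i2 := (((aY.mul aB).mul aW).integrable).const_mul 2
  have i3 := ((aV.mul (aW.pow 2)).integrable).const_mul (6 * K ^ 2)
  have i4 := ((aV.mul aN.abs).integrable).const_mul (1 + 2 * K ^ 2)
  have i5 := ((aV.mul (aN.pow 2)).integrable).const_mul (6 * K ^ 2)
  have key : ∫ ω, (1 + cell Y A B D W N a (a + δ) ω ^ 2) ∂P ≤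
      ∫ ω, ((1 + (1 + 8 * K ^ 2) * δ) * (1 + Y ω ^ 2)
      + 2 * (Y ω * B ω * (W (a + δ) ω - W a ω))
      + 6 * K ^ 2 * ((1 + Y ω ^ 2) * (W (a + δ) ω - W a ω) ^ 2)
      + (1 + 2 * K ^ 2) * ((1 + Y ω ^ 2) * |N (a + δ) ω - N a ω|)
      + 6 * K ^ 2 * ((1 + Y ω ^ 2) * (N (a + δ) ω - N a ω) ^ 2)) ∂P := by
    refine integral_mono ((AL.const 1).add (aX.pow 2)).integrable
      ((((i1.fun_add i2).fun_add i3).fun_add i4).fun_add i5) fun ω => ?_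
    have := sq_pt (w := W (a + δ) ω - W a ω) (n := N (a + δ) ω - N a ω) hδ hδ1
      (hA ω) (hB ω) (hD ω)
    simpa [cell] using this
  refine key.trans ?_
  rw [integral_add (((i1.fun_add i2).fun_add i3).fun_add i4) i5, integral_add ((i1.fun_add i2).fun_add i3) i4,
    integral_add (i1.fun_add i2) i3, integral_add i1 i2, integral_const_mul, integral_const_mul,
    integral_const_mul, integral_const_mul, integral_const_mul, e1, e2]
  have g3 := mul_le_mul_of_nonneg_left e3 (show 0 ≤ 1 + 2 * K ^ 2 by positivity)
  have g4 := mul_le_mul_of_nonneg_left e4 (show 0 ≤ 6 * K ^ 2 by positivity)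
  linarith

variable {μ σ ρ : ℝ → ℝ}

lemma grid_succ {δ x : ℝ} (j : ℕ) :
    emGrid μ σ ρ W N δ x (j + 1) = cell (emGrid μ σ ρ W N δ x j)
      (fun ω => μ (emGrid μ σ ρ W N δ x j ω)) (fun ω => σ (emGrid μ σ ρ W N δ x j ω))
      (fun ω => ρ (emGrid μ σ ρ W N δ x j ω)) W N (j * δ) (j * δ + δ) := by
  funext ω
  have : ((j:ℝ) + 1) * δ = j * δ + δ := by ring
  simp only [emGrid, cell, this, add_sub_cancel_left]

lemma grid_reg (I : Inc F P T Λ c3 W N) {δ x K : ℝ} (hδ : 0 < δ)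
    (mμ : Measurable μ) (mσ : Measurable σ) (mρ : Measurable ρ)
    (gμ : ∀ y, |μ y| ≤ K * (1 + |y|)) (gσ : ∀ y, |σ y| ≤ K * (1 + |y|))
    (gρ : ∀ y, |ρ y| ≤ K * (1 + |y|)) (j : ℕ) (hj : j * δ ≤ T) :
    Measurable[F (j * δ)] (emGrid μ σ ρ W N δ x j) ∧ AL P (emGrid μ σ ρ W N δ x j) := by
  induction j with
  | zero =>
    have : emGrid μ σ ρ W N δ x 0 = fun _ => x := by funext ω; simp [emGrid]
    rw [this]
    exact ⟨measurable_const, AL.const x⟩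
  | succ j ih =>
    have e : ((j + 1 : ℕ) : ℝ) * δ = j * δ + δ := by push_cast; ring
    rw [e] at hj ⊢
    obtain ⟨mY, aY⟩ := ih (by linarith)
    have mY' := mY.mono (F.le _) le_rfl
    have h0 : (0:ℝ) ≤ j * δ := by positivity
    rw [grid_succ]
    exact ⟨cell_meas I h0 mY (mμ.comp mY) (mσ.comp mY) (mρ.comp mY) (by linarith) hj,
      cell_al I h0 aY (aY.comp_growth mY' mμ gμ) (aY.comp_growth mY' mσ gσ)
        (aY.comp_growth mY' mρ gρ) (by linarith) hj⟩

lemma grid_sq (I : Inc F P T Λ c3 W N) {δ x K : ℝ} (hδ : 0 < δ) (hδ1 : δ < 1)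
    (mμ : Measurable μ) (mσ : Measurable σ) (mρ : Measurable ρ)
    (gμ : ∀ y, |μ y| ≤ K * (1 + |y|)) (gσ : ∀ y, |σ y| ≤ K * (1 + |y|))
    (gρ : ∀ y, |ρ y| ≤ K * (1 + |y|)) (j : ℕ) (hj : j * δ ≤ T) :
    ∫ ω, (1 + emGrid μ σ ρ W N δ x j ω ^ 2) ∂P
      ≤ Real.exp ((1 + 14 * K ^ 2 + (1 + 8 * K ^ 2) * Λ) * (j * δ)) * (1 + x ^ 2) := by
  have hΛ := I.Λ0
  set K' := 1 + 14 * K ^ 2 + (1 + 8 * K ^ 2) * Λ with hK'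
  have hK0 : 0 ≤ K' := by positivity
  induction j with
  | zero => simp [emGrid]
  | succ j ih =>
    have e : ((j + 1 : ℕ) : ℝ) * δ = j * δ + δ := by push_cast; ring
    rw [e] at hj ⊢
    obtain ⟨mY, aY⟩ := grid_reg (x := x) I hδ mμ mσ mρ gμ gσ gρ j (by linarith)
    have mY' := mY.mono (F.le _) le_rfl
    have h0 : (0:ℝ) ≤ j * δ := by positivity
    have st := sq_step I h0 hδ hδ1 hj mY (mσ.comp mY) aY (aY.comp_growth mY' mμ gμ)
      (aY.comp_growth mY' mσ gσ) (aY.comp_growth mY' mρ gρ) (fun ω => gμ _) (fun ω => gσ _)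
      (fun ω => gρ _)
    rw [grid_succ]
    refine st.trans ?_
    have h1 : 1 + K' * δ ≤ Real.exp (K' * δ) := by
      have := Real.add_one_le_exp (K' * δ); linarith
    have h2 := ih (by linarith)
    calc _ ≤ Real.exp (K' * δ) * (Real.exp (K' * (j * δ)) * (1 + x ^ 2)) := by
          refine mul_le_mul h1 h2 (integral_nonneg fun ω => by positivity) (Real.exp_pos _).le
      _ = _ := by rw [← mul_assoc, ← Real.exp_add]; ring_nf

lemma grid_abs (I : Inc F P T Λ c3 W N) {δ x K : ℝ} (hδ : 0 < δ) (hδ1 : δ < 1)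
    (mμ : Measurable μ) (mσ : Measurable σ) (mρ : Measurable ρ)
    (gμ : ∀ y, |μ y| ≤ K * (1 + |y|)) (gσ : ∀ y, |σ y| ≤ K * (1 + |y|))
    (gρ : ∀ y, |ρ y| ≤ K * (1 + |y|)) (j : ℕ) (hj : j * δ ≤ T) :
    ∫ ω, |emGrid μ σ ρ W N δ x j ω| ∂P
      ≤ (Real.exp ((1 + 14 * K ^ 2 + (1 + 8 * K ^ 2) * Λ) * T) + 1) * (1 + |x|) := by
  have hΛ := I.Λ0
  obtain ⟨mY, aY⟩ := grid_reg (x := x) I hδ mμ mσ mρ gμ gσ gρ j hj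
  have hs := grid_sq (x := x) I hδ hδ1 mμ mσ mρ gμ gσ gρ j hj
  set K' := 1 + 14 * K ^ 2 + (1 + 8 * K ^ 2) * Λ with hK'
  have hK0 : 0 ≤ K' := by positivity
  have h1 : Real.exp (K' * (j * δ)) ≤ Real.exp (K' * T) :=
    Real.exp_le_exp.2 (mul_le_mul_of_nonneg_left hj hK0)
  set q := 1 + |x| with hq
  have hx := abs_nonneg x
  have hq0 : 0 < q := by positivity
  have hx2 : 1 + x ^ 2 ≤ q * q := by rw [hq, ← sq_abs x]; nlinarith
  have aV : AL P (fun ω => 1 + emGrid μ σ ρ W N δ x j ω ^ 2) := (AL.const 1).add (aY.pow 2)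
  have h2 : ∫ ω, |emGrid μ σ ρ W N δ x j ω| ∂P
      ≤ ∫ ω, ((1 / q) * (1 + emGrid μ σ ρ W N δ x j ω ^ 2) + q) ∂P := by
    refine integral_mono aY.abs.integrable ((aV.integrable.const_mul _).add
      (integrable_const q)) fun ω => ?_
    simp only
    generalize emGrid μ σ ρ W N δ x j ω = y
    rw [← sq_abs y]
    have : |y| * q ≤ 1 + |y| ^ 2 + q * q := by nlinarith [sq_nonneg (|y| - q), sq_nonneg (|y| + q)]
    calc |y| ≤ (1 + |y| ^ 2 + q * q) / q := (le_div_iff₀ hq0).2 this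
      _ = _ := by field_simp
  rw [integral_add (aV.integrable.const_mul _) (integrable_const q), integral_const_mul] at h2
  simp only [integral_const, probReal_univ, one_smul] at h2
  have h3 : ∫ ω, (1 + emGrid μ σ ρ W N δ x j ω ^ 2) ∂P ≤ Real.exp (K' * T) * (q * q) :=
    hs.trans (mul_le_mul h1 hx2 (by positivity) (Real.exp_pos _).le)
  have h4 := mul_le_mul_of_nonneg_left h3 (show 0 ≤ 1 / q by positivity)
  have h5 : 1 / q * (Real.exp (K' * T) * (q * q)) = Real.exp (K' * T) * q := by field_simp
  linarith

end grid

section final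
variable {Ω : Type*} {m0 : MeasurableSpace Ω} {F : Filtration ℝ m0} {P : Measure Ω}
    [IsProbabilityMeasure P] {T Λ c3 : ℝ} {W N : ℝ → Ω → ℝ} {μ σ ρ : ℝ → ℝ}

lemma floor_cell {δ s : ℝ} (hδ : 0 < δ) (j : ℕ) (hs : s ∈ Set.Ico (j * δ) (j * δ + δ)) :
    ⌊s / δ⌋.toNat = j := by
  have : ⌊s / δ⌋ = (j : ℤ) := by
    rw [Int.floor_eq_iff]
    constructor
    · rw [le_div_iff₀ hδ]; exact_mod_cast hs.1
    · rw [div_lt_iff₀ hδ]; have := hs.2; push_cast; linarith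
  rw [this]; simp

lemma proc_cell {δ s x : ℝ} (hδ : 0 < δ) (j : ℕ) (hs : s ∈ Set.Ico (j * δ) (j * δ + δ)) (ω : Ω) :
    emProc μ σ ρ W N δ x s ω = cell (emGrid μ σ ρ W N δ x j)
      (fun ω => μ (emGrid μ σ ρ W N δ x j ω)) (fun ω => σ (emGrid μ σ ρ W N δ x j ω))
      (fun ω => ρ (emGrid μ σ ρ W N δ x j ω)) W N (j * δ) s ω := by
  simp only [emProc, cell, lastGrid, floor_cell hδ j hs]

lemma proc_last {δ s x : ℝ} (hδ : 0 < δ) (j : ℕ) (hs : s ∈ Set.Ico (j * δ) (j * δ + δ)) (ω : Ω) :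
    emProc μ σ ρ W N δ x (lastGrid δ s) ω = emGrid μ σ ρ W N δ x j ω := by
  have : lastGrid δ s = j * δ := by simp only [lastGrid, floor_cell hδ j hs]
  rw [this, proc_cell hδ j ⟨le_rfl, by linarith⟩, cell_self]

lemma lint_cells {δ : ℝ} (hδ : 0 < δ) (f : ℝ → ENNReal) (n : ℕ) :
    ∫⁻ s in Set.Ico 0 (n * δ), f s
      ≤ ∑ j ∈ Finset.range n, ∫⁻ s in Set.Ico (j * δ) (j * δ + δ), f s := by
  induction n with
  | zero => simp
  | succ n ih =>
    rw [Finset.sum_range_succ]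
    have e : Set.Ico (0:ℝ) ((n + 1 : ℕ) * δ)
        = Set.Ico (0:ℝ) (n * δ) ∪ Set.Ico (n * δ) (n * δ + δ) := by
      rw [Set.Ico_union_Ico_eq_Ico (by positivity) (by linarith)]
      congr 1; push_cast; ring
    rw [e]
    exact (lintegral_union_le _ _ _).trans (add_le_add ih le_rfl)

lemma main_est (I : Inc F P T Λ c3 W N) {δ x K : ℝ} (hδ : 0 < δ) (hδ1 : δ < 1) (hK : 0 ≤ K)
    (n : ℕ) (hn : n * δ = T)
    (mμ : Measurable μ) (mσ : Measurable σ) (mρ : Measurable ρ)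
    (gμ : ∀ y, |μ y| ≤ K * (1 + |y|)) (gσ : ∀ y, |σ y| ≤ K * (1 + |y|))
    (gρ : ∀ y, |ρ y| ≤ K * (1 + |y|)) (ζ ε : ℝ) (hε : 0 < ε) (G : ℝ)
    (hG : G = Real.exp ((1 + 14 * K ^ 2 + (1 + 8 * K ^ 2) * Λ) * T) + 1) :
    ∫⁻ ω, (∫⁻ s in Set.Ico (0:ℝ) T, ENNReal.ofReal
          ((if emProc μ σ ρ W N δ x s ω ∈ Set.Icc (ζ - ε) (ζ + ε) then (1:ℝ) else 0)
            * σ (emProc μ σ ρ W N δ x (lastGrid δ s) ω) ^ 2)) ∂P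
        ≤ ENNReal.ofReal ((8 * (G + 1) + 8 * T * K * (1 + Λ) * (1 + G)) * (1 + |x|) * ε) := by
  have hΛ := I.Λ0
  have hG0 : 0 ≤ G := by rw [hG]; positivity
  have hjT : ∀ j, j ≤ n → (j:ℝ) * δ ≤ T := fun j hj => by
    rw [← hn]; exact mul_le_mul_of_nonneg_right (by exact_mod_cast hj) hδ.le
  have hT0 : 0 ≤ T := by rw [← hn]; positivity
  have hreg := fun j hj => grid_reg (x := x) I hδ mμ mσ mρ gμ gσ gρ j (hjT j hj)
  have habs := fun j hj => grid_abs (x := x) I hδ hδ1 mμ mσ mρ gμ gσ gρ j (hjT j hj)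
  rw [← hG] at habs
  set Y := emGrid μ σ ρ W N δ x with hY
  set R : ℕ → ℝ := fun j => 2 * (∫ ω, tf ζ ε (Y (j + 1) ω) ∂P - ∫ ω, tf ζ ε (Y j ω) ∂P)
      + 4 * ε * (δ * (∫ ω, |μ (Y j ω)| ∂P + Λ * ∫ ω, |ρ (Y j ω)| ∂P)) with hR
  have hcell : ∀ j, j < n → 0 ≤ R j ∧ ∃ L : Ω → ENNReal, Measurable L ∧
      (∀ᵐ ω ∂P, ∫⁻ s in Set.Ico (j * δ) (j * δ + δ), ENNReal.ofReal
          ((if emProc μ σ ρ W N δ x s ω ∈ Set.Icc (ζ - ε) (ζ + ε) then (1:ℝ) else 0)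
            * σ (emProc μ σ ρ W N δ x (lastGrid δ s) ω) ^ 2) ≤ 2 * L ω) ∧
      ∫⁻ ω, L ω ∂P ≤ ENNReal.ofReal (R j) := by
    intro j hj
    obtain ⟨mY, aY⟩ := hreg j hj.le
    have mY' := mY.mono (F.le _) le_rfl
    have hj1 : (j:ℝ) * δ + δ ≤ T := by
      have := hjT (j + 1) hj
      push_cast at this; linarith
    obtain ⟨h1, L, mL, hL, hLi⟩ := cell_lint I (by positivity) hδ hj1 mY (mμ.comp mY)
      (mσ.comp mY) (mρ.comp mY) aY (aY.comp_growth mY' mμ gμ) (aY.comp_growth mY' mσ gσ)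
      (aY.comp_growth mY' mρ gρ) ζ ε hε (R j) (by simp only [hR, hY, grid_succ]; rfl)
    refine ⟨h1, L, mL, ?_, hLi⟩
    filter_upwards [hL] with ω hω
    refine le_trans ?_ (mul_le_mul_right hω 2)
    rw [← lintegral_const_mul' _ _ (by simp)]
    refine setLIntegral_mono' measurableSet_Ico fun s hs => ?_
    rw [proc_last hδ j hs, proc_cell hδ j hs, ← ENNReal.ofReal_ofNat 2,
      ← ENNReal.ofReal_mul (by norm_num), ← mul_assoc]
    exact ENNReal.ofReal_le_ofReal (mul_le_mul_of_nonneg_right (ind_le_ph ζ ε hε _) (sq_nonneg _))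
  choose! hR0 L mL hL hLi using hcell
  have hae : ∀ᵐ ω ∂P, ∀ j ∈ Finset.range n, 
      ∫⁻ s in Set.Ico (j * δ) (j * δ + δ), ENNReal.ofReal
          ((if emProc μ σ ρ W N δ x s ω ∈ Set.Icc (ζ - ε) (ζ + ε) then (1:ℝ) else 0)
            * σ (emProc μ σ ρ W N δ x (lastGrid δ s) ω) ^ 2) ≤ 2 * L j ω := by
    rw [Filter.eventually_all_finset]
    exact fun j hj => hL j (Finset.mem_range.1 hj)
  have step1 : ∫⁻ ω, (∫⁻ s in Set.Ico (0:ℝ) T, ENNReal.ofReal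
          ((if emProc μ σ ρ W N δ x s ω ∈ Set.Icc (ζ - ε) (ζ + ε) then (1:ℝ) else 0)
            * σ (emProc μ σ ρ W N δ x (lastGrid δ s) ω) ^ 2)) ∂P
      ≤ ∫⁻ ω, ∑ j ∈ Finset.range n, 2 * L j ω ∂P := by
    refine lintegral_mono_ae ?_
    filter_upwards [hae] with ω hω
    rw [← hn]
    exact (lint_cells hδ _ n).trans (Finset.sum_le_sum hω)
  have step2 : ∫⁻ ω, ∑ j ∈ Finset.range n, 2 * L j ω ∂P
      ≤ ENNReal.ofReal (2 * ∑ j ∈ Finset.range n, R j) := by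
    rw [lintegral_finsetSum' _ fun j hj =>
      ((mL j (Finset.mem_range.1 hj)).const_mul 2).aemeasurable, Finset.mul_sum,
      ENNReal.ofReal_sum_of_nonneg fun j hj => 
        mul_nonneg (by norm_num) (hR0 j (Finset.mem_range.1 hj))]
    refine Finset.sum_le_sum fun j hj => ?_
    rw [lintegral_const_mul' _ _ (by simp), ENNReal.ofReal_mul (by norm_num), ENNReal.ofReal_ofNat]
    exact mul_le_mul_right (hLi j (Finset.mem_range.1 hj)) 2
  refine (step1.trans step2).trans (ENNReal.ofReal_le_ofReal ?_)
  have hx := abs_nonneg x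
  -- the telescoping sum
  have htel : ∫ ω, tf ζ ε (Y n ω) ∂P - ∫ ω, tf ζ ε (Y 0 ω) ∂P
      ≤ 2 * ε * ((G + 1) * (1 + |x|)) := by
    obtain ⟨mY, aY⟩ := hreg n le_rfl
    have mY' := mY.mono (F.le _) le_rfl
    have atf := aY.comp_growth mY' (tf_cont ζ ε).measurable (tf_growth ζ ε hε)
    have e0 : ∫ ω, tf ζ ε (Y 0 ω) ∂P = tf ζ ε x := by simp [hY, emGrid]
    have h1 : ∫ ω, tf ζ ε (Y n ω) ∂P ≤ ∫ ω, (2 * ε * |Y n ω| + (2 * ε * |x| + tf ζ ε x)) ∂P := by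
      refine integral_mono atf.integrable ((aY.abs.integrable.const_mul _).add
        (integrable_const _)) fun ω => ?_
      have h2 := (le_abs_self _).trans (tf_lip ζ ε hε (Y n ω) x)
      have h3 := mul_le_mul_of_nonneg_left (abs_sub (Y n ω) x) (show 0 ≤ 2 * ε by positivity)
      simp only
      linarith
    rw [integral_add (aY.abs.integrable.const_mul _) (integrable_const _),
      integral_const_mul] at h1
    simp only [integral_const, probReal_univ, one_smul] at h1
    have h4 := mul_le_mul_of_nonneg_left (habs n le_rfl) (show 0 ≤ 2 * ε by positivity)
    rw [e0]
    nlinarith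
  have hgr : ∀ (g : ℝ → ℝ), Measurable g → (∀ y, |g y| ≤ K * (1 + |y|)) → ∀ j ≤ n,
      ∫ ω, |g (Y j ω)| ∂P ≤ K * ((1 + G) * (1 + |x|)) := by
    intro g mg hg j hj
    obtain ⟨mY, aY⟩ := hreg j hj
    have mY' := mY.mono (F.le _) le_rfl
    have h1 : ∫ ω, |g (Y j ω)| ∂P ≤ ∫ ω, K * (1 + |Y j ω|) ∂P :=
      integral_mono (aY.comp_growth mY' mg hg).abs.integrable
        (((AL.const 1).add aY.abs).integrable.const_mul _) fun ω => hg _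
    rw [integral_const_mul, integral_add (integrable_const _) aY.abs.integrable] at h1
    simp only [integral_const, probReal_univ, one_smul] at h1
    refine h1.trans (mul_le_mul_of_nonneg_left ?_ hK)
    have := habs j hj
    linarith
  have hsum : ∑ j ∈ Finset.range n, R j
      ≤ 2 * (2 * ε * ((G + 1) * (1 + |x|)))
        + n * (4 * ε * (δ * (K * ((1 + G) * (1 + |x|)) + Λ * (K * ((1 + G) * (1 + |x|)))))) := by
    simp only [hR]
    rw [Finset.sum_add_distrib, ← Finset.mul_sum,
      Finset.sum_range_sub (fun j => ∫ ω, tf ζ ε (Y j ω) ∂P)]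
    refine add_le_add (mul_le_mul_of_nonneg_left htel (by norm_num)) ?_
    rw [← nsmul_eq_mul]
    refine (Finset.sum_le_card_nsmul _ _ _ fun j hj => ?_).trans_eq (by rw [Finset.card_range])
    have hj' := (Finset.mem_range.1 hj).le
    have h1 := hgr μ mμ gμ j hj'
    have h2 := hgr ρ mρ gρ j hj'
    gcongr
  have e : (n:ℝ) * (4 * ε * (δ * (K * ((1 + G) * (1 + |x|)) + Λ * (K * ((1 + G) * (1 + |x|))))))
      = T * (4 * ε * ((K * ((1 + G) * (1 + |x|)) + Λ * (K * ((1 + G) * (1 + |x|)))))) := by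
    rw [← hn]; ring
  rw [e] at hsum
  linarith

end final

end EMLT

/-- Local time type estimate for the Euler–Maruyama process:
`E[∫_0^t 1_{[ζ_k - ε, ζ_k + ε]}(X^{(δ),x}_s) σ(X^{(δ),x}_{s̲})² ds] ≤ C (1 + |x|) ε`. -/
theorem em_local_time_estimate
    {Ω : Type*} {m0 : MeasurableSpace Ω}
    (F : Filtration ℝ m0) (P : Measure Ω) [IsProbabilityMeasure P]
    (T : ℝ) (hT : 0 < T)
    (lam : ℝ → ℝ) (hlam_meas : Measurable lam)
    (hlam_pos : ∀ t ∈ Set.Icc (0:ℝ) T, 0 < lam t)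
    (lamB : ℝ) (hlamB : ∀ t ∈ Set.Icc (0:ℝ) T, lam t ≤ lamB)
    (W N : ℝ → Ω → ℝ)
    (hW0 : ∀ ω, W 0 ω = 0) (hN0 : ∀ ω, N 0 ω = 0)
    (hW_adapted : ∀ t ∈ Set.Icc (0:ℝ) T, Measurable[F t] (W t))
    (hN_adapted : ∀ t ∈ Set.Icc (0:ℝ) T, Measurable[F t] (N t))
    (hW_cont : ∀ᵐ ω ∂P, ContinuousOn (fun t => W t ω) (Set.Icc 0 T))
    (hN_mono : ∀ᵐ ω ∂P, ∀ s t : ℝ, 0 ≤ s → s ≤ t → t ≤ T → N s ω ≤ N t ω)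
    (hN_rc : ∀ᵐ ω ∂P, ∀ t ∈ Set.Ico (0:ℝ) T,
      Filter.Tendsto (fun u => N u ω) (nhdsWithin t (Set.Ioi t)) (nhds (N t ω)))
    (hN_int : ∀ᵐ ω ∂P, ∀ t ∈ Set.Icc (0:ℝ) T, ∃ k : ℕ, N t ω = k)
    (hW_gauss : ∀ s t : ℝ, 0 ≤ s → s ≤ t → t ≤ T →
      Measure.map (fun ω => W t ω - W s ω) P = gaussianReal 0 (Real.toNNReal (t - s)))
    (hN_poisson : ∀ s t : ℝ, 0 ≤ s → s ≤ t → t ≤ T →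
      Measure.map (fun ω => N t ω - N s ω) P
        = Measure.map (fun k : ℕ => (k : ℝ))
            (poissonMeasure (Real.toNNReal (∫ u in s..t, lam u))))
    (h_indep : ∀ s t : ℝ, 0 ≤ s → s ≤ t → t ≤ T →
      Indep (MeasurableSpace.comap (fun ω => (W t ω - W s ω, N t ω - N s ω)) inferInstance)
        (F s) P)
    (hWN_indep : ∀ s t : ℝ, 0 ≤ s → s ≤ t → t ≤ T →
      IndepFun (fun ω => W t ω - W s ω) (fun ω => N t ω - N s ω) P)
    (μ σ ρ : ℝ → ℝ) (hμ_meas : Measurable μ) (hσ_meas : Measurable σ) (hρ_meas : Measurable ρ)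
    (m : ℕ) (hm : 0 < m) (ζ : Fin m → ℝ) (hζ : StrictMono ζ)
    (hμ_low : ∃ K : NNReal, LipschitzOnWith K μ (Set.Iio (ζ ⟨0, hm⟩)))
    (hμ_high : ∃ K : NNReal, LipschitzOnWith K μ (Set.Ioi (ζ ⟨m - 1, Nat.sub_lt hm one_pos⟩)))
    (hμ_mid : ∀ (k : Fin m) (h : (k : ℕ) + 1 < m),
      ∃ K : NNReal, LipschitzOnWith K μ (Set.Ioo (ζ k) (ζ ⟨(k : ℕ) + 1, h⟩)))
    (hσ_lip : ∃ K : NNReal, LipschitzWith K σ)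
    (hσ_nz : ∀ k : Fin m, σ (ζ k) ≠ 0)
    (hρ_lip : ∃ K : NNReal, LipschitzWith K ρ)
    :
    ∃ C : ℝ, 0 < C ∧ ∀ (k : Fin m) (x : ℝ) (n : ℕ), 0 < n → T / n < 1 → ∀ ε : ℝ, 0 < ε →
      ∀ t ∈ Set.Icc (0:ℝ) T,
      ∫⁻ ω, (∫⁻ s in Set.Icc (0:ℝ) t, ENNReal.ofReal
          ((if emProc μ σ ρ W N (T / n) x s ω ∈ Set.Icc (ζ k - ε) (ζ k + ε)
              then (1:ℝ) else 0)
            * σ (emProc μ σ ρ W N (T / n) x (lastGrid (T / n) s) ω) ^ 2)) ∂P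
        ≤ ENNReal.ofReal (C * (1 + |x|) * ε) := by
  have I := EMLT.Inc.mk' F P T hT lam hlam_pos lamB hlamB W N hW_adapted hN_adapted hW_cont
    hN_mono hW_gauss hN_poisson h_indep
  obtain ⟨K1, hK1⟩ := EMLT.growth_mu m hm ζ hμ_low hμ_high hμ_mid
  obtain ⟨K2, hK2⟩ := EMLT.growth_of_lip (S := Set.univ) (hσ_lip.imp fun _ h => h.lipschitzOnWith)
  obtain ⟨K3, hK3⟩ := EMLT.growth_of_lip (S := Set.univ) (hρ_lip.imp fun _ h => h.lipschitzOnWith)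
  set K := max 0 (max K1 (max K2 K3)) with hK
  have hK0 : 0 ≤ K := le_max_left _ _
  have k1 : K1 ≤ K := (le_max_left _ _).trans (le_max_right _ _)
  have k2 : K2 ≤ K := (le_max_left _ _).trans ((le_max_right _ _).trans (le_max_right _ _))
  have k3 : K3 ≤ K := (le_max_right _ _).trans ((le_max_right _ _).trans (le_max_right _ _))
  have gμ : ∀ y, |μ y| ≤ K * (1 + |y|) := fun y =>
    (hK1 y).trans (mul_le_mul_of_nonneg_right k1 (by positivity))
  have gσ : ∀ y, |σ y| ≤ K * (1 + |y|) := fun y =>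
    (hK2 y trivial).trans (mul_le_mul_of_nonneg_right k2 (by positivity))
  have gρ : ∀ y, |ρ y| ≤ K * (1 + |y|) := fun y =>
    (hK3 y trivial).trans (mul_le_mul_of_nonneg_right k3 (by positivity))
  have hΛ := I.Λ0
  set Λ := lamB + lamB ^ 2 * T with hΛdef
  set G := Real.exp ((1 + 14 * K ^ 2 + (1 + 8 * K ^ 2) * Λ) * T) + 1 with hG
  have hG0 : 0 < G := by positivity
  refine ⟨8 * (G + 1) + 8 * T * K * (1 + Λ) * (1 + G), by positivity, ?_⟩
  intro k x n hn hn1 ε hε t ht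
  have hn' : (0:ℝ) < n := by exact_mod_cast hn
  have hδ : 0 < T / n := by positivity
  refine le_trans ?_ (EMLT.main_est I hδ hn1 hK0 n (by field_simp) hμ_meas hσ_meas hρ_meas
    gμ gσ gρ (ζ k) ε hε G hG)
  refine lintegral_mono fun ω => ?_
  refine (lintegral_mono_set (Set.Icc_subset_Icc_right ht.2)).trans_eq ?_
  exact setLIntegral_congr Ico_ae_eq_Icc.symm
end
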